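/- arXiv:2108.09447 — 2 statements merged into one kernel-verified Lean document; each statement's English description precedes it below -/
import Mathlib

section
/- Let 𝐟 : ℝ² → ℝ be a C² function on the open unit disk D = {(u,v) : u² + v² < 1} satisfying the minimal surface equation on D. Let W² = 1 + (∂_u𝐟(0,0))² + (∂_v𝐟(0,0))² and let K be the Gaussian curvature of the graph of 𝐟 at the point above the origin. Then W² |K| < 5.8. -/
open Real Set

/-- Partial derivative in the `u` (first coordinate) direction. -/
noncomputable def pdu (f : ℝ × ℝ → ℝ) (p : ℝ × ℝ) : ℝ := lineDeriv ℝ f p (1, 0)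

/-- Partial derivative in the `v` (second coordinate) direction. -/
noncomputable def pdv (f : ℝ × ℝ → ℝ) (p : ℝ × ℝ) : ℝ := lineDeriv ℝ f p (0, 1)

/-- The open unit disk in `ℝ²`. -/
def unitDisk : Set (ℝ × ℝ) := {p | p.1 ^ 2 + p.2 ^ 2 < 1}

/-- The Gaussian curvature of the graph of `f` at the point above `p`. -/
noncomputable def gaussCurv (f : ℝ × ℝ → ℝ) (p : ℝ × ℝ) : ℝ :=
  (pdu (pdu f) p * pdv (pdv f) p - (pdv (pdu f) p) ^ 2) /
    (1 + (pdu f p) ^ 2 + (pdv f p) ^ 2) ^ 2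

/-- `f` satisfies the minimal surface equation on `D`. -/
def MinimalSurfaceEq (f : ℝ × ℝ → ℝ) (D : Set (ℝ × ℝ)) : Prop :=
  ∀ p ∈ D, (1 + (pdv f p) ^ 2) * pdu (pdu f) p
      - 2 * pdu f p * pdv f p * pdv (pdu f) p
      + (1 + (pdu f p) ^ 2) * pdv (pdv f) p = 0

/-- `ζ` is an `h`-symmetric point of `f`: `h` is a unit vector,
`∇ₕ f(ζ) = 0` and `∇²_{h, ih} f(ζ) = 0` where `ih = (-h₂, h₁)`. -/
def IsSymmetricPt (f : ℝ × ℝ → ℝ) (ζ : ℝ × ℝ) (h : ℝ × ℝ) : Prop :=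
  h.1 ^ 2 + h.2 ^ 2 = 1 ∧ lineDeriv ℝ f ζ h = 0 ∧
    lineDeriv ℝ (fun p => lineDeriv ℝ f p h) ζ (-h.2, h.1) = 0

section RiemannMapping

open Filter Metric Topology Complex

/-- A pointwise limit of holomorphic functions with values in the unit disk is a locally uniform
limit. -/
lemma tendstoLocallyUniformlyOn_of_mapsTo_ball {ι : Type*} {l : Filter ι} [l.NeBot] {Ω : Set ℂ}
    (ho : IsOpen Ω) {φ : ι → ℂ → ℂ} {ψ : ℂ → ℂ} (hd : ∀ k, DifferentiableOn ℂ (φ k) Ω)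
    (hm : ∀ k, MapsTo (φ k) Ω (ball 0 1)) (hl : ∀ z ∈ Ω, Tendsto (fun k => φ k z) l (𝓝 (ψ z))) :
    TendstoLocallyUniformlyOn φ ψ l Ω := by
  rw [Metric.tendstoLocallyUniformlyOn_iff]
  intro ε hε x hx
  obtain ⟨R, hR, hRΩ⟩ := Metric.isOpen_iff.1 ho x hx
  have key : ∀ k, ∀ y ∈ ball x R, dist (φ k y) (φ k x) ≤ 2 / R * dist y x := by
    intro k y hy
    refine Complex.dist_le_div_mul_dist_of_mapsTo_ball ((hd k).mono hRΩ) ?_ hy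
    intro z hz
    have h1 := hm k (hRΩ hz)
    have h2 := hm k hx
    rw [mem_ball_zero_iff] at h1 h2
    rw [mem_closedBall, dist_eq_norm]
    linarith [norm_sub_le (φ k z) (φ k x)]
  have keyl : ∀ y ∈ ball x R, dist (ψ y) (ψ x) ≤ 2 / R * dist y x := fun y hy =>
    le_of_tendsto ((hl y (hRΩ hy)).dist (hl x hx)) (Eventually.of_forall fun k => key k y hy)
  have hδ : 0 < min R (ε * R / 6) := by positivity
  refine ⟨ball x (min R (ε * R / 6)), mem_nhdsWithin_of_mem_nhds (ball_mem_nhds x hδ), ?_⟩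
  filter_upwards [(Metric.tendsto_nhds.1 (hl x hx)) (ε / 3) (by positivity)] with k hk y hy
  have hyR : y ∈ ball x R := ball_subset_ball (min_le_left _ _) hy
  have hd' : 2 / R * dist y x < ε / 3 := by
    have : dist y x < ε * R / 6 := lt_of_lt_of_le hy (min_le_right _ _)
    calc 2 / R * dist y x < 2 / R * (ε * R / 6) := by gcongr
      _ = ε / 3 := by field_simp; norm_num
  have h1 := key k y hyR
  have h2 := keyl y hyR
  have h3 := dist_triangle4 (ψ y) (ψ x) (φ k x) (φ k y)
  rw [dist_comm (ψ x), dist_comm (φ k x) (φ k y)] at h3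
  linarith

/-- **Hurwitz's theorem**, local form. -/
lemma eventually_eq_zero_of_tendstoLocallyUniformlyOn {ι : Type*} {l : Filter ι} [l.NeBot]
    {U : Set ℂ} (ho : IsOpen U) {φ : ι → ℂ → ℂ} {ψ : ℂ → ℂ}
    (hd : ∀ k, DifferentiableOn ℂ (φ k) U) (h0 : ∀ k, ∀ z ∈ U, φ k z ≠ 0)
    (hl : TendstoLocallyUniformlyOn φ ψ l U) {z : ℂ} (hz : z ∈ U) (hψ : ψ z = 0) :
    ∀ᶠ y in 𝓝 z, ψ y = 0 := by
  have hψd : DifferentiableOn ℂ ψ U := hl.differentiableOn (Eventually.of_forall hd) ho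
  rcases (hψd.analyticAt (ho.mem_nhds hz)).eventually_eq_zero_or_eventually_ne_zero with h | h
  · exact h
  exfalso
  rw [eventually_nhdsWithin_iff] at h
  obtain ⟨R, hR, hball⟩ := Metric.eventually_nhds_iff_ball.1 (h.and (ho.mem_nhds hz))
  set r := R / 2 with hr
  have hr0 : 0 < r := by positivity
  have hcb : closedBall z r ⊆ U := fun y hy => (hball y (closedBall_subset_ball (by
    rw [hr]; linarith) hy)).2
  have hsU : sphere z r ⊆ U := sphere_subset_closedBall.trans hcb
  obtain ⟨w, hw, hmin⟩ := (isCompact_sphere z r).exists_isMinOn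
    (NormedSpace.sphere_nonempty.2 hr0.le) (hψd.continuousOn.mono hsU).norm
  have hwpos : 0 < ‖ψ w‖ := by
    rw [norm_pos_iff]
    refine (hball w ?_).1 ?_
    · exact sphere_subset_ball (by rw [hr]; linarith) hw
    · rintro rfl
      simp at hw
      exact hr0.ne hw
  set μ := ‖ψ w‖ / 2 with hμ
  have hμ0 : 0 < μ := by positivity
  have hunif := (tendstoLocallyUniformlyOn_iff_forall_isCompact ho).1 hl (sphere z r) hsU
    (isCompact_sphere z r)
  have hev : ∀ᶠ k in l, μ ≤ ‖φ k z‖ := by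
    filter_upwards [Metric.tendstoUniformlyOn_iff.1 hunif μ hμ0] with k hk
    have hb : ∀ y ∈ sphere z r, ‖(φ k y)⁻¹‖ ≤ μ⁻¹ := by
      intro y hy
      rw [norm_inv]
      have h1 : ‖ψ w‖ ≤ ‖ψ y‖ := hmin hy
      have h2 := hk y hy
      rw [dist_eq_norm] at h2
      have h3 := norm_sub_norm_le (ψ y) (φ k y)
      exact inv_anti₀ hμ0 (by linarith)
    have := Complex.norm_le_of_forall_mem_frontier_norm_le (f := fun y => (φ k y)⁻¹)
      (U := ball z r) isBounded_ball (by
        apply DifferentiableOn.diffContOnCl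
        rw [closure_ball z hr0.ne']
        exact ((hd k).mono hcb).inv fun y hy => h0 k y (hcb hy)) (C := μ⁻¹) (by
        rw [frontier_ball z hr0.ne']; exact hb) (subset_closure (mem_ball_self hr0))
    rw [norm_inv] at this
    exact (inv_le_inv₀ (norm_pos_iff.2 (h0 k z hz)) hμ0).1 this
  have := ge_of_tendsto ((hl.tendsto_at hz).norm) hev
  rw [hψ, norm_zero] at this
  linarith

/-- Vanishing of the derivative near a point propagates through a connected open set. -/
lemma deriv_ne_zero_of_frequently {Ω : Set ℂ} (ho : IsOpen Ω) (hc : IsPreconnected Ω)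
    {φ : ℂ → ℂ} (hd : DifferentiableOn ℂ φ Ω) {a : ℂ} (ha : a ∈ Ω) (hφ : deriv φ a ≠ 0)
    {b : ℂ} (hb : b ∈ Ω) : ¬ ∀ᶠ y in 𝓝 b, deriv φ y = 0 := by
  intro h
  have han : AnalyticOnNhd ℂ (deriv φ) Ω := (hd.deriv ho).analyticOnNhd ho
  exact hφ (han.eqOn_zero_of_preconnected_of_eventuallyEq_zero hc hb h ha)

/-- The competing maps in the extremal problem of the Riemann mapping theorem. -/
structure IsRiemannCandidate (Ω : Set ℂ) (φ : ℂ → ℂ) : Prop where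
  differentiableOn : DifferentiableOn ℂ φ Ω
  mapsTo : MapsTo φ Ω (ball 0 1)
  injOn : InjOn φ Ω
  deriv_ne : ∀ z ∈ Ω, deriv φ z ≠ 0
  map_zero : φ 0 = 0

lemma IsRiemannCandidate.of_tendsto {ι : Type*} {l : Filter ι} [l.NeBot] {Ω : Set ℂ}
    (ho : IsOpen Ω) (hc : IsPreconnected Ω) (h0 : 0 ∈ Ω) {φ : ι → ℂ → ℂ} {ψ : ℂ → ℂ}
    (hφ : ∀ k, IsRiemannCandidate Ω (φ k))
    (hl : ∀ z ∈ Ω, Tendsto (fun k => φ k z) l (𝓝 (ψ z))) {S : ℝ} (hS : 0 < S)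
    (hlS : Tendsto (fun k => ‖deriv (φ k) 0‖) l (𝓝 S)) :
    IsRiemannCandidate Ω ψ ∧ ‖deriv ψ 0‖ = S := by
  have hlu := tendstoLocallyUniformlyOn_of_mapsTo_ball ho (fun k => (hφ k).differentiableOn)
    (fun k => (hφ k).mapsTo) hl
  have hd : DifferentiableOn ℂ ψ Ω :=
    hlu.differentiableOn (Eventually.of_forall fun k => (hφ k).differentiableOn) ho
  have hlud := hlu.deriv (Eventually.of_forall fun k => (hφ k).differentiableOn) ho
  have hderiv0 : ‖deriv ψ 0‖ = S := tendsto_nhds_unique (hlud.tendsto_at h0).norm hlS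
  have hne0 : deriv ψ 0 ≠ 0 := by
    rw [← norm_pos_iff, hderiv0]; exact hS
  have hnc : ∀ b ∈ Ω, ¬ ∀ᶠ y in 𝓝 b, ψ y = ψ b := by
    intro b hb h
    refine deriv_ne_zero_of_frequently ho hc hd h0 hne0 hb ?_
    filter_upwards [h.eventually_nhds] with y hy
    rw [EventuallyEq.deriv_eq (f := fun _ => ψ b) hy]
    simp
  refine ⟨⟨hd, ?_, ?_, ?_, ?_⟩, hderiv0⟩
  · have hle : ∀ z ∈ Ω, ‖ψ z‖ ≤ 1 := fun z hz =>
      le_of_tendsto (hl z hz).norm (Eventually.of_forall fun k =>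
        (mem_ball_zero_iff.1 ((hφ k).mapsTo hz)).le)
    intro z hz
    rw [mem_ball_zero_iff]
    refine lt_of_le_of_ne (hle z hz) fun h1 => hnc z hz ?_
    refine Complex.eventually_eq_of_isLocalMax_norm ?_ ?_
    · filter_upwards [ho.mem_nhds hz] with y hy
      exact hd.differentiableAt (ho.mem_nhds hy)
    · filter_upwards [ho.mem_nhds hz] with y hy
      simp only [Function.comp]
      rw [h1]
      exact hle y hy
  · intro a ha b hb hab
    by_contra hne
    have hU : IsOpen (Ω \ {a}) := ho.sdiff isClosed_singleton
    have hlu' : TendstoLocallyUniformlyOn (fun k z => φ k z - φ k a) (fun z => ψ z - ψ a) l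
        (Ω \ {a}) := by
      rw [Metric.tendstoLocallyUniformlyOn_iff]
      intro ε hε x hx
      obtain ⟨t, ht, hev⟩ := Metric.tendstoLocallyUniformlyOn_iff.1 hlu (ε / 2) (by positivity)
        x hx.1
      refine ⟨t, nhdsWithin_mono _ sdiff_subset ht, ?_⟩
      filter_upwards [hev, (Metric.tendsto_nhds.1 (hl a ha)) (ε / 2) (by positivity)] with k h1 h2
        y hy
      have h3 := h1 y hy
      rw [dist_comm] at h2
      calc dist (ψ y - ψ a) (φ k y - φ k a) ≤ dist (ψ y) (φ k y) + dist (ψ a) (φ k a) :=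
            dist_sub_sub_le _ _ _ _
        _ < ε := by linarith
    have hz := eventually_eq_zero_of_tendstoLocallyUniformlyOn hU
      (fun k => (((hφ k).differentiableOn).mono sdiff_subset).sub_const _)
      (fun k z hz h => hz.2 ((hφ k).injOn hz.1 ha (sub_eq_zero.1 h))) hlu' (z := b)
      ⟨hb, fun h => hne h.symm⟩ (by simp [hab])
    refine hnc b hb ?_
    filter_upwards [hz] with y hy
    rw [← hab]
    exact sub_eq_zero.1 hy
  · intro z hz h
    exact deriv_ne_zero_of_frequently ho hc hd h0 hne0 hz
      (eventually_eq_zero_of_tendstoLocallyUniformlyOn ho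
        (fun k => (hφ k).differentiableOn.deriv ho) (fun k => (hφ k).deriv_ne) hlud hz h)
  · refine tendsto_nhds_unique (hl 0 h0) ?_
    simp only [(hφ _).map_zero]
    exact tendsto_const_nhds

/-- The disk automorphism exchanging the roles of `w` and `0`. -/
noncomputable def diskAut (w z : ℂ) : ℂ := (z - w) / (1 - (starRingEnd ℂ) w * z)

lemma one_sub_conj_mul_ne_zero {w z : ℂ} (hw : ‖w‖ < 1) (hz : ‖z‖ < 1) :
    1 - (starRingEnd ℂ) w * z ≠ 0 := by
  intro h
  have h1 : ‖(starRingEnd ℂ) w * z‖ = 1 := by rw [← sub_eq_zero.1 h]; simp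
  rw [norm_mul, RCLike.norm_conj] at h1
  nlinarith [norm_nonneg w, norm_nonneg z]

lemma norm_diskAut_lt_one {w z : ℂ} (hw : ‖w‖ < 1) (hz : ‖z‖ < 1) : ‖diskAut w z‖ < 1 := by
  have hne := one_sub_conj_mul_ne_zero hw hz
  rw [diskAut, norm_div, div_lt_one (norm_pos_iff.2 hne)]
  refine lt_of_pow_lt_pow_left₀ 2 (norm_nonneg _) ?_
  have h1 : ‖w‖ ^ 2 < 1 := by nlinarith [norm_nonneg w]
  have h2 : ‖z‖ ^ 2 < 1 := by nlinarith [norm_nonneg z]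
  have h3 : 0 < (1 - ‖w‖ ^ 2) * (1 - ‖z‖ ^ 2) := mul_pos (by linarith) (by linarith)
  rw [← Complex.normSq_eq_norm_sq, ← Complex.normSq_eq_norm_sq] at h3 ⊢
  simp only [Complex.normSq_apply, Complex.sub_re, Complex.sub_im, Complex.mul_re, Complex.mul_im,
    Complex.conj_re, Complex.conj_im, Complex.one_re, Complex.one_im] at h3 ⊢
  nlinarith

lemma diskAut_injOn {w : ℂ} (hw : ‖w‖ < 1) : InjOn (diskAut w) (ball 0 1) := by
  intro x hx y hy hxy
  rw [mem_ball_zero_iff] at hx hy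
  have h1 := one_sub_conj_mul_ne_zero hw hx
  have h2 := one_sub_conj_mul_ne_zero hw hy
  have h3 := one_sub_conj_mul_ne_zero hw hw
  rw [diskAut, diskAut, div_eq_div_iff h1 h2] at hxy
  have : (1 - (starRingEnd ℂ) w * w) * (x - y) = 0 := by linear_combination hxy
  exact sub_eq_zero.1 ((mul_eq_zero.1 this).resolve_left h3)

lemma hasDerivAt_diskAut {w z : ℂ} (hw : ‖w‖ < 1) (hz : ‖z‖ < 1) :
    HasDerivAt (diskAut w) ((1 - (starRingEnd ℂ) w * w) / (1 - (starRingEnd ℂ) w * z) ^ 2) z := by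
  have hne := one_sub_conj_mul_ne_zero hw hz
  have := ((hasDerivAt_id z).sub_const w).div
    (((hasDerivAt_id z).const_mul ((starRingEnd ℂ) w)).const_sub 1) hne
  refine this.congr_deriv ?_
  simp only [id]
  congr 1
  ring

/-- Koebe's square-root trick. -/
lemma IsRiemannCandidate.exists_deriv_lt {Ω : Set ℂ} (ho : IsOpen Ω) (h0 : 0 ∈ Ω)
    (hsqrt : ∀ φ : ℂ → ℂ, DifferentiableOn ℂ φ Ω → (∀ z ∈ Ω, φ z ≠ 0) →
      ∃ ψ : ℂ → ℂ, DifferentiableOn ℂ ψ Ω ∧ ∀ z ∈ Ω, ψ z ^ 2 = φ z)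
    {φ : ℂ → ℂ} (hφ : IsRiemannCandidate Ω φ) {w : ℂ} (hw : ‖w‖ < 1) (hwφ : w ∉ φ '' Ω) :
    ∃ χ, IsRiemannCandidate Ω χ ∧ ‖deriv φ 0‖ < ‖deriv χ 0‖ := by
  have hφ1 : ∀ z ∈ Ω, ‖φ z‖ < 1 := fun z hz => mem_ball_zero_iff.1 (hφ.mapsTo hz)
  have hφd : ∀ z ∈ Ω, HasDerivAt φ (deriv φ z) z := fun z hz =>
    (hφ.differentiableOn.differentiableAt (ho.mem_nhds hz)).hasDerivAt
  have hTd : ∀ z ∈ Ω, HasDerivAt (fun y => diskAut w (φ y))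
      ((1 - (starRingEnd ℂ) w * w) / (1 - (starRingEnd ℂ) w * φ z) ^ 2 * deriv φ z) z :=
    fun z hz => (hasDerivAt_diskAut hw (hφ1 z hz)).comp z (hφd z hz)
  have hTne : ∀ z ∈ Ω, diskAut w (φ z) ≠ 0 := by
    intro z hz h
    rw [diskAut, div_eq_zero_iff] at h
    rcases h with h | h
    · exact hwφ ⟨z, hz, sub_eq_zero.1 h⟩
    · exact one_sub_conj_mul_ne_zero hw (hφ1 z hz) h
  obtain ⟨ψ, hψd, hψ⟩ := hsqrt (fun y => diskAut w (φ y))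
    (fun z hz => (hTd z hz).differentiableAt.differentiableWithinAt) hTne
  have hψ1 : ∀ z ∈ Ω, ‖ψ z‖ < 1 := by
    intro z hz
    have h1 : ‖ψ z‖ ^ 2 < 1 := by
      rw [← norm_pow, hψ z hz]; exact norm_diskAut_lt_one hw (hφ1 z hz)
    nlinarith [norm_nonneg (ψ z)]
  have hψ0 : ‖ψ 0‖ < 1 := hψ1 0 h0
  have hψh : ∀ z ∈ Ω, HasDerivAt ψ (deriv ψ z) z := fun z hz =>
    (hψd.differentiableAt (ho.mem_nhds hz)).hasDerivAt
  have hψeq : ∀ z ∈ Ω, 2 * ψ z * deriv ψ z =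
      (1 - (starRingEnd ℂ) w * w) / (1 - (starRingEnd ℂ) w * φ z) ^ 2 * deriv φ z := by
    intro z hz
    have h1 : HasDerivAt (fun y => ψ y ^ 2) (2 * ψ z * deriv ψ z) z := by
      simpa using (hψh z hz).fun_pow 2
    refine h1.unique ((hTd z hz).congr_of_eventuallyEq ?_)
    filter_upwards [ho.mem_nhds hz] with y hy using hψ y hy
  have hww := one_sub_conj_mul_ne_zero hw hw
  have hψne : ∀ z ∈ Ω, deriv ψ z ≠ 0 := by
    intro z hz h
    have h1 := hψeq z hz
    rw [h, mul_zero] at h1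
    exact mul_ne_zero (div_ne_zero hww (pow_ne_zero 2 (one_sub_conj_mul_ne_zero hw (hφ1 z hz))))
      (hφ.deriv_ne z hz) h1.symm
  have hψinj : InjOn ψ Ω := by
    intro a ha b hb hab
    refine hφ.injOn ha hb (diskAut_injOn hw (hφ.mapsTo ha) (hφ.mapsTo hb) ?_)
    have h1 := hψ a ha
    have h2 := hψ b hb
    rw [← h1, ← h2, hab]
  have hχd : ∀ z ∈ Ω, HasDerivAt (fun y => diskAut (ψ 0) (ψ y))
      ((1 - (starRingEnd ℂ) (ψ 0) * ψ 0) / (1 - (starRingEnd ℂ) (ψ 0) * ψ z) ^ 2 * deriv ψ z) z :=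
    fun z hz => (hasDerivAt_diskAut hψ0 (hψ1 z hz)).comp z (hψh z hz)
  have h00 := one_sub_conj_mul_ne_zero hψ0 hψ0
  refine ⟨fun y => diskAut (ψ 0) (ψ y), ⟨fun z hz =>
    (hχd z hz).differentiableAt.differentiableWithinAt, fun z hz =>
    mem_ball_zero_iff.2 (norm_diskAut_lt_one hψ0 (hψ1 z hz)), fun a ha b hb hab =>
    hψinj ha hb (diskAut_injOn hψ0 (mem_ball_zero_iff.2 (hψ1 a ha))
      (mem_ball_zero_iff.2 (hψ1 b hb)) hab), fun z hz => ?_, by simp [diskAut]⟩, ?_⟩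
  · rw [(hχd z hz).deriv]
    exact mul_ne_zero (div_ne_zero h00 (pow_ne_zero 2 (one_sub_conj_mul_ne_zero hψ0 (hψ1 z hz))))
      (hψne z hz)
  · rw [(hχd 0 h0).deriv]
    have e1 := hψeq 0 h0
    rw [hφ.map_zero] at e1
    have e2 := hψ 0 h0
    simp only [diskAut, hφ.map_zero, mul_zero, sub_zero, div_one, zero_sub] at e2
    set s := ‖ψ 0‖ with hs
    have hsw : ‖w‖ = s ^ 2 := by rw [hs, ← norm_pow, e2, norm_neg]
    have hw0 : w ≠ 0 := by
      rintro rfl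
      exact hwφ ⟨0, h0, hφ.map_zero⟩
    have hs0 : 0 < s := by
      rw [hs, norm_pos_iff]
      rintro h
      rw [h] at e2
      simp at e2
      exact hw0 e2
    have n1 : ‖1 - (starRingEnd ℂ) w * w‖ = 1 - s ^ 4 := by
      rw [Complex.conj_mul', hsw]
      rw [show (1 : ℂ) - ((s ^ 2 : ℝ) : ℂ) ^ 2 = ((1 - s ^ 4 : ℝ) : ℂ) by push_cast; ring,
        Complex.norm_real, Real.norm_of_nonneg]
      have : s ^ 4 ≤ 1 := pow_le_one₀ hs0.le hψ0.le
      linarith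
    have n2 : ‖1 - (starRingEnd ℂ) (ψ 0) * ψ 0‖ = 1 - s ^ 2 := by
      rw [Complex.conj_mul', ← hs]
      rw [show (1 : ℂ) - (s : ℂ) ^ 2 = ((1 - s ^ 2 : ℝ) : ℂ) by push_cast; ring,
        Complex.norm_real, Real.norm_of_nonneg]
      have : s ^ 2 ≤ 1 := pow_le_one₀ hs0.le hψ0.le
      linarith
    have e3 := congrArg norm e1
    rw [norm_mul, norm_mul, norm_mul, norm_div, n1, ← hs] at e3
    simp only [mul_zero, sub_zero, one_pow, norm_one, div_one, RCLike.norm_ofNat] at e3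
    rw [norm_mul, norm_div, norm_pow, n2]
    have hp : 0 < 1 - s ^ 2 := by nlinarith
    rw [show (1 - s ^ 2) / (1 - s ^ 2) ^ 2 * ‖deriv ψ 0‖ = ‖deriv ψ 0‖ / (1 - s ^ 2) by
      field_simp, lt_div_iff₀ hp]
    have hdp : 0 < ‖deriv φ 0‖ := norm_pos_iff.2 (hφ.deriv_ne 0 h0)
    have : 2 * s * (‖deriv φ 0‖ * (1 - s ^ 2)) < 2 * s * ‖deriv ψ 0‖ := by
      rw [e3]
      have h1 : 0 < ‖deriv φ 0‖ * (1 - s ^ 2) * (1 - s) ^ 2 := by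
        have : 0 < 1 - s := by linarith
        positivity
      nlinarith
    exact lt_of_mul_lt_mul_left this (by positivity)

/-- **Riemann mapping theorem** for bounded domains on which holomorphic square roots exist. -/
theorem exists_riemannCandidate_surjOn {Ω : Set ℂ} (ho : IsOpen Ω) (hc : IsPreconnected Ω)
    (hb : Bornology.IsBounded Ω) (h0 : 0 ∈ Ω)
    (hsqrt : ∀ φ : ℂ → ℂ, DifferentiableOn ℂ φ Ω → (∀ z ∈ Ω, φ z ≠ 0) →
      ∃ ψ : ℂ → ℂ, DifferentiableOn ℂ ψ Ω ∧ ∀ z ∈ Ω, ψ z ^ 2 = φ z) :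
    ∃ φ, IsRiemannCandidate Ω φ ∧ SurjOn φ Ω (ball 0 1) := by
  obtain ⟨B, hB⟩ := hb.exists_norm_le
  have hB0 : 0 ≤ B := by simpa using hB 0 h0
  have hcand : IsRiemannCandidate Ω (fun z => z / ((B + 1 : ℝ) : ℂ)) := by
    have hne : ((B + 1 : ℝ) : ℂ) ≠ 0 := by
      exact_mod_cast (by linarith : B + 1 ≠ 0)
    refine ⟨differentiableOn_id.div_const _, fun z hz => ?_, fun a _ b _ hab => ?_, fun z _ => ?_,
      by simp⟩
    · rw [mem_ball_zero_iff, norm_div, Complex.norm_real, Real.norm_of_nonneg (by linarith),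
        div_lt_one (by linarith)]
      linarith [hB z hz]
    · exact (div_left_inj' hne).1 hab
    · rw [((hasDerivAt_id' z).div_const _).deriv]
      exact one_div_ne_zero hne
  obtain ⟨R, hR, hRΩ⟩ := Metric.isOpen_iff.1 ho 0 h0
  set T : Set ℝ := (fun φ => ‖deriv φ 0‖) '' {φ | IsRiemannCandidate Ω φ} with hT
  have hTne : T.Nonempty := ⟨_, _, hcand, rfl⟩
  have hTb : BddAbove T := by
    refine ⟨1 / R, ?_⟩
    rintro _ ⟨φ, hφ, rfl⟩
    refine Complex.norm_deriv_le_div_of_mapsTo_ball (hφ.differentiableOn.mono hRΩ) ?_ hR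
    rw [hφ.map_zero]
    exact (hφ.mapsTo.mono_left hRΩ).mono_right ball_subset_closedBall
  obtain ⟨u, -, hu, huT⟩ := exists_seq_tendsto_sSup hTne hTb
  choose φ hφ hφu using huT
  have hSpos : 0 < sSup T := lt_of_lt_of_le (norm_pos_iff.2 (hcand.deriv_ne 0 h0))
    (le_csSup hTb ⟨_, hcand, rfl⟩)
  have hlim : ∀ z, ∃ y, z ∈ Ω → Tendsto (fun k => φ k z) (hyperfilter ℕ) (𝓝 y) := by
    intro z
    by_cases hz : z ∈ Ω
    · obtain ⟨y, -, hy⟩ := (isCompact_closedBall (0 : ℂ) 1).ultrafilter_le_nhds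
        ((hyperfilter ℕ).map fun k => φ k z) (by
          rw [le_principal_iff]
          show _ ∈ Filter.map (fun k => φ k z) (hyperfilter ℕ : Filter ℕ)
          exact Filter.mem_map.2 <| univ_mem' fun k => ball_subset_closedBall ((hφ k).mapsTo hz))
      exact ⟨y, fun _ => hy⟩
    · exact ⟨0, fun h => absurd h hz⟩
  choose ψ hψ using hlim
  obtain ⟨hψc, hψS⟩ := IsRiemannCandidate.of_tendsto (l := (hyperfilter ℕ : Filter ℕ)) ho hc h0
    hφ hψ hSpos (by
      simp only [hφu]
      exact hu.mono_left (Nat.hyperfilter_le_atTop))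
  refine ⟨ψ, hψc, fun w hw => ?_⟩
  by_contra hwψ
  obtain ⟨χ, hχ, hlt⟩ := hψc.exists_deriv_lt ho h0 hsqrt (mem_ball_zero_iff.1 hw) hwψ
  rw [hψS] at hlt
  exact absurd (le_csSup hTb ⟨χ, hχ, rfl⟩) (not_le.2 hlt)

end RiemannMapping

section BoundaryAngle

open Filter Metric Topology MeasureTheory
open scoped ContDiff

/-- The cut-off angular form `b(t) χ(|F|²) Im (∂_w F / F)` in direction `w`. -/
noncomputable def angularForm (F : ℝ × ℝ → ℂ) (b χ : ℝ → ℝ) (w p : ℝ × ℝ) : ℝ :=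
  b p.2 * χ (Complex.normSq (F p)) * (fderiv ℝ F p w / F p).im

lemma contDiffOn_angularForm {U : Set (ℝ × ℝ)} (hU : IsOpen U) {F : ℝ × ℝ → ℂ}
    (hF : ContDiffOn ℝ 2 F U) (hne : ∀ p ∈ U, F p ≠ 0) {b χ : ℝ → ℝ} (hb : ContDiff ℝ 1 b)
    (hχ : ContDiff ℝ 1 χ) (w : ℝ × ℝ) : ContDiffOn ℝ 1 (angularForm F b χ w) U := by
  have hF1 : ContDiffOn ℝ 1 F U := hF.of_le (by norm_num)
  have hdF : ContDiffOn ℝ 1 (fun p => fderiv ℝ F p w) U :=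
    (hF.fderiv_of_isOpen hU (by norm_num)).clm_apply contDiffOn_const
  have hq : ContDiffOn ℝ 1 (fun p => (fderiv ℝ F p w / F p).im) U :=
    Complex.imCLM.contDiff.comp_contDiffOn
      (by simpa only [div_eq_mul_inv] using hdF.mul (hF1.inv hne))
  have hs : ContDiffOn ℝ 1 (fun p => Complex.normSq (F p)) U := by
    simp only [Complex.normSq_apply]
    have hre : ContDiffOn ℝ 1 (fun p => (F p).re) U := Complex.reCLM.contDiff.comp_contDiffOn hF1
    have him : ContDiffOn ℝ 1 (fun p => (F p).im) U := Complex.imCLM.contDiff.comp_contDiffOn hF1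
    exact (hre.mul hre).add (him.mul him)
  exact ((hb.comp contDiff_snd).contDiffOn.mul (hχ.comp_contDiffOn hs)).mul hq

lemma fderiv_angularForm {U : Set (ℝ × ℝ)} (hU : IsOpen U) {F : ℝ × ℝ → ℂ}
    (hF : ContDiffOn ℝ 2 F U) (hne : ∀ p ∈ U, F p ≠ 0) {b χ : ℝ → ℝ} (hb : ContDiff ℝ 1 b)
    (hχ : ContDiff ℝ 1 χ) (v w : ℝ × ℝ) {p : ℝ × ℝ} (hp : p ∈ U) :
    fderiv ℝ (angularForm F b χ w) p v =
      (deriv b p.2 * v.2 * χ (Complex.normSq (F p)) +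
        b p.2 * (deriv χ (Complex.normSq (F p)) *
          (2 * ((starRingEnd ℂ) (F p) * fderiv ℝ F p v).re))) * (fderiv ℝ F p w / F p).im +
      b p.2 * χ (Complex.normSq (F p)) *
        ((fderiv ℝ (fderiv ℝ F) p v w * F p - fderiv ℝ F p w * fderiv ℝ F p v) / F p ^ 2).im := by
  have hmem := hU.mem_nhds hp
  have hd : DifferentiableAt ℝ (angularForm F b χ w) p :=
    ((contDiffOn_angularForm hU hF hne hb hχ w).contDiffAt hmem).differentiableAt (by norm_num)
  have h1 := hd.hasFDerivAt.hasLineDerivAt v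
  have hFl : HasDerivAt (fun x : ℝ => F (p + x • v)) (fderiv ℝ F p v) 0 :=
    ((hF.contDiffAt hmem).differentiableAt (by norm_num)).hasFDerivAt.hasLineDerivAt v
  have hdFl : HasDerivAt (fun x : ℝ => fderiv ℝ F (p + x • v) w) (fderiv ℝ (fderiv ℝ F) p v w) 0 := by
    have h2 : HasDerivAt (fun x : ℝ => fderiv ℝ F (p + x • v)) (fderiv ℝ (fderiv ℝ F) p v) 0 :=
      ((((hF.fderiv_of_isOpen hU (m := 1) (by norm_num)).contDiffAt hmem).differentiableAt
        (by norm_num)).hasFDerivAt.hasLineDerivAt v)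
    simpa using h2.clm_apply (hasDerivAt_const (0 : ℝ) w)
  have hp0 : p + (0 : ℝ) • v = p := by simp
  have hq := hdFl.fun_div hFl (by rw [hp0]; exact hne p hp)
  rw [hp0] at hq
  have hqi : HasDerivAt (fun x : ℝ => (fderiv ℝ F (p + x • v) w / F (p + x • v)).im) _ 0 :=
    Complex.imCLM.hasFDerivAt.comp_hasDerivAt (0 : ℝ) hq
  have hre : HasDerivAt (fun x : ℝ => (F (p + x • v)).re) (fderiv ℝ F p v).re 0 :=
    Complex.reCLM.hasFDerivAt.comp_hasDerivAt (0 : ℝ) hFl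
  have him : HasDerivAt (fun x : ℝ => (F (p + x • v)).im) (fderiv ℝ F p v).im 0 :=
    Complex.imCLM.hasFDerivAt.comp_hasDerivAt (0 : ℝ) hFl
  have hs : HasDerivAt (fun x : ℝ => Complex.normSq (F (p + x • v)))
      (2 * ((starRingEnd ℂ) (F p) * fderiv ℝ F p v).re) 0 := by
    simp only [Complex.normSq_apply]
    refine ((hre.fun_mul hre).fun_add (him.fun_mul him)).congr_deriv ?_
    simp
    ring
  have hc : HasDerivAt (fun x : ℝ => χ (Complex.normSq (F (p + x • v)))) _ 0 :=
    HasDerivAt.comp (0 : ℝ) ((hχ.differentiable (by norm_num)).differentiableAt.hasDerivAt) hs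
  have hbl : HasDerivAt (fun x : ℝ => b (p + x • v).2) (deriv b p.2 * v.2) 0 := by
    have h3 : HasDerivAt (fun x : ℝ => p.2 + x * v.2) v.2 0 := by
      simpa using ((hasDerivAt_id' (0 : ℝ)).mul_const v.2).const_add p.2
    have h4 : HasDerivAt b (deriv b p.2) (p.2 + 0 * v.2) := by
      simpa using (hb.differentiable (by norm_num)).differentiableAt.hasDerivAt
    exact h4.comp (0 : ℝ) h3
  have h5 := (hbl.fun_mul hc).fun_mul hqi
  have h6 := HasDerivAt.unique (h1 : HasDerivAt (fun x : ℝ => angularForm F b χ w (p + x • v)) _ 0)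
    h5
  rw [h6]
  simp only [hp0, Complex.imCLM_apply]

/-- Green's formula for the cut-off angular form gives an almost-monotonicity of the argument. -/
lemma angularForm_integral_ge {F : ℝ × ℝ → ℂ} (hF : ContDiffOn ℝ 2 F {p | p.1 < 0})
    (hne : ∀ p : ℝ × ℝ, p.1 < 0 → F p ≠ 0) (hper : ∀ p, F (p + (0, 2 * π)) = F p)
    (hJ : ∀ p : ℝ × ℝ, p.1 < 0 →
      0 ≤ ((starRingEnd ℂ) (fderiv ℝ F p (1, 0)) * fderiv ℝ F p (0, 1)).im)
    {b χ : ℝ → ℝ} (hb : ContDiff ℝ 1 b) (hbper : ∀ t, b (t + 2 * π) = b t) (hb0 : ∀ t, 0 ≤ b t)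
    (hb1 : ∀ t, |deriv b t| ≤ 1) (hχ : ContDiff ℝ 1 χ) (hχm : Monotone χ) (hχ0 : ∀ x, 0 ≤ χ x)
    (hχ1 : ∀ x, χ x ≤ 1) {σ₀ σ₁ : ℝ} (h01 : σ₀ ≤ σ₁) (h1 : σ₁ < 0) :
    (∫ t in 0..2 * π, angularForm F b χ (0, 1) (σ₀, t)) -
        (∫ p in Icc (σ₀, 0) (σ₁, 2 * π), ‖fderiv ℝ F p (1, 0)‖ / ‖F p‖)
      ≤ ∫ t in 0..2 * π, angularForm F b χ (0, 1) (σ₁, t) := by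
  have hU : IsOpen {p : ℝ × ℝ | p.1 < 0} := isOpen_lt continuous_fst continuous_const
  have hsub : Icc ((σ₀, 0) : ℝ × ℝ) (σ₁, 2 * π) ⊆ {p : ℝ × ℝ | p.1 < 0} := fun p hp =>
    lt_of_le_of_lt hp.2.1 h1
  have hP := contDiffOn_angularForm hU hF hne hb hχ (0, 1)
  have hR := (contDiffOn_angularForm hU hF hne hb hχ (1, 0)).neg
  have hcont : ∀ {Q : ℝ × ℝ → ℝ}, ContDiffOn ℝ 1 Q {p : ℝ × ℝ | p.1 < 0} → ∀ v : ℝ × ℝ,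
      ContinuousOn (fun p => fderiv ℝ Q p v) (Icc ((σ₀, 0) : ℝ × ℝ) (σ₁, 2 * π)) := fun hQ v =>
    ((hQ.continuousOn_fderiv_of_isOpen hU le_rfl).clm_apply continuousOn_const).mono hsub
  have h_integral : IntegrableOn (fun p => fderiv ℝ (angularForm F b χ (0, 1)) p (1, 0) +
      fderiv ℝ (fun p => - angularForm F b χ (1, 0) p) p (0, 1))
      (Icc ((σ₀, 0) : ℝ × ℝ) (σ₁, 2 * π)) :=
    ((hcont hP _).add (hcont hR _)).integrableOn_compact isCompact_Icc
  have hdiff : ∀ {Q : ℝ × ℝ → ℝ}, ContDiffOn ℝ 1 Q {p : ℝ × ℝ | p.1 < 0} →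
      ∀ p ∈ Ioo σ₀ σ₁ ×ˢ Ioo 0 (2 * π), HasFDerivAt Q (fderiv ℝ Q p) p := fun hQ p hp =>
    ((hQ.contDiffAt (hU.mem_nhds (lt_trans hp.1.2 h1))).differentiableAt
      (by norm_num)).hasFDerivAt
  have green := integral_divergence_prod_Icc_of_hasFDerivAt_of_le (angularForm F b χ (0, 1))
    (fun p => - angularForm F b χ (1, 0) p) _ _ (σ₀, 0) (σ₁, 2 * π)
    ⟨h01, by positivity⟩ (hP.continuousOn.mono hsub) (hR.continuousOn.mono hsub) (hdiff hP)
    (hdiff hR) h_integral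
  have hFper : ∀ p, fderiv ℝ F (p + (0, 2 * π)) = fderiv ℝ F p := by
    intro p
    rw [← fderiv_comp_add_right]
    simp only [hper]
  have hRper : ∀ x, angularForm F b χ (1, 0) (x, 2 * π) = angularForm F b χ (1, 0) (x, 0) := by
    intro x
    have e : ((x, 2 * π) : ℝ × ℝ) = (x, 0) + (0, 2 * π) := by simp
    have hb2 := hbper 0
    rw [zero_add] at hb2
    simp only [angularForm]
    rw [e, hper, hFper]
    simp [hb2]
  simp only [hRper, sub_self, zero_add] at green
  have hlow : - (∫ p in Icc ((σ₀, 0) : ℝ × ℝ) (σ₁, 2 * π), ‖fderiv ℝ F p (1, 0)‖ / ‖F p‖) ≤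
      ∫ p in Icc ((σ₀, 0) : ℝ × ℝ) (σ₁, 2 * π), fderiv ℝ (angularForm F b χ (0, 1)) p (1, 0) +
      fderiv ℝ (fun p => - angularForm F b χ (1, 0) p) p (0, 1) := by
    rw [← integral_neg]
    refine setIntegral_mono_on ?_ h_integral measurableSet_Icc ?_
    · refine ContinuousOn.integrableOn_compact isCompact_Icc (ContinuousOn.neg ?_)
      refine ContinuousOn.div ?_ (hF.continuousOn.mono hsub).norm fun p hp =>
        norm_ne_zero_iff.2 (hne p (hsub hp))
      exact (((hF.continuousOn_fderiv_of_isOpen hU (by norm_num)).clm_apply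
        continuousOn_const).mono hsub).norm
    · intro p hp
      have hpU := hsub hp
      rw [fderiv_fun_neg]
      simp only [neg_apply]
      rw [fderiv_angularForm hU hF hne hb hχ _ _ hpU, fderiv_angularForm hU hF hne hb hχ _ _ hpU]
      have hsymm : fderiv ℝ (fderiv ℝ F) p (1, 0) (0, 1) = fderiv ℝ (fderiv ℝ F) p (0, 1) (1, 0) :=
        ((hF.contDiffAt (hU.mem_nhds hpU)).isSymmSndFDerivAt (by simp)) _ _
      rw [hsymm]
      have hF0 := hne p hpU
      have hJp := hJ p hpU
      have hdχ : 0 ≤ deriv χ (Complex.normSq (F p)) := hχm.deriv_nonneg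
      generalize fderiv ℝ (fderiv ℝ F) p (0, 1) (1, 0) = D
      have hA : |(fderiv ℝ F p (1, 0) / F p).im| ≤ ‖fderiv ℝ F p (1, 0)‖ / ‖F p‖ := by
        rw [← norm_div]; exact Complex.abs_im_le_norm _
      generalize fderiv ℝ F p (1, 0) = A at *
      generalize fderiv ℝ F p (0, 1) = B at *
      generalize F p = f at *
      have hid : 2 * ((starRingEnd ℂ) f * A).re * (B / f).im -
          2 * ((starRingEnd ℂ) f * B).re * (A / f).im = 2 * ((starRingEnd ℂ) A * B).im := by
        have hn : Complex.normSq f ≠ 0 := by simpa using hF0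
        simp only [Complex.div_im, Complex.mul_re, Complex.mul_im, Complex.conj_re,
          Complex.conj_im]
        field_simp
        rw [Complex.normSq_apply]
        ring
      have hc1 : |deriv b p.2 * χ (Complex.normSq f) * (A / f).im| ≤ ‖A‖ / ‖f‖ := by
        rw [abs_mul, abs_mul, abs_of_nonneg (hχ0 _)]
        calc |deriv b p.2| * χ (Complex.normSq f) * |(A / f).im|
            ≤ 1 * 1 * (‖A‖ / ‖f‖) := by
              gcongr
              · exact hχ0 _
              · exact hb1 _
              · exact hχ1 _
          _ = ‖A‖ / ‖f‖ := by ring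
      have hmain : 0 ≤ b p.2 * deriv χ (Complex.normSq f) * (2 * ((starRingEnd ℂ) A * B).im) :=
        mul_nonneg (mul_nonneg (hb0 _) hdχ) (by linarith)
      rw [← hid] at hmain
      have hc2 := (abs_le.1 hc1).2
      rw [mul_comm A B]
      simp only [mul_zero, mul_one, zero_mul, zero_add]
      nlinarith
  rw [green] at hlow
  linarith

end BoundaryAngle

section BoundaryAngle

open Filter Metric Topology MeasureTheory
open scoped ContDiff

lemma exists_setIntegral_strip_le {φ : ℝ × ℝ → ℝ} (hφ : ∀ p, 0 ≤ φ p)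
    (hi : IntegrableOn φ (Ioo (-1) 0 ×ˢ Icc 0 (2 * π))) {η : ℝ} (hη : 0 < η) :
    ∃ σ₀ : ℝ, -1 < σ₀ ∧ σ₀ < 0 ∧ ∀ σ ∈ Ico σ₀ 0,
      ∫ p in Ioo σ 0 ×ˢ Icc 0 (2 * π), φ p ≤ η := by
  have hanti : Antitone fun n : ℕ => Ioo (-(1 / ((n : ℝ) + 1))) (0 : ℝ) ×ˢ Icc (0 : ℝ) (2 * π) := by
    intro m n hmn
    refine prod_mono (Ioo_subset_Ioo_left ?_) subset_rfl
    have : (1 : ℝ) / (n + 1) ≤ 1 / (m + 1) := by gcongr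
    linarith
  have hT := tendsto_setIntegral_of_antitone
    (fun n => (measurableSet_Ioo.prod measurableSet_Icc)) hanti ⟨0, by simpa using hi⟩
  have hemp : ⋂ n : ℕ, Ioo (-(1 / ((n : ℝ) + 1))) (0 : ℝ) ×ˢ Icc (0 : ℝ) (2 * π) = ∅ := by
    ext p
    simp only [mem_iInter, mem_empty_iff_false, iff_false, not_forall]
    by_cases h : p.1 < 0
    · obtain ⟨n, hn⟩ := exists_nat_one_div_lt (neg_pos.2 h)
      exact ⟨n, fun hp => by linarith [hp.1.1]⟩
    · exact ⟨0, fun hp => h hp.1.2⟩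
  rw [hemp] at hT
  simp only [setIntegral_empty] at hT
  obtain ⟨n, hn, hn1⟩ := ((hT.eventually (gt_mem_nhds hη)).and (eventually_ge_atTop 1)).exists
  refine ⟨-(1 / ((n : ℝ) + 1)), ?_, ?_, ?_⟩
  · rw [neg_lt_neg_iff, div_lt_one (by positivity)]
    have : (1 : ℝ) ≤ n := by exact_mod_cast hn1
    linarith
  · rw [neg_lt_zero]; positivity
  · intro σ hσ
    refine le_trans (setIntegral_mono_set ?_ ?_ ?_) hn.le
    · refine hi.mono_set (prod_mono (Ioo_subset_Ioo_left ?_) subset_rfl)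
      have : (1 : ℝ) / (n + 1) ≤ 1 := by
        rw [div_le_one (by positivity)]
        have : (0 : ℝ) ≤ n := by positivity
        linarith
      linarith
    · exact Eventually.of_forall hφ
    · exact (prod_mono (Ioo_subset_Ioo_left hσ.1) subset_rfl).eventuallyLE

/-- For a sense-preserving map of the left half-plane onto the punctured disk, periodic in the
second variable and proper in the first one, the angular derivative near the boundary has
almost nonnegative integral against slowly varying nonnegative weights. -/
lemma exists_forall_integral_angular_ge {F : ℝ × ℝ → ℂ} (hF : ContDiffOn ℝ 2 F {p | p.1 < 0})
    (hne : ∀ p : ℝ × ℝ, p.1 < 0 → F p ≠ 0) (hper : ∀ p, F (p + (0, 2 * π)) = F p)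
    (hJ : ∀ p : ℝ × ℝ, p.1 < 0 →
      0 ≤ ((starRingEnd ℂ) (fderiv ℝ F p (1, 0)) * fderiv ℝ F p (0, 1)).im)
    (hlt : ∀ p : ℝ × ℝ, p.1 < 0 → ‖F p‖ < 1)
    (hlim : ∀ ε > 0, ∃ σ < 0, ∀ p : ℝ × ℝ, σ < p.1 → p.1 < 0 → 1 - ε < ‖F p‖)
    (hi : IntegrableOn (fun p => ‖fderiv ℝ F p (1, 0)‖) (Ioo (-1) 0 ×ˢ Icc 0 (2 * π)))
    {η : ℝ} (hη : 0 < η) :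
    ∃ σs < 0, ∀ σ ∈ Ioo σs 0, ∀ b : ℝ → ℝ, ContDiff ℝ 1 b → (∀ t, b (t + 2 * π) = b t) →
      (∀ t, 0 ≤ b t) → (∀ t, |deriv b t| ≤ 1) →
      -η ≤ ∫ t in 0..2 * π, b t * (fderiv ℝ F (σ, t) (0, 1) / F (σ, t)).im := by
  have hU : IsOpen {p : ℝ × ℝ | p.1 < 0} := isOpen_lt continuous_fst continuous_const
  obtain ⟨σa, hσa0, hσa⟩ := hlim (1 / 2) (by norm_num)
  obtain ⟨σb, hσb1, hσb0, hσb⟩ := exists_setIntegral_strip_le (fun p => norm_nonneg _) hi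
    (show 0 < η / 2 by positivity)
  set σ₀ := max (σa / 2) (σb / 2) with hσ₀
  have h00 : σ₀ < 0 := max_lt (by linarith) (by linarith)
  have h0a : σa < σ₀ := lt_of_lt_of_le (by linarith) (le_max_left _ _)
  have h0b : σb < σ₀ := lt_of_lt_of_le (by linarith) (le_max_right _ _)
  obtain ⟨t₀, -, ht₀⟩ := (isCompact_Icc (a := (0 : ℝ)) (b := 2 * π)).exists_isMaxOn
    (nonempty_Icc.2 (by positivity)) (f := fun t => Complex.normSq (F (σ₀, t))) (by
      refine Complex.continuous_normSq.comp_continuousOn ?_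
      exact hF.continuousOn.comp (by fun_prop) fun t _ => h00)
  set s := Complex.normSq (F (σ₀, t₀)) with hs
  have hs1 : s < 1 := by
    rw [hs, Complex.normSq_eq_norm_sq]
    have := hlt (σ₀, t₀) h00
    nlinarith [norm_nonneg (F (σ₀, t₀))]
  set χ : ℝ → ℝ := fun x => Real.smoothTransition ((x - s) / ((1 - s) / 2)) with hχ
  have hχd : ContDiff ℝ 1 χ := by
    have : ContDiff ℝ 1 Real.smoothTransition := Real.smoothTransition.contDiff (n := 1)
    exact this.comp (by fun_prop)
  have hχm : Monotone χ := fun x y hxy => Real.smoothTransition.monotone (by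
    have : 0 < (1 - s) / 2 := by linarith
    gcongr)
  obtain ⟨σc, hσc0, hσc⟩ := hlim ((1 - s) / 4) (by linarith)
  refine ⟨max σ₀ σc, max_lt h00 hσc0, fun σ hσ b hb hbper hb0 hb1 => ?_⟩
  have hσ0 : σ₀ < σ := lt_of_le_of_lt (le_max_left _ _) hσ.1
  have hσc' : σc < σ := lt_of_le_of_lt (le_max_right _ _) hσ.1
  have key := angularForm_integral_ge hF hne hper hJ hb hbper hb0 hb1 hχd hχm
    (fun x => Real.smoothTransition.nonneg _) (fun x => Real.smoothTransition.le_one _) hσ0.le hσ.2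
  have e0 : ∫ t in 0..2 * π, angularForm F b χ (0, 1) (σ₀, t) = 0 := by
    rw [intervalIntegral.integral_congr (g := fun _ => (0 : ℝ))]
    · simp
    · intro t ht
      rw [uIcc_of_le (by positivity)] at ht
      have h1 : Complex.normSq (F (σ₀, t)) ≤ s := ht₀ ht
      have h2 : χ (Complex.normSq (F (σ₀, t))) = 0 :=
        Real.smoothTransition.zero_of_nonpos
          (div_nonpos_of_nonpos_of_nonneg (by linarith) (by linarith))
      simp [angularForm, h2]
  have e1 : ∫ t in 0..2 * π, angularForm F b χ (0, 1) (σ, t) =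
      ∫ t in 0..2 * π, b t * (fderiv ℝ F (σ, t) (0, 1) / F (σ, t)).im := by
    refine intervalIntegral.integral_congr fun t _ => ?_
    have h1 := hσc (σ, t) hσc' hσ.2
    have h2 : (1 + s) / 2 ≤ Complex.normSq (F (σ, t)) := by
      rw [Complex.normSq_eq_norm_sq]
      have hs0 : 0 ≤ s := Complex.normSq_nonneg _
      nlinarith
    have h3 : χ (Complex.normSq (F (σ, t))) = 1 := by
      refine Real.smoothTransition.one_of_one_le ?_
      rw [le_div_iff₀ (by linarith)]
      linarith
    simp [angularForm, h3]
  have e2 : ∫ p in Icc ((σ₀, 0) : ℝ × ℝ) (σ, 2 * π), ‖fderiv ℝ F p (1, 0)‖ / ‖F p‖ ≤ η := by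
    have hsub : Icc ((σ₀, 0) : ℝ × ℝ) (σ, 2 * π) ⊆ Ioo σb 0 ×ˢ Icc 0 (2 * π) := fun p hp =>
      ⟨⟨lt_of_lt_of_le h0b hp.1.1, lt_of_le_of_lt hp.2.1 hσ.2⟩, hp.1.2, hp.2.2⟩
    have hi' : IntegrableOn (fun p => ‖fderiv ℝ F p (1, 0)‖) (Ioo σb 0 ×ˢ Icc 0 (2 * π)) :=
      hi.mono_set (prod_mono (Ioo_subset_Ioo_left hσb1.le) subset_rfl)
    calc ∫ p in Icc ((σ₀, 0) : ℝ × ℝ) (σ, 2 * π), ‖fderiv ℝ F p (1, 0)‖ / ‖F p‖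
        ≤ ∫ p in Icc ((σ₀, 0) : ℝ × ℝ) (σ, 2 * π), 2 * ‖fderiv ℝ F p (1, 0)‖ := by
          have hsubU : Icc ((σ₀, 0) : ℝ × ℝ) (σ, 2 * π) ⊆ {p : ℝ × ℝ | p.1 < 0} :=
            fun p hp => lt_of_le_of_lt hp.2.1 hσ.2
          refine setIntegral_mono_on ?_ ((hi'.mono_set hsub).const_mul 2) measurableSet_Icc ?_
          · refine ContinuousOn.integrableOn_compact isCompact_Icc ?_
            refine ContinuousOn.div ?_ (hF.continuousOn.mono hsubU).norm fun p hp =>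
              norm_ne_zero_iff.2 (hne p (hsubU hp))
            exact (((hF.continuousOn_fderiv_of_isOpen hU (by norm_num)).clm_apply
              continuousOn_const).mono hsubU).norm
          · intro p hp
            have h1 := hσa p (lt_of_lt_of_le h0a hp.1.1) (hsubU hp)
            rw [div_le_iff₀ (by linarith)]
            nlinarith [norm_nonneg (fderiv ℝ F p (1, 0))]
      _ = 2 * ∫ p in Icc ((σ₀, 0) : ℝ × ℝ) (σ, 2 * π), ‖fderiv ℝ F p (1, 0)‖ := by
          rw [integral_const_mul]
      _ ≤ 2 * ∫ p in Ioo σb 0 ×ˢ Icc 0 (2 * π), ‖fderiv ℝ F p (1, 0)‖ := by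
          refine mul_le_mul_of_nonneg_left ?_ two_pos.le
          exact setIntegral_mono_set hi' (Eventually.of_forall fun p => norm_nonneg _)
            hsub.eventuallyLE
      _ ≤ 2 * (η / 2) := by gcongr; exact hσb σb ⟨le_rfl, hσb0⟩
      _ = η := by ring
  rw [e0, e1] at key
  linarith

end BoundaryAngle

section PeriodicIncrements

open Filter Topology MeasureTheory intervalIntegral

lemma integral_swap_of_continuous {K : ℝ → ℝ → ℝ} (hK : Continuous (Function.uncurry K))
    (a b c d : ℝ) : ∫ x in a..b, ∫ y in c..d, K x y = ∫ y in c..d, ∫ x in a..b, K x y := by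
  refine intervalIntegral_intervalIntegral_swap ?_
  exact (hK.continuousOn.integrableOn_compact (isCompact_uIcc.prod isCompact_uIcc)).mono_set
    (prod_mono uIoc_subset_uIcc uIoc_subset_uIcc)

lemma integral_periodic_shift {T : ℝ} {φ : ℝ → ℝ} (hφ : Function.Periodic φ T) (u : ℝ) :
    ∫ t in 0..T, φ (t + u) = ∫ t in 0..T, φ t := by
  rw [integral_comp_add_right]
  simpa [add_comm] using hφ.intervalIntegral_add_eq u 0

/-- Moving a window average from one periodic factor to the other. -/
lemma integral_window_mul {T : ℝ} {b k : ℝ → ℝ} (hb : Continuous b) (hk : Continuous k)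
    (hbT : Function.Periodic b T) (hkT : Function.Periodic k T) (θ : ℝ) :
    ∫ t in 0..T, (∫ u in (t - θ)..t, b u) * k t = ∫ t in 0..T, b t * ∫ u in t..(t + θ), k u := by
  have h1 : ∀ t, (∫ u in (t - θ)..t, b u) * k t = ∫ u in 0..θ, b (t - u) * k t := by
    intro t
    rw [intervalIntegral.integral_mul_const, integral_comp_sub_left (fun x => b x) t]
    simp
  have h2 : ∀ t, b t * ∫ u in t..(t + θ), k u = ∫ u in 0..θ, b t * k (t + u) := by
    intro t
    rw [intervalIntegral.integral_const_mul, integral_comp_add_left (fun x => k x) t]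
    simp
  simp only [h1, h2]
  rw [integral_swap_of_continuous (K := fun t u => b (t - u) * k t) (by fun_prop),
    integral_swap_of_continuous (K := fun t u => b t * k (t + u)) (by fun_prop)]
  refine integral_congr fun u _ => ?_
  have hper : Function.Periodic (fun t => b (t - u) * k t) T := fun t => by
    simp only [hkT t]
    rw [show t + T - u = t - u + T by ring, hbT]
  have := integral_periodic_shift hper u
  simp only [add_sub_cancel_right] at this
  exact this.symm

/-- If `k` is almost nonnegative when tested against slowly varying weights, then the increments
of its primitive have small negative part. -/
lemma integral_negPart_increment_le {k : ℝ → ℝ} (hk : Continuous k)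
    (hkT : Function.Periodic k (2 * π)) {η : ℝ}
    (h : ∀ b : ℝ → ℝ, ContDiff ℝ 1 b → (∀ t, b (t + 2 * π) = b t) → (∀ t, 0 ≤ b t) →
      (∀ t, |deriv b t| ≤ 1) → -η ≤ ∫ t in 0..2 * π, b t * k t) {θ : ℝ} (hθ : 0 ≤ θ) :
    ∫ t in 0..2 * π, max (-∫ u in t..(t + θ), k u) 0 ≤ η := by
  set δ : ℝ → ℝ := fun t => ∫ u in t..(t + θ), k u with hδ
  have hkint : ∀ a b, IntervalIntegrable k volume a b := fun a b => hk.intervalIntegrable a b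
  have hδc : Continuous δ := by
    have h1 : δ = fun t => (∫ u in 0..(t + θ), k u) - ∫ u in 0..t, k u := by
      ext t
      rw [integral_interval_sub_left (hkint _ _) (hkint _ _)]
    rw [h1]
    have h2 : Continuous fun t => ∫ u in 0..t, k u := continuous_primitive hkint 0
    exact (h2.comp (by fun_prop)).sub h2
  have hδT : Function.Periodic δ (2 * π) := by
    intro t
    simp only [hδ]
    rw [show t + 2 * π + θ = t + θ + 2 * π by ring, ← integral_comp_add_right]
    simp only [hkT _]
  refine le_of_forall_pos_le_add fun e he => ?_
  set ε := e / (2 * π) with hε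
  have hε0 : 0 < ε := by positivity
  set n : ℝ → ℝ := fun t => max (-δ t) 0 with hn
  have hnc : Continuous n := by fun_prop
  have hn0 : ∀ t, 0 ≤ n t := fun t => le_max_right _ _
  set b : ℝ → ℝ := fun t => n t / (n t + ε) with hb
  have hbc : Continuous b := hnc.div (by fun_prop) fun t => by have := hn0 t; positivity
  have hbT : Function.Periodic b (2 * π) := fun t => by simp only [hb, hn, hδT t]
  have hb0 : ∀ t, 0 ≤ b t := fun t => div_nonneg (hn0 t) (by have := hn0 t; positivity)
  have hb1 : ∀ t, b t ≤ 1 := fun t => by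
    have := hn0 t
    rw [hb, div_le_one (by positivity)]
    linarith
  set G : ℝ → ℝ := fun t => ∫ u in (t - θ)..t, b u with hG
  have hbint : ∀ x y, IntervalIntegrable b volume x y := fun x y => hbc.intervalIntegrable x y
  have hGd : ∀ t, HasDerivAt G (b t - b (t - θ)) t := by
    intro t
    have h1 : G = fun t => (∫ u in 0..t, b u) - ∫ u in 0..(t - θ), b u := by
      ext t
      rw [integral_interval_sub_left (hbint _ _) (hbint _ _)]
    have h2 : ∀ s, HasDerivAt (fun t => ∫ u in 0..t, b u) (b s) s := fun s =>
      (hbc.integral_hasStrictDerivAt 0 s).hasDerivAt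
    rw [h1]
    refine (h2 t).sub ?_
    simpa [Function.comp_def] using (h2 (t - θ)).comp t ((hasDerivAt_id t).sub_const θ)
  have hGderiv : deriv G = fun t => b t - b (t - θ) := funext fun t => (hGd t).deriv
  have key := h G (contDiff_one_iff_deriv.2 ⟨fun t => (hGd t).differentiableAt, by
      rw [hGderiv]; fun_prop⟩) (fun t => by
      simp only [hG]
      rw [show t + 2 * π - θ = t - θ + 2 * π by ring, ← integral_comp_add_right]
      simp only [hbT _]) (fun t => integral_nonneg (by linarith) fun u _ => hb0 u) (fun t => by
      rw [hGderiv, abs_le]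
      constructor <;> linarith [hb0 t, hb1 t, hb0 (t - θ), hb1 (t - θ)])
  rw [integral_window_mul hbc hk hbT hkT θ] at key
  have hle : ∫ t in 0..2 * π, b t * δ t ≤ ∫ t in 0..2 * π, (ε - n t) := by
    refine integral_mono_on (by positivity) ((hbc.mul hδc).intervalIntegrable _ _)
      ((continuous_const.sub hnc).intervalIntegrable _ _) fun t _ => ?_
    have h0 := hn0 t
    simp only [hb]
    rcases le_total 0 (δ t) with h1 | h1
    · have : n t = 0 := max_eq_right (by linarith)
      simp [this, hε0.le]
    · have : n t = -δ t := max_eq_left (by linarith)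
      rw [show δ t = -n t by linarith, div_mul_eq_mul_div, div_le_iff₀ (by positivity)]
      nlinarith
  rw [intervalIntegral.integral_sub (by simp) (hnc.intervalIntegrable _ _)] at hle
  simp only [intervalIntegral.integral_const, sub_zero, smul_eq_mul] at hle
  have : 2 * π * ε = e := by rw [hε]; field_simp
  rw [this] at hle
  linarith

lemma integral_increment {k : ℝ → ℝ} (hk : Continuous k) (hkT : Function.Periodic k (2 * π))
    (htot : ∫ t in 0..2 * π, k t = 2 * π) (θ : ℝ) :
    ∫ t in 0..2 * π, (∫ u in t..(t + θ), k u) = 2 * π * θ := by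
  have := integral_window_mul (b := fun _ => (1 : ℝ)) continuous_const hk (fun _ => rfl) hkT θ
  simp only [one_mul] at this
  rw [← this]
  simp only [intervalIntegral.integral_const, sub_sub_cancel, smul_eq_mul, mul_one,
    intervalIntegral.integral_const_mul, htot]
  ring

end PeriodicIncrements

section Correlation

open Filter Topology MeasureTheory intervalIntegral

lemma nonneg_of_hasDerivAt_nonneg {φ φ' : ℝ → ℝ} (h : ∀ x, HasDerivAt φ (φ' x) x)
    (h0 : 0 ≤ φ 0) (hφ' : ∀ x, 0 ≤ x → 0 ≤ φ' x) {x : ℝ} (hx : 0 ≤ x) : 0 ≤ φ x := by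
  have hm : MonotoneOn φ (Ici 0) := monotoneOn_of_deriv_nonneg (convex_Ici 0)
    (fun y _ => (h y).continuousAt.continuousWithinAt)
    (fun y _ => (h y).differentiableAt.differentiableWithinAt) (fun y hy => by
      rw [(h y).deriv]
      rw [interior_Ici] at hy
      exact hφ' y (le_of_lt hy))
  exact h0.trans (hm self_mem_Ici hx hx)

lemma sin_ge_cubic {x : ℝ} (hx : 0 ≤ x) : 0 ≤ Real.sin x - (x - x ^ 3 / 6) := by
  refine nonneg_of_hasDerivAt_nonneg (φ := fun x => Real.sin x - (x - x ^ 3 / 6))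
    (φ' := fun x => Real.cos x - (1 - x ^ 2 / 2)) (fun y => ?_) (by simp)
    (fun y _ => by linarith [Real.one_sub_sq_div_two_le_cos (x := y)]) hx
  refine ((Real.hasDerivAt_sin y).fun_sub
    ((hasDerivAt_id' y).fun_sub ((hasDerivAt_pow 3 y).div_const 6))).congr_deriv ?_
  push_cast
  ring

lemma cos_le_quartic {x : ℝ} (hx : 0 ≤ x) : 0 ≤ 1 - x ^ 2 / 2 + x ^ 4 / 24 - Real.cos x := by
  refine nonneg_of_hasDerivAt_nonneg (φ := fun x => 1 - x ^ 2 / 2 + x ^ 4 / 24 - Real.cos x)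
    (φ' := fun x => Real.sin x - (x - x ^ 3 / 6)) (fun y => ?_) (by simp)
    (fun y hy => sin_ge_cubic hy) hx
  refine ((((hasDerivAt_pow 2 y).div_const 2).const_sub 1 |>.fun_add
    ((hasDerivAt_pow 4 y).div_const 24)).fun_sub (Real.hasDerivAt_cos y)).congr_deriv ?_
  push_cast
  ring

lemma sin_le_quintic {x : ℝ} (hx : 0 ≤ x) :
    0 ≤ x - x ^ 3 / 6 + x ^ 5 / 120 - Real.sin x := by
  refine nonneg_of_hasDerivAt_nonneg (φ := fun x => x - x ^ 3 / 6 + x ^ 5 / 120 - Real.sin x)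
    (φ' := fun x => 1 - x ^ 2 / 2 + x ^ 4 / 24 - Real.cos x) (fun y => ?_) (by simp)
    (fun y hy => cos_le_quartic hy) hx
  refine ((((hasDerivAt_id' y).fun_sub ((hasDerivAt_pow 3 y).div_const 6)).fun_add
    ((hasDerivAt_pow 5 y).div_const 120)).fun_sub (Real.hasDerivAt_sin y)).congr_deriv ?_
  push_cast
  ring

lemma cos_ge_sextic {x : ℝ} (hx : 0 ≤ x) :
    0 ≤ Real.cos x - (1 - x ^ 2 / 2 + x ^ 4 / 24 - x ^ 6 / 720) := by
  refine nonneg_of_hasDerivAt_nonneg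
    (φ := fun x => Real.cos x - (1 - x ^ 2 / 2 + x ^ 4 / 24 - x ^ 6 / 720))
    (φ' := fun x => x - x ^ 3 / 6 + x ^ 5 / 120 - Real.sin x) (fun y => ?_) (by simp)
    (fun y hy => sin_le_quintic hy) hx
  refine ((Real.hasDerivAt_cos y).fun_sub ((((hasDerivAt_pow 2 y).div_const 2).const_sub 1 |>.fun_add
    ((hasDerivAt_pow 4 y).div_const 24)).fun_sub ((hasDerivAt_pow 6 y).div_const 720))).congr_deriv ?_
  push_cast
  ring

lemma one_sub_cos_add_sin_le_of_nonneg {x : ℝ} (hx : 0 ≤ x) :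
    1 - Real.cos x + 1 / 4 * Real.sin x ≤ 83 / 100 * x := by
  rcases le_total x (5 / 2) with h | h
  · have h1 := cos_ge_sextic hx
    have h2 := sin_le_quintic hx
    have hq : x ^ 5 / 720 + x ^ 4 / 480 - x ^ 3 / 24 - x ^ 2 / 24 + x / 2 - 58 / 100 ≤ 0 := by
      have hc : x ^ 3 / 720 + 277 * x ^ 2 / 36000 - 61 * x / 4000 - 5 / 36 ≤ 0 := by
        nlinarith [mul_nonneg hx (sub_nonneg.2 h), mul_nonneg (mul_nonneg hx hx) (sub_nonneg.2 h)]
      nlinarith [mul_nonneg (sq_nonneg (x - 203 / 100)) (neg_nonneg.2 hc)]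
    nlinarith [mul_nonneg hx (neg_nonneg.2 hq)]
  · have h1 := Real.sin_sq_add_cos_sq x
    have h2 : - Real.cos x + 1 / 4 * Real.sin x ≤ 107 / 100 := by
      nlinarith [sq_nonneg (Real.sin x + 1 / 4 * Real.cos x),
        sq_nonneg (- Real.cos x + 1 / 4 * Real.sin x - 107 / 100)]
    linarith

lemma one_sub_cos_add_sin_le (x : ℝ) :
    1 - Real.cos x + 1 / 4 * Real.sin x ≤ 83 / 100 * x + 3 * max (-x) 0 := by
  rcases le_total 0 x with h | h
  · rw [max_eq_right (by linarith)]
    linarith [one_sub_cos_add_sin_le_of_nonneg h]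
  · rw [max_eq_left (by linarith)]
    have h1 : 1 - Real.cos x ≤ -x := by
      rcases le_total (-2) x with h2 | h2
      · nlinarith [Real.one_sub_sq_div_two_le_cos (x := x)]
      · linarith [Real.neg_one_le_cos x]
    have h2 : Real.sin x ≤ -x := by
      have := Real.abs_sin_le_abs (x := x)
      rw [abs_of_nonpos h] at this
      exact (le_abs_self _).trans this
    linarith

/-- A nonvanishing curve is recovered from the primitive of its logarithmic derivative. -/
lemma mul_conj_eq_norm_mul_exp {f : ℝ → ℂ} (hf : ContDiff ℝ 1 f) (hne : ∀ t, f t ≠ 0) (t θ : ℝ) :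
    f (t + θ) * (starRingEnd ℂ) (f t) = (‖f (t + θ)‖ * ‖f t‖ : ℝ) *
      Complex.exp ((∫ u in t..(t + θ), (deriv f u / f u).im : ℝ) * Complex.I) := by
  have hqc : Continuous fun u => deriv f u / f u := (hf.continuous_deriv le_rfl).div hf.continuous hne
  set E : ℝ → ℂ := fun s => ∫ u in t..s, deriv f u / f u with hE
  have hEd : ∀ s, HasDerivAt E (deriv f s / f s) s := fun s =>
    (hqc.integral_hasStrictDerivAt t s).hasDerivAt
  have hfd : ∀ s, HasDerivAt f (deriv f s) s := fun s =>
    (hf.differentiable (by norm_num) s).hasDerivAt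
  have hconst : ∀ s, f s * Complex.exp (-E s) = f t := by
    intro s
    have hd : ∀ s, HasDerivAt (fun s => f s * Complex.exp (-E s)) 0 s := by
      intro s
      refine ((hfd s).fun_mul (hEd s).fun_neg.cexp).congr_deriv ?_
      field_simp [hne s]
      ring
    have := is_const_of_deriv_eq_zero (fun s => (hd s).differentiableAt) (fun s => (hd s).deriv) s t
    rw [this]
    simp [hE]
  have hval : f (t + θ) = f t * Complex.exp (E (t + θ)) := by
    rw [← hconst (t + θ), mul_assoc, ← Complex.exp_add]
    simp
  have him : (∫ u in t..(t + θ), (deriv f u / f u).im : ℝ) = (E (t + θ)).im := by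
    have := Complex.imCLM.intervalIntegral_comp_comm (hqc.intervalIntegrable (μ := volume) t (t + θ))
    simpa using this
  rw [him, hval, norm_mul, Complex.norm_exp]
  set w := E (t + θ)
  have h1 : Complex.exp w = (Real.exp w.re : ℝ) * Complex.exp (w.im * Complex.I) := by
    rw [Complex.ofReal_exp, ← Complex.exp_add, Complex.re_add_im]
  rw [h1]
  have h2 : f t * (starRingEnd ℂ) (f t) = (‖f t‖ : ℂ) ^ 2 := Complex.mul_conj' _
  push_cast
  linear_combination (Complex.exp w.re * Complex.exp (w.im * Complex.I)) * h2

/-- Upper bound for the skewed autocorrelation of an almost-monotone closed curve near the unit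
circle. -/
lemma integral_correlation_le {f : ℝ → ℂ} (hf : ContDiff ℝ 1 f)
    (hper : Function.Periodic f (2 * π)) {ε η : ℝ} (hε : ε < 1)
    (hlow : ∀ t, 1 - ε < ‖f t‖) (hup : ∀ t, ‖f t‖ < 1)
    (hk : ∀ b : ℝ → ℝ, ContDiff ℝ 1 b → (∀ t, b (t + 2 * π) = b t) → (∀ t, 0 ≤ b t) →
      (∀ t, |deriv b t| ≤ 1) → -η ≤ ∫ t in 0..2 * π, b t * (deriv f t / f t).im)
    (htot : ∫ t in 0..2 * π, (deriv f t / f t).im = 2 * π) {θ : ℝ} (hθ : 0 ≤ θ) :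
    ∫ t in 0..2 * π, (‖f t‖ ^ 2 - (f (t + θ) * (starRingEnd ℂ) (f t)).re +
        1 / 4 * (f (t + θ) * (starRingEnd ℂ) (f t)).im)
      ≤ 2 * π * (2 * ε) + 83 / 100 * (2 * π * θ) + 3 * η := by
  have hne : ∀ t, f t ≠ 0 := fun t => norm_pos_iff.1 (by linarith [hlow t])
  have hfc := hf.continuous
  have hkc : Continuous fun u => (deriv f u / f u).im :=
    Complex.continuous_im.comp ((hf.continuous_deriv le_rfl).div hf.continuous hne)
  have hdper : Function.Periodic (deriv f) (2 * π) := by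
    intro t
    rw [← deriv_comp_add_const]
    simp only [hper _]
  have hkper : Function.Periodic (fun u => (deriv f u / f u).im) (2 * π) := fun t => by
    simp only [hper t, hdper t]
  set δ : ℝ → ℝ := fun t => ∫ u in t..(t + θ), (deriv f u / f u).im with hδ
  have hδc : Continuous δ := by
    have hkint : ∀ a b, IntervalIntegrable (fun u => (deriv f u / f u).im) volume a b :=
      fun a b => hkc.intervalIntegrable a b
    have h1 : δ = fun t => (∫ u in 0..(t + θ), (deriv f u / f u).im) -
        ∫ u in 0..t, (deriv f u / f u).im := by
      ext t
      rw [integral_interval_sub_left (hkint _ _) (hkint _ _)]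
    rw [h1]
    have h2 : Continuous fun t => ∫ u in 0..t, (deriv f u / f u).im := continuous_primitive hkint 0
    exact (h2.comp (by fun_prop)).sub h2
  have hneg := integral_negPart_increment_le hkc hkper hk hθ
  have hinc := integral_increment hkc hkper htot θ
  have hpt : ∀ t, ‖f t‖ ^ 2 - (f (t + θ) * (starRingEnd ℂ) (f t)).re +
      1 / 4 * (f (t + θ) * (starRingEnd ℂ) (f t)).im ≤
      2 * ε + 83 / 100 * δ t + 3 * max (-δ t) 0 := by
    intro t
    rw [mul_conj_eq_norm_mul_exp hf hne t θ, Complex.re_ofReal_mul, Complex.im_ofReal_mul,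
      Complex.exp_ofReal_mul_I_re, Complex.exp_ofReal_mul_I_im]
    have hψ := one_sub_cos_add_sin_le (δ t)
    have hψ0 : 0 ≤ 83 / 100 * δ t + 3 * max (-δ t) 0 := by
      rcases le_total 0 (δ t) with h | h
      · have := le_max_right (-δ t) 0
        linarith
      · have := le_max_left (-δ t) 0
        linarith
    have h1 := hlow t
    have h2 := hup t
    have h3 := hlow (t + θ)
    have h4 := hup (t + θ)
    change ‖f t‖ ^ 2 - ‖f (t + θ)‖ * ‖f t‖ * Real.cos (δ t) +
      1 / 4 * (‖f (t + θ)‖ * ‖f t‖ * Real.sin (δ t)) ≤ _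
    set x := ‖f t‖
    set y := ‖f (t + θ)‖
    have hρ0 : 0 ≤ y * x := by positivity
    have hρ1 : y * x ≤ 1 := by nlinarith
    have h5 : y * x * (1 - Real.cos (δ t) + 1 / 4 * Real.sin (δ t)) ≤
        83 / 100 * δ t + 3 * max (-δ t) 0 :=
      (mul_le_mul_of_nonneg_left hψ hρ0).trans (by nlinarith)
    have h6 : x ^ 2 - y * x ≤ 2 * ε := by nlinarith
    linarith
  calc ∫ t in 0..2 * π, (‖f t‖ ^ 2 - (f (t + θ) * (starRingEnd ℂ) (f t)).re +
        1 / 4 * (f (t + θ) * (starRingEnd ℂ) (f t)).im)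
      ≤ ∫ t in 0..2 * π, (2 * ε + 83 / 100 * δ t + 3 * max (-δ t) 0) := by
        refine integral_mono_on (by positivity) ?_ ?_ fun t _ => hpt t
        · refine Continuous.intervalIntegrable ?_ _ _
          have : Continuous fun t => f (t + θ) * (starRingEnd ℂ) (f t) :=
            (hfc.comp (by fun_prop)).mul (Complex.continuous_conj.comp hfc)
          exact ((hfc.norm.pow 2).sub (Complex.continuous_re.comp this)).add
            (continuous_const.mul (Complex.continuous_im.comp this))
        · exact Continuous.intervalIntegrable (by fun_prop) _ _
    _ = 2 * π * (2 * ε) + 83 / 100 * (∫ t in 0..2 * π, δ t) +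
        3 * ∫ t in 0..2 * π, max (-δ t) 0 := by
        rw [intervalIntegral.integral_add (Continuous.intervalIntegrable (by fun_prop) _ _)
          (Continuous.intervalIntegrable (by fun_prop) _ _),
          intervalIntegral.integral_add (Continuous.intervalIntegrable (by fun_prop) _ _)
          (Continuous.intervalIntegrable (by fun_prop) _ _)]
        simp
        ring
    _ ≤ _ := by
        rw [hinc]
        linarith

end Correlation

section
open MeasureTheory intervalIntegral

lemma norm_cexp_I_mul_intCast_mul (n : ℤ) (t : ℝ) : ‖Complex.exp (Complex.I * n * t)‖ = 1 := by
  have : Complex.I * n * t = ((n * t : ℝ) : ℂ) * Complex.I := by push_cast; ring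
  rw [this, Complex.norm_exp_ofReal_mul_I]

lemma hasSum_integral_fourier_mul {c : ℤ → ℂ} (hc : Summable fun n => ‖c n‖) {f φ : ℝ → ℂ}
    (hf : ∀ t : ℝ, HasSum (fun n : ℤ => c n * Complex.exp (Complex.I * n * t)) (f t))
    (hφ : Continuous φ) (a b : ℝ) :
    HasSum (fun n : ℤ => c n * ∫ t in a..b, Complex.exp (Complex.I * n * t) * φ t)
      (∫ t in a..b, f t * φ t) := by
  have := intervalIntegral.hasSum_integral_of_dominated_convergence (μ := volume) (a := a) (b := b)
    (F := fun (n : ℤ) (t : ℝ) => c n * (Complex.exp (Complex.I * n * t) * φ t))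
    (f := fun t => f t * φ t) (fun n t => ‖c n‖ * ‖φ t‖)
    (fun n => (Continuous.aestronglyMeasurable (by fun_prop)))
    (fun n => Filter.Eventually.of_forall fun t _ => by
      rw [norm_mul, norm_mul, norm_cexp_I_mul_intCast_mul, one_mul])
    (Filter.Eventually.of_forall fun t _ => hc.mul_right _)
    (by
      simp_rw [tsum_mul_right]
      exact (by fun_prop : Continuous fun t => (∑' n, ‖c n‖) * ‖φ t‖).intervalIntegrable _ _)
    (Filter.Eventually.of_forall fun t _ => by
      simpa [mul_assoc] using (hf t).mul_right (φ t))
  simpa only [intervalIntegral.integral_const_mul] using this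

lemma integral_cexp_I_mul_intCast_mul {n : ℤ} (hn : n ≠ 0) :
    ∫ t in (0 : ℝ)..2 * π, Complex.exp (Complex.I * n * t) = 0 := by
  have hc : Complex.I * (n : ℂ) ≠ 0 := mul_ne_zero Complex.I_ne_zero (by exact_mod_cast hn)
  rw [integral_exp_mul_complex hc]
  have : Complex.I * (n : ℂ) * ((2 * π : ℝ) : ℂ) = n * (2 * π * Complex.I) := by push_cast; ring
  rw [this, Complex.exp_int_mul_two_pi_mul_I]
  simp

lemma integral_fourier_coeff {c : ℤ → ℂ} (hc : Summable fun n => ‖c n‖) {f : ℝ → ℂ}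
    (hf : ∀ t : ℝ, HasSum (fun n : ℤ => c n * Complex.exp (Complex.I * n * t)) (f t)) (m : ℤ) :
    ∫ t in (0 : ℝ)..2 * π, f t * Complex.exp (-(Complex.I * m * t)) = 2 * π * c m := by
  have h := hasSum_integral_fourier_mul hc hf
    (φ := fun t : ℝ => Complex.exp (-(Complex.I * m * t))) (by fun_prop) 0 (2 * π)
  refine h.unique ?_
  convert! hasSum_ite_eq m (2 * π * c m) using 2 with n
  have : ∀ t : ℝ, Complex.exp (Complex.I * n * t) * Complex.exp (-(Complex.I * m * t))
      = Complex.exp (Complex.I * ((n - m : ℤ) : ℂ) * t) := fun t => by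
    rw [← Complex.exp_add]
    congr 1
    push_cast
    ring
  simp_rw [this]
  split_ifs with hnm
  · subst hnm
    simp
    ring
  · rw [integral_cexp_I_mul_intCast_mul (sub_ne_zero.2 hnm), mul_zero]

lemma hasSum_integral_correlation {c : ℤ → ℂ} (hc : Summable fun n => ‖c n‖) {f : ℝ → ℂ}
    (hfc : Continuous f)
    (hf : ∀ t : ℝ, HasSum (fun n : ℤ => c n * Complex.exp (Complex.I * n * t)) (f t)) (θ : ℝ) :
    HasSum (fun n : ℤ => 2 * π * (‖c n‖ ^ 2 : ℂ) * Complex.exp (Complex.I * n * θ))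
      (∫ t in (0 : ℝ)..2 * π, f (t + θ) * (starRingEnd ℂ) (f t)) := by
  have hc' : Summable fun n : ℤ => ‖c n * Complex.exp (Complex.I * n * θ)‖ := by
    simpa only [norm_mul, norm_cexp_I_mul_intCast_mul, mul_one] using hc
  have h := hasSum_integral_fourier_mul hc' (f := fun t => f (t + θ))
    (φ := fun t => (starRingEnd ℂ) (f t)) (fun t => by
      convert! hf (t + θ) using 2 with n
      rw [mul_assoc, ← Complex.exp_add]
      congr 2
      push_cast
      ring) (Complex.continuous_conj.comp hfc) 0 (2 * π)
  convert! h using 2 with n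
  have h1 : ∫ t in (0 : ℝ)..2 * π, Complex.exp (Complex.I * n * t) * (starRingEnd ℂ) (f t)
      = (starRingEnd ℂ) (2 * π * c n) := by
    rw [← integral_fourier_coeff hc hf n, integral_of_le (by positivity),
      integral_of_le (by positivity), ← integral_conj]
    congr 1
    ext t
    rw [map_mul, ← Complex.exp_conj, mul_comm]
    simp
  rw [h1, ← Complex.mul_conj']
  simp only [map_mul, Complex.conj_ofReal, map_ofNat]
  ring
end

section
open MeasureTheory intervalIntegral

lemma integrableOn_pow_mul_exp_neg_three_mul (k : ℕ) :
    IntegrableOn (fun θ : ℝ => θ ^ k * rexp (-(3 * θ))) (Ioi 0) := by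
  have h := integrableOn_rpow_mul_exp_neg_mul_rpow (p := 1) (s := k) (b := 3)
    (by linarith [(Nat.cast_nonneg k : (0 : ℝ) ≤ k)]) one_pos three_pos
  simpa using h

lemma integral_id_mul_exp_neg_three_mul : ∫ θ in Ioi (0 : ℝ), θ * rexp (-(3 * θ)) = 1 / 9 := by
  have h := Real.integral_rpow_mul_exp_neg_mul_Ioi (a := 2) (r := 3) two_pos three_pos
  have h2 : Real.Gamma 2 = 1 := by simp
  norm_num [h2] at h
  rw [h]

lemma integral_sq_mul_exp_neg_three_mul :
    ∫ θ in Ioi (0 : ℝ), θ ^ 2 * rexp (-(3 * θ)) = 2 / 27 := by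
  have h := Real.integral_rpow_mul_exp_neg_mul_Ioi (a := 3) (r := 3) three_pos three_pos
  have h2 : Real.Gamma 3 = 2 := by simp
  norm_num [h2] at h
  rw [h]

lemma integrableOn_id_mul_exp_mul_cexp (n : ℤ) :
    IntegrableOn (fun θ : ℝ => ((θ * rexp (-(3 * θ)) : ℝ) : ℂ) *
      Complex.exp (Complex.I * n * θ)) (Ioi 0) := by
  have hi : IntegrableOn (fun θ : ℝ => θ * rexp (-(3 * θ))) (Ioi 0) := by
    simpa using integrableOn_pow_mul_exp_neg_three_mul 1
  refine Integrable.mono hi (Continuous.aestronglyMeasurable (by fun_prop)) ?_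
  exact Filter.Eventually.of_forall fun θ => by
    rw [norm_mul, norm_cexp_I_mul_intCast_mul, mul_one, Complex.norm_real]

lemma integral_id_mul_exp_mul_cexp (n : ℤ) :
    ∫ θ in Ioi (0 : ℝ), ((θ * rexp (-(3 * θ)) : ℝ) : ℂ) * Complex.exp (Complex.I * n * θ)
      = 1 / (3 - Complex.I * n) ^ 2 := by
  set s : ℂ := 3 - Complex.I * n with hs
  have hs0 : s ≠ 0 := fun h => by
    have := congrArg Complex.re h
    simp [hs] at this
  have hexp : ∀ θ : ℝ, Complex.exp (-(s * θ))
      = ((rexp (-(3 * θ)) : ℝ) : ℂ) * Complex.exp (Complex.I * n * θ) := fun θ => by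
    push_cast
    rw [← Complex.exp_add]
    congr 1
    rw [hs]
    ring
  have hlim : Filter.Tendsto (fun θ : ℝ => -((θ : ℂ) / s + 1 / s ^ 2) * Complex.exp (-(s * θ)))
      Filter.atTop (nhds 0) := by
    have h1 := tendsto_rpow_mul_exp_neg_mul_atTop_nhds_zero 1 3 three_pos
    have h0 := tendsto_rpow_mul_exp_neg_mul_atTop_nhds_zero 0 3 three_pos
    have h2 := (h1.mul_const ‖1 / s‖).add (h0.mul_const ‖1 / s ^ 2‖)
    simp only [zero_mul, add_zero] at h2
    refine squeeze_zero_norm' ?_ h2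
    filter_upwards [Filter.eventually_ge_atTop 0] with θ hθ
    rw [norm_mul, norm_neg, hexp, norm_mul, norm_cexp_I_mul_intCast_mul, mul_one, Complex.norm_real,
      Real.norm_of_nonneg (exp_pos _).le, rpow_one, rpow_zero]
    have : ‖(θ : ℂ) / s + 1 / s ^ 2‖ ≤ θ * ‖1 / s‖ + ‖1 / s ^ 2‖ := by
      refine (norm_add_le _ _).trans (add_le_add (le_of_eq ?_) le_rfl)
      rw [div_eq_mul_one_div, norm_mul, Complex.norm_real, Real.norm_of_nonneg hθ]
    rw [show -3 * θ = -(3 * θ) by ring]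
    nlinarith [exp_pos (-(3 * θ))]
  have h := integral_Ioi_of_hasDerivAt_of_tendsto' (a := 0) (m := 0)
    (f := fun θ : ℝ => -((θ : ℂ) / s + 1 / s ^ 2) * Complex.exp (-(s * θ)))
    (f' := fun θ : ℝ => ((θ * rexp (-(3 * θ)) : ℝ) : ℂ) * Complex.exp (Complex.I * n * θ))
    (fun θ _ => by
      have h1 : HasDerivAt (fun θ : ℝ => (θ : ℂ)) 1 θ := Complex.ofRealCLM.hasDerivAt
      have h2 := ((h1.div_const s).add_const (1 / s ^ 2)).fun_neg.fun_mul
        ((h1.const_mul s).fun_neg.cexp)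
      convert! h2 using 1
      rw [Complex.ofReal_mul, mul_assoc, ← hexp]
      field_simp
      ring)
    (integrableOn_id_mul_exp_mul_cexp n) hlim
  rw [h]
  simp

/-- The weighted average of `1 - cos (n θ) + sin (n θ) / 4` against `9 θ exp (-3 θ)`. -/
noncomputable def kernelWeight (n : ℤ) : ℝ :=
  ((n : ℝ) ^ 4 + 27 * (n : ℝ) ^ 2 + 27 / 2 * n) / ((n : ℝ) ^ 2 + 9) ^ 2

lemma integral_kernel (n : ℤ) :
    ∫ θ in Ioi (0 : ℝ), (9 * (θ * rexp (-(3 * θ)))) *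
      (1 - (Complex.exp (Complex.I * n * θ)).re + 1 / 4 * (Complex.exp (Complex.I * n * θ)).im)
      = kernelWeight n := by
  have hi : IntegrableOn (fun θ : ℝ => θ * rexp (-(3 * θ))) (Ioi 0) := by
    simpa using integrableOn_pow_mul_exp_neg_three_mul 1
  have hci := integrableOn_id_mul_exp_mul_cexp n
  have hre := (Complex.reCLM.integral_comp_comm hci)
  have him := (Complex.imCLM.integral_comp_comm hci)
  simp only [Complex.reCLM_apply, Complex.imCLM_apply, Complex.re_ofReal_mul,
    Complex.im_ofReal_mul] at hre him
  rw [integral_id_mul_exp_mul_cexp] at hre him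
  have hrei : IntegrableOn (fun θ : ℝ => θ * rexp (-(3 * θ)) *
      (Complex.exp (Complex.I * n * θ)).re) (Ioi 0) := by
    have := Complex.reCLM.integrable_comp hci
    simp only [Complex.reCLM_apply, Complex.re_ofReal_mul] at this
    exact this
  have himi : IntegrableOn (fun θ : ℝ => θ * rexp (-(3 * θ)) *
      (Complex.exp (Complex.I * n * θ)).im) (Ioi 0) := by
    have := Complex.imCLM.integrable_comp hci
    simp only [Complex.imCLM_apply, Complex.im_ofReal_mul] at this
    exact this
  have hsplit : ∀ θ : ℝ, (9 * (θ * rexp (-(3 * θ)))) *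
      (1 - (Complex.exp (Complex.I * n * θ)).re + 1 / 4 * (Complex.exp (Complex.I * n * θ)).im)
      = 9 * (θ * rexp (-(3 * θ)))
        - 9 * (θ * rexp (-(3 * θ)) * (Complex.exp (Complex.I * n * θ)).re)
        + 9 / 4 * (θ * rexp (-(3 * θ)) * (Complex.exp (Complex.I * n * θ)).im) := fun θ => by ring
  simp_rw [hsplit]
  have hsub : Integrable (fun θ : ℝ => 9 * (θ * rexp (-(3 * θ)))
      - 9 * (θ * rexp (-(3 * θ)) * (Complex.exp (Complex.I * n * θ)).re))
      (volume.restrict (Ioi 0)) := (hi.const_mul 9).sub (hrei.const_mul 9)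
  rw [MeasureTheory.integral_add hsub (himi.const_mul _),
    MeasureTheory.integral_sub (hi.const_mul 9) (hrei.const_mul 9),
    MeasureTheory.integral_const_mul, MeasureTheory.integral_const_mul,
    MeasureTheory.integral_const_mul, hre, him, integral_id_mul_exp_neg_three_mul, kernelWeight]
  have hz : (1 : ℂ) / (3 - Complex.I * n) ^ 2
      = (((9 - (n : ℝ) ^ 2) / ((n : ℝ) ^ 2 + 9) ^ 2 : ℝ) : ℂ)
        + ((6 * n / ((n : ℝ) ^ 2 + 9) ^ 2 : ℝ) : ℂ) * Complex.I := by
    have hd : ((n : ℂ) ^ 2 + 9) ≠ 0 := by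
      have : ((n : ℝ) ^ 2 + 9) ≠ 0 := by positivity
      exact_mod_cast this
    have hm : (3 - Complex.I * n) * (3 + Complex.I * n) = (n : ℂ) ^ 2 + 9 := by
      linear_combination (-(n : ℂ) ^ 2) * Complex.I_sq
    have h3 : (3 - Complex.I * (n : ℂ)) ≠ 0 := fun h => hd (by rw [← hm, h, zero_mul])
    rw [div_eq_iff (pow_ne_zero 2 h3)]
    push_cast
    field_simp
    linear_combination ((n : ℂ) ^ 4 + 27 * (n : ℂ) ^ 2 - 6 * Complex.I * (n : ℂ) ^ 3) *
      Complex.I_sq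
  rw [hz]
  simp only [Complex.add_re, Complex.add_im, Complex.ofReal_re, Complex.ofReal_im,
    Complex.re_ofReal_mul, Complex.im_ofReal_mul, Complex.I_re, Complex.I_im]
  field_simp
  ring

lemma seven_eighths_le_kernelWeight {n : ℤ} (hn : 3 ≤ |n|) : 7 / 8 ≤ kernelWeight n := by
  rw [kernelWeight, le_div_iff₀ (by positivity)]
  have h : (3 : ℝ) ≤ |(n : ℝ)| := by exact_mod_cast hn
  set m : ℝ := |(n : ℝ)| with hm
  have h1 : -m ≤ (n : ℝ) := neg_abs_le _
  have h2 : (n : ℝ) ^ 2 = m ^ 2 := (sq_abs _).symm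
  have h4 : (n : ℝ) ^ 4 = m ^ 4 := by
    rw [show (n : ℝ) ^ 4 = ((n : ℝ) ^ 2) ^ 2 by ring, h2]; ring
  rw [h2, h4]
  nlinarith [mul_nonneg (sub_nonneg.2 h) (sub_nonneg.2 h),
    mul_nonneg (mul_nonneg (sub_nonneg.2 h) (sub_nonneg.2 h)) (sub_nonneg.2 h),
    mul_nonneg (mul_nonneg (sub_nonneg.2 h) (sub_nonneg.2 h))
      (mul_nonneg (sub_nonneg.2 h) (sub_nonneg.2 h))]
end

section
open MeasureTheory

lemma abs_kernel_le (n : ℤ) (θ : ℝ) :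
    ‖1 - (Complex.exp (Complex.I * n * θ)).re + 1 / 4 * (Complex.exp (Complex.I * n * θ)).im‖
      ≤ 3 := by
  have h1 := Complex.abs_re_le_norm (Complex.exp (Complex.I * n * θ))
  have h2 := Complex.abs_im_le_norm (Complex.exp (Complex.I * n * θ))
  rw [norm_cexp_I_mul_intCast_mul, abs_le] at h1 h2
  rw [Real.norm_eq_abs, abs_le]
  constructor <;> linarith [h1.1, h1.2, h2.1, h2.2]

lemma summable_norm_sq_of_summable_norm {c : ℤ → ℂ} (hc : Summable fun n => ‖c n‖) :
    Summable fun n => ‖c n‖ ^ 2 := by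
  obtain ⟨C, hC⟩ : ∃ C, ∀ n, ‖c n‖ ≤ C := ⟨∑' n, ‖c n‖, fun n =>
    hc.le_tsum n fun _ _ => norm_nonneg _⟩
  refine Summable.of_nonneg_of_le (fun n => by positivity) (fun n => ?_) (hc.mul_left C)
  rw [sq]
  exact mul_le_mul_of_nonneg_right (hC n) (norm_nonneg _)

lemma hasSum_integral_correlation_kernel {c : ℤ → ℂ} (hc : Summable fun n => ‖c n‖) {f : ℝ → ℂ}
    (hfc : Continuous f)
    (hf : ∀ t : ℝ, HasSum (fun n : ℤ => c n * Complex.exp (Complex.I * n * t)) (f t)) (θ : ℝ) :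
    HasSum (fun n : ℤ => 2 * π * (‖c n‖ ^ 2 * (1 - (Complex.exp (Complex.I * n * θ)).re
        + 1 / 4 * (Complex.exp (Complex.I * n * θ)).im)))
      (∫ t in 0..2 * π, (‖f t‖ ^ 2 - (f (t + θ) * (starRingEnd ℂ) (f t)).re +
        1 / 4 * (f (t + θ) * (starRingEnd ℂ) (f t)).im)) := by
  have hcorr := hasSum_integral_correlation hc hfc hf
  have hre := Complex.hasSum_re (hcorr θ)
  have him := Complex.hasSum_im (hcorr θ)
  have h0 := Complex.hasSum_re (hcorr 0)
  have hcont : ∀ θ, Continuous fun t => f (t + θ) * (starRingEnd ℂ) (f t) := fun θ =>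
    (hfc.comp (by fun_prop)).mul (Complex.continuous_conj.comp hfc)
  have e1 : ∀ θ, (∫ t in (0 : ℝ)..2 * π, f (t + θ) * (starRingEnd ℂ) (f t)).re
      = ∫ t in (0 : ℝ)..2 * π, (f (t + θ) * (starRingEnd ℂ) (f t)).re := fun θ =>
    (Complex.reCLM.intervalIntegral_comp_comm ((hcont θ).intervalIntegrable _ _)).symm
  have e2 : (∫ t in (0 : ℝ)..2 * π, f (t + θ) * (starRingEnd ℂ) (f t)).im
      = ∫ t in (0 : ℝ)..2 * π, (f (t + θ) * (starRingEnd ℂ) (f t)).im :=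
    (Complex.imCLM.intervalIntegral_comp_comm ((hcont θ).intervalIntegrable _ _)).symm
  have e3 : ∀ t, (f (t + 0) * (starRingEnd ℂ) (f t)).re = ‖f t‖ ^ 2 := fun t => by
    rw [add_zero, Complex.mul_conj']
    norm_cast
  rw [e1] at hre h0
  simp_rw [e3] at h0
  rw [e2] at him
  have hi1 : IntervalIntegrable (fun t => ‖f t‖ ^ 2) volume 0 (2 * π) :=
    (hfc.norm.pow 2).intervalIntegrable _ _
  have hi2 : IntervalIntegrable (fun t => (f (t + θ) * (starRingEnd ℂ) (f t)).re)
    volume 0 (2 * π) := (Complex.continuous_re.comp (hcont θ)).intervalIntegrable _ _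
  have hi3 : IntervalIntegrable (fun t => 1 / 4 * (f (t + θ) * (starRingEnd ℂ) (f t)).im)
    volume 0 (2 * π) :=
    ((Complex.continuous_im.comp (hcont θ)).const_mul (1 / 4)).intervalIntegrable _ _
  rw [intervalIntegral.integral_add (hi1.sub hi2) hi3, intervalIntegral.integral_sub hi1 hi2,
    intervalIntegral.integral_const_mul]
  convert! (h0.sub hre).add (him.mul_left (1 / 4)) using 2 with n
  have : ∀ z : ℂ, (2 * π * (‖c n‖ ^ 2 : ℂ) * z) = ((2 * π * ‖c n‖ ^ 2 : ℝ) : ℂ) * z := fun z => by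
    push_cast; ring
  rw [this, this, Complex.re_ofReal_mul, Complex.re_ofReal_mul, Complex.im_ofReal_mul]
  simp
  ring

lemma fourier_weighted_inequality {c : ℤ → ℂ} (hc : Summable fun n => ‖c n‖) (hc0 : c 0 = 0)
    {f : ℝ → ℂ} (hfc : Continuous f)
    (hf : ∀ t : ℝ, HasSum (fun n : ℤ => c n * Complex.exp (Complex.I * n * t)) (f t))
    {ε η A : ℝ} (hε : ε ≤ 1) (hη : 0 ≤ η) (hA0 : 0 ≤ A) (hA : A ≤ 7 / 8)
    (hlow : ∀ t, 1 - ε < ‖f t‖)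
    (hcorr : ∀ θ, 0 ≤ θ → ∫ t in 0..2 * π, (‖f t‖ ^ 2 - (f (t + θ) * (starRingEnd ℂ) (f t)).re +
        1 / 4 * (f (t + θ) * (starRingEnd ℂ) (f t)).im)
      ≤ 2 * π * (2 * ε) + 83 / 100 * (2 * π * θ) + 3 * η) :
    A * (1 - ε) ^ 2 - 83 / 150 - 2 * ε - η ≤ (A - 83 / 200) * ‖c 1‖ ^ 2
      + (A - 29 / 200) * ‖c (-1)‖ ^ 2 + (A - 151 / 169) * ‖c 2‖ ^ 2
      + (A - 97 / 169) * ‖c (-2)‖ ^ 2 := by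
  have hpi := Real.pi_pos
  have hsq := summable_norm_sq_of_summable_norm hc
  have hnorm : 2 * π * (1 - ε) ^ 2 ≤ 2 * π * ∑' n, ‖c n‖ ^ 2 := by
    have h0 := Complex.hasSum_re (hasSum_integral_correlation hc hfc hf 0)
    have e3 : ∀ t, f (t + 0) * (starRingEnd ℂ) (f t) = ((‖f t‖ ^ 2 : ℝ) : ℂ) := fun t => by
      rw [add_zero, Complex.mul_conj']
      norm_cast
    simp_rw [e3, intervalIntegral.integral_ofReal] at h0
    have h1 : HasSum (fun n => 2 * π * ‖c n‖ ^ 2) (∫ t in (0 : ℝ)..2 * π, ‖f t‖ ^ 2) := by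
      convert! h0 using 2 with n
      simp
      norm_cast
    rw [← tsum_mul_left, h1.tsum_eq]
    have h2 : ∫ t in (0 : ℝ)..2 * π, (1 - ε) ^ 2 ≤ ∫ t in (0 : ℝ)..2 * π, ‖f t‖ ^ 2 :=
      intervalIntegral.integral_mono_on (by positivity) (by simp)
        ((hfc.norm.pow 2).intervalIntegrable _ _) fun t _ =>
          pow_le_pow_left₀ (by linarith) (hlow t).le 2
    simpa using h2
  set k : ℤ → ℝ → ℝ := fun n θ => 1 - (Complex.exp (Complex.I * n * θ)).re
    + 1 / 4 * (Complex.exp (Complex.I * n * θ)).im with hk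
  have hkc : ∀ n, Continuous (k n) := fun n => by fun_prop
  have hkb : ∀ n θ, ‖k n θ‖ ≤ 3 := abs_kernel_le
  have hi1 : IntegrableOn (fun θ : ℝ => θ * rexp (-(3 * θ))) (Ioi 0) := by
    simpa using integrableOn_pow_mul_exp_neg_three_mul 1
  have hi2 := integrableOn_pow_mul_exp_neg_three_mul 2
  set g : ℝ → ℝ := fun θ => ∑' n, ‖c n‖ ^ 2 * k n θ with hg
  have hgsum : ∀ θ, HasSum (fun n => ‖c n‖ ^ 2 * k n θ) (g θ) := fun θ => by
    refine (Summable.of_norm_bounded (hsq.mul_right 3) fun n => ?_).hasSum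
    rw [norm_mul, Real.norm_of_nonneg (by positivity : (0:ℝ) ≤ ‖c n‖ ^ 2)]
    exact mul_le_mul_of_nonneg_left (hkb n θ) (by positivity)
  have hgle : ∀ θ, 0 ≤ θ → g θ ≤ 2 * ε + η + 83 / 100 * θ := fun θ hθ => by
    have h1 := (hasSum_integral_correlation_kernel hc hfc hf θ).unique ((hgsum θ).mul_left (2 * π))
    have h2 := hcorr θ hθ
    rw [h1] at h2
    have h3 : 2 * π * g θ ≤ 2 * π * (2 * ε + η + 83 / 100 * θ) := by
      nlinarith [Real.pi_gt_three]
    exact le_of_mul_le_mul_left h3 (by positivity)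
  have hgc : Continuous g := continuous_tsum (fun n => (hkc n).const_mul _) (hsq.mul_right 3)
    fun n θ => by
      rw [norm_mul, Real.norm_of_nonneg (by positivity : (0:ℝ) ≤ ‖c n‖ ^ 2)]
      exact mul_le_mul_of_nonneg_left (hkb n θ) (by positivity)
  have hgb : ∀ θ, ‖g θ‖ ≤ ∑' n, ‖c n‖ ^ 2 * 3 := fun θ =>
    tsum_of_norm_bounded (hsq.mul_right 3).hasSum fun n => by
      rw [norm_mul, Real.norm_of_nonneg (by positivity : (0:ℝ) ≤ ‖c n‖ ^ 2)]
      exact mul_le_mul_of_nonneg_left (hkb n θ) (by positivity)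
  have hw : HasSum (fun n => ‖c n‖ ^ 2 * kernelWeight n)
      (∫ θ in Ioi (0 : ℝ), 9 * (θ * rexp (-(3 * θ))) * g θ) := by
    have := hasSum_integral_of_dominated_convergence (μ := volume.restrict (Ioi (0 : ℝ)))
      (F := fun n θ => ‖c n‖ ^ 2 * (9 * (θ * rexp (-(3 * θ))) * k n θ))
      (f := fun θ => 9 * (θ * rexp (-(3 * θ))) * g θ)
      (fun n θ => (‖c n‖ ^ 2 * 3) * (9 * (θ * rexp (-(3 * θ)))))
      (fun n => Continuous.aestronglyMeasurable (by have := hkc n; fun_prop))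
      (fun n => (ae_restrict_iff' measurableSet_Ioi).2 <| Filter.Eventually.of_forall
        fun θ hθ => by
          have hθ' : (0 : ℝ) < θ := hθ
          rw [norm_mul, norm_mul, Real.norm_of_nonneg (by positivity : (0:ℝ) ≤ ‖c n‖ ^ 2),
            Real.norm_of_nonneg (by positivity : (0:ℝ) ≤ 9 * (θ * rexp (-(3 * θ))))]
          have := mul_le_mul_of_nonneg_left (hkb n θ)
            (by positivity : (0:ℝ) ≤ ‖c n‖ ^ 2 * (9 * (θ * rexp (-(3 * θ)))))
          linarith)
      (Filter.Eventually.of_forall fun θ => (hsq.mul_right 3).mul_right _)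
      (by
        simp_rw [tsum_mul_right]
        exact (hi1.const_mul 9).const_mul _)
      (Filter.Eventually.of_forall fun θ => by
        convert! (hgsum θ).mul_left (9 * (θ * rexp (-(3 * θ)))) using 2 with n
        ring)
    simpa only [MeasureTheory.integral_const_mul, hk, integral_kernel] using this
  have hwle : ∫ θ in Ioi (0 : ℝ), 9 * (θ * rexp (-(3 * θ))) * g θ ≤ 2 * ε + η + 83 / 150 := by
    have hbi : Integrable (fun θ : ℝ => 9 * (2 * ε + η) * (θ * rexp (-(3 * θ)))
        + 747 / 100 * (θ ^ 2 * rexp (-(3 * θ)))) (volume.restrict (Ioi 0)) :=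
      (hi1.const_mul _).add (hi2.const_mul _)
    have hgi : IntegrableOn (fun θ => 9 * (θ * rexp (-(3 * θ))) * g θ) (Ioi 0) :=
      Integrable.mul_bdd (c := ∑' n, ‖c n‖ ^ 2 * 3) (hi1.const_mul 9)
        hgc.aestronglyMeasurable (Filter.Eventually.of_forall hgb)
    have h1 := setIntegral_mono_on hgi hbi measurableSet_Ioi fun θ (hθ : 0 < θ) => by
      have := mul_le_mul_of_nonneg_left (hgle θ hθ.le)
        (by positivity : 0 ≤ 9 * (θ * rexp (-(3 * θ))))
      refine this.trans (le_of_eq ?_)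
      ring
    rw [MeasureTheory.integral_add (hi1.const_mul _) (hi2.const_mul _),
      MeasureTheory.integral_const_mul, MeasureTheory.integral_const_mul,
      integral_id_mul_exp_neg_three_mul, integral_sq_mul_exp_neg_three_mul] at h1
    linarith
  have hs : HasSum (fun n => (A - kernelWeight n) * ‖c n‖ ^ 2)
      (A * ∑' n, ‖c n‖ ^ 2 - ∫ θ in Ioi (0 : ℝ), 9 * (θ * rexp (-(3 * θ))) * g θ) := by
    convert! (hsq.hasSum.mul_left A).sub hw using 2 with n
    ring
  have hfin : A * ∑' n, ‖c n‖ ^ 2 - ∫ θ in Ioi (0 : ℝ), 9 * (θ * rexp (-(3 * θ))) * g θ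
      ≤ ∑ n ∈ ({1, -1, 2, -2} : Finset ℤ), (A - kernelWeight n) * ‖c n‖ ^ 2 := by
    rw [← hs.tsum_eq]
    have h1 := hs.summable.neg.sum_le_tsum ({1, -1, 2, -2} : Finset ℤ) fun n hn => by
      rcases eq_or_ne n 0 with rfl | h0
      · simp [hc0]
      · have h3 : 3 ≤ |n| := by
          simp only [Finset.mem_insert, Finset.mem_singleton, not_or] at hn
          rcases abs_cases n with h | h <;> omega
        have := seven_eighths_le_kernelWeight h3
        have h4 : 0 ≤ (kernelWeight n - A) * ‖c n‖ ^ 2 := mul_nonneg (by linarith) (by positivity)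
        linarith
    simp only [Finset.sum_neg_distrib, tsum_neg] at h1
    linarith
  have hsum4 : ∑ n ∈ ({1, -1, 2, -2} : Finset ℤ), (A - kernelWeight n) * ‖c n‖ ^ 2
      = (A - 83 / 200) * ‖c 1‖ ^ 2
      + (A - 29 / 200) * ‖c (-1)‖ ^ 2 + (A - 151 / 169) * ‖c 2‖ ^ 2
      + (A - 97 / 169) * ‖c (-2)‖ ^ 2 := by
    rw [Finset.sum_insert (by decide), Finset.sum_insert (by decide),
      Finset.sum_insert (by decide), Finset.sum_singleton]
    simp only [kernelWeight]
    norm_num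
    ring
  have hnorm' := mul_le_mul_of_nonneg_left (le_of_mul_le_mul_left hnorm (by positivity)) hA0
  linarith
end

section
open MeasureTheory Metric

lemma det_smul_one_complex (a : ℂ) : (a • (1 : ℂ →L[ℝ] ℂ)).det = ‖a‖ ^ 2 := by
  rw [← Complex.normSq_eq_norm_sq, ← Algebra.norm_complex_apply, Algebra.norm_apply]
  rfl

lemma integrableOn_sq_norm_deriv_of_injOn {H H' : ℂ → ℂ} {S : Set ℂ} (hS : MeasurableSet S)
    (hd : ∀ z ∈ S, HasDerivAt H (H' z) z) (hinj : InjOn H S)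
    (hb : Bornology.IsBounded (H '' S)) : IntegrableOn (fun z => ‖H' z‖ ^ 2) S := by
  have h := integrableOn_image_iff_integrableOn_abs_det_fderiv_smul volume hS
    (fun z hz => (hd z hz).complexToReal_fderiv.hasFDerivWithinAt) hinj (fun _ => (1 : ℝ))
  have h1 : IntegrableOn (fun _ => (1 : ℝ)) (H '' S) :=
    integrableOn_const hb.measure_lt_top.ne
  refine (h.1 h1).congr_fun (fun z _ => ?_) hS
  simp only [det_smul_one_complex, smul_eq_mul, mul_one]
  exact abs_of_nonneg (by positivity)

lemma injOn_exp_strip {a b : ℝ} (hab : b - a < 2 * π) :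
    InjOn Complex.exp {z | a ≤ z.im ∧ z.im ≤ b} := by
  intro z hz w hw h
  obtain ⟨n, hn⟩ := Complex.exp_eq_exp_iff_exists_int.1 h
  have him := congrArg Complex.im hn
  simp at him
  have h1 : |(n : ℝ) * (2 * π)| < 2 * π := by
    rw [abs_lt]
    constructor <;> linarith [hz.1, hz.2, hw.1, hw.2]
  rw [abs_mul, abs_of_pos two_pi_pos] at h1
  have h2 : |(n : ℝ)| < 1 := by
    by_contra! hc
    nlinarith [two_pi_pos]
  have h3 : |n| < 1 := by exact_mod_cast h2
  rw [Int.abs_lt_one_iff.1 h3] at hn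
  simpa using hn

lemma integrableOn_norm_deriv_comp_exp {h : ℂ → ℂ} (hh : DifferentiableOn ℂ h (ball 0 1))
    (hinj : InjOn h (ball 0 1)) {C : ℝ} (hC : ∀ z ∈ ball (0 : ℂ) 1, ‖h z‖ ≤ C) :
    IntegrableOn (fun p : ℝ × ℝ => ‖Complex.exp (p.1 + p.2 * Complex.I) *
      deriv h (Complex.exp (p.1 + p.2 * Complex.I))‖) (Ioo (-1) 0 ×ˢ Icc 0 (2 * π)) := by
  have hball : ∀ z : ℂ, z.re < 0 → Complex.exp z ∈ ball (0 : ℂ) 1 := fun z hz => by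
    rw [mem_ball_zero_iff, Complex.norm_exp]
    exact Real.exp_zero ▸ Real.exp_lt_exp.2 hz
  have hder : ∀ z : ℂ, z.re < 0 → HasDerivAt (fun z => h (Complex.exp z))
      (Complex.exp z * deriv h (Complex.exp z)) z := fun z hz => by
    have h1 := ((hh _ (hball z hz)).differentiableAt
      (isOpen_ball.mem_nhds (hball z hz))).hasDerivAt.comp z (Complex.hasDerivAt_exp z)
    rw [mul_comm]
    exact h1
  have hstrip : ∀ a b : ℝ, b - a < 2 * π → IntegrableOn (fun z : ℂ => ‖Complex.exp z *
      deriv h (Complex.exp z)‖ ^ 2) ({z | z.re ∈ Ioo (-1) 0} ∩ {z | a ≤ z.im ∧ z.im ≤ b}) := by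
    intro a b hab
    refine integrableOn_sq_norm_deriv_of_injOn (H := fun z => h (Complex.exp z)) ?_
      (fun z hz => hder z hz.1.2) ?_ ?_
    · exact ((measurableSet_Ioo).preimage Complex.measurable_re).inter
        ((measurableSet_Icc (a := a) (b := b)).preimage Complex.measurable_im)
    · exact fun z hz w hw e => injOn_exp_strip hab hz.2 hw.2
        (hinj (hball z hz.1.2) (hball w hw.1.2) e)
    · refine (isBounded_iff_forall_norm_le.2 ⟨C, ?_⟩)
      rintro _ ⟨z, hz, rfl⟩
      exact hC _ (hball z hz.1.2)
  have hall := (hstrip 0 π (by linarith [pi_pos])).union (hstrip π (2 * π) (by linarith [pi_pos]))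
  set S : Set ℂ := {z | z.re ∈ Ioo (-1) 0} ∩ {z | 0 ≤ z.im ∧ z.im ≤ 2 * π} with hSdef
  have hS : MeasurableSet S := ((measurableSet_Ioo).preimage Complex.measurable_re).inter
        ((measurableSet_Icc (a := 0) (b := 2 * π)).preimage Complex.measurable_im)
  have hsq : IntegrableOn (fun z : ℂ => ‖Complex.exp z * deriv h (Complex.exp z)‖ ^ 2) S := by
    refine hall.mono_set fun z hz => ?_
    rcases le_total z.im π with h1 | h1
    · exact Or.inl ⟨hz.1, hz.2.1, h1⟩
    · exact Or.inr ⟨hz.1, h1, hz.2.2⟩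
  have hSb : volume S ≠ ⊤ := by
    refine (Bornology.IsBounded.measure_lt_top (isBounded_iff_forall_norm_le.2
      ⟨1 + 2 * π, fun z hz => ?_⟩)).ne
    refine (Complex.norm_le_abs_re_add_abs_im z).trans (add_le_add ?_ ?_)
    · rw [abs_le]; exact ⟨hz.1.1.le, by linarith [hz.1.2]⟩
    · rw [abs_le]; exact ⟨by linarith [hz.2.1, pi_pos], hz.2.2⟩
  have hcont : ContinuousOn (fun z : ℂ => ‖Complex.exp z * deriv h (Complex.exp z)‖) S := by
    refine (Complex.continuous_exp.continuousOn.mul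
      ((hh.deriv isOpen_ball).continuousOn.comp Complex.continuous_exp.continuousOn
        fun z hz => hball z hz.1.2)).norm
  have hlin : IntegrableOn (fun z : ℂ => ‖Complex.exp z * deriv h (Complex.exp z)‖) S := by
    refine Integrable.mono' ((integrableOn_const (C := (1 : ℝ)) hSb).add hsq)
      (hcont.aestronglyMeasurable hS) (Filter.Eventually.of_forall fun z => ?_)
    simp only [Pi.add_apply, norm_norm]
    nlinarith [sq_nonneg (‖Complex.exp z * deriv h (Complex.exp z)‖ - 1)]
  have hmp := Complex.volume_preserving_equiv_real_prod.symm
  have := (hmp.integrableOn_comp_preimage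
    Complex.measurableEquivRealProd.symm.measurableEmbedding).2 hlin
  have hset : Complex.measurableEquivRealProd.symm ⁻¹' S = Ioo (-1) 0 ×ˢ Icc 0 (2 * π) := rfl
  rw [hset] at this
  refine this.congr_fun (fun p _ => ?_) (measurableSet_Ioo.prod measurableSet_Icc)
  have hp : Complex.measurableEquivRealProd.symm p = p.1 + p.2 * Complex.I :=
    Complex.mk_eq_add_mul_I p.1 p.2
  simp only [Function.comp_apply, hp]
end

section
open MeasureTheory Metric

/-- A bounded sense-preserving harmonic map `h + conj g` of the unit disk into itself, fixing the
origin, whose modulus tends to `1` at the boundary. -/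
structure IsHarmonicDiskMap (h g : ℂ → ℂ) : Prop where
  diff_left : DifferentiableOn ℂ h (ball 0 1)
  diff_right : DifferentiableOn ℂ g (ball 0 1)
  left_zero : h 0 = 0
  right_zero : g 0 = 0
  deriv_le : ∀ z ∈ ball (0 : ℂ) 1, ‖deriv g z‖ ≤ ‖deriv h z‖
  right_lt_left : ∀ z ∈ ball (0 : ℂ) 1, z ≠ 0 → ‖g z‖ < ‖h z‖
  deriv_ne : deriv h 0 ≠ 0
  injOn : InjOn h (ball 0 1)
  bounded : ∃ C, ∀ z ∈ ball (0 : ℂ) 1, ‖h z‖ ≤ C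
  norm_lt_one : ∀ z ∈ ball (0 : ℂ) 1, ‖h z + (starRingEnd ℂ) (g z)‖ < 1
  boundary : ∀ ε > 0, ∃ r < 1, ∀ z : ℂ, r < ‖z‖ → ‖z‖ < 1 → 1 - ε < ‖h z + (starRingEnd ℂ) (g z)‖

/-- The map `h + conj g` in logarithmic polar coordinates. -/
noncomputable def polarLift (h g : ℂ → ℂ) (p : ℝ × ℝ) : ℂ :=
  h (Complex.exp (p.1 + p.2 * Complex.I)) +
    (starRingEnd ℂ) (g (Complex.exp (p.1 + p.2 * Complex.I)))

lemma exp_polar_mem_ball {p : ℝ × ℝ} (hp : p.1 < 0) :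
    Complex.exp (p.1 + p.2 * Complex.I) ∈ ball (0 : ℂ) 1 := by
  rw [mem_ball_zero_iff, Complex.norm_exp]
  simpa using hp

lemma norm_exp_polar (p : ℝ × ℝ) : ‖Complex.exp (p.1 + p.2 * Complex.I)‖ = rexp p.1 := by
  rw [Complex.norm_exp]
  simp

lemma hasFDerivAt_comp_exp_polar {h : ℂ → ℂ} (hh : DifferentiableOn ℂ h (ball 0 1)) {p : ℝ × ℝ}
    (hp : p.1 < 0) :
    HasFDerivAt (fun p : ℝ × ℝ => h (Complex.exp (p.1 + p.2 * Complex.I)))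
      (((Complex.exp (p.1 + p.2 * Complex.I) * deriv h (Complex.exp (p.1 + p.2 * Complex.I))) •
        (1 : ℂ →L[ℝ] ℂ)).comp (Complex.equivRealProdCLM.symm : ℝ × ℝ →L[ℝ] ℂ)) p := by
  have hb := exp_polar_mem_ball hp
  have h1 := ((hh _ hb).differentiableAt (isOpen_ball.mem_nhds hb)).hasDerivAt.comp
    ((p.1 : ℂ) + p.2 * Complex.I) (Complex.hasDerivAt_exp _)
  rw [mul_comm] at h1
  have hE : ∀ q : ℝ × ℝ, Complex.equivRealProdCLM.symm q = q.1 + q.2 * Complex.I :=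
    fun q => Complex.mk_eq_add_mul_I q.1 q.2
  rw [← hE] at h1
  have h2 := h1.complexToReal_fderiv.comp p Complex.equivRealProdCLM.symm.hasFDerivAt
  have h3 : (h ∘ Complex.exp) ∘ Complex.equivRealProdCLM.symm
      = fun p : ℝ × ℝ => h (Complex.exp (p.1 + p.2 * Complex.I)) := by
    ext q
    simp only [Function.comp_apply, hE]
  rw [h3, hE] at h2
  exact h2

lemma fderiv_polarLift_apply {h g : ℂ → ℂ} (H : IsHarmonicDiskMap h g) {p : ℝ × ℝ} (hp : p.1 < 0)
    (v : ℝ × ℝ) :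
    fderiv ℝ (polarLift h g) p v =
      Complex.exp (p.1 + p.2 * Complex.I) * deriv h (Complex.exp (p.1 + p.2 * Complex.I)) *
        (v.1 + v.2 * Complex.I) +
      (starRingEnd ℂ) (Complex.exp (p.1 + p.2 * Complex.I) *
        deriv g (Complex.exp (p.1 + p.2 * Complex.I)) * (v.1 + v.2 * Complex.I)) := by
  have h1 := hasFDerivAt_comp_exp_polar H.diff_left hp
  have h2 := (Complex.conjCLE : ℂ →L[ℝ] ℂ).hasFDerivAt.comp p
    (hasFDerivAt_comp_exp_polar H.diff_right hp)
  have hE : ∀ q : ℝ × ℝ, Complex.equivRealProdCLM.symm q = q.1 + q.2 * Complex.I :=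
    fun q => Complex.mk_eq_add_mul_I q.1 q.2
  have h3 : HasFDerivAt (polarLift h g) _ p := h1.add h2
  rw [h3.fderiv]
  simp only [add_apply, ContinuousLinearMap.comp_apply,
    smul_apply, ContinuousLinearEquiv.coe_coe, hE,
    one_apply_eq_self, smul_eq_mul, Complex.conjCLE_apply]

lemma contDiffOn_polarLift {h g : ℂ → ℂ} (H : IsHarmonicDiskMap h g) {n : ℕ∞} :
    ContDiffOn ℝ n (polarLift h g) {p | p.1 < 0} := by
  have key : ∀ k : ℂ → ℂ, DifferentiableOn ℂ k (ball 0 1) →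
      ContDiffOn ℝ n (fun p : ℝ × ℝ => k (Complex.exp (p.1 + p.2 * Complex.I))) {p | p.1 < 0} := by
    intro k hk
    refine ((hk.contDiffOn isOpen_ball).restrict_scalars ℝ).comp (t := ball (0 : ℂ) 1)
      (ContDiff.contDiffOn ?_) fun p hp => exp_polar_mem_ball hp
    have hl : ContDiff ℝ n fun p : ℝ × ℝ => ((p.1 : ℂ) + p.2 * Complex.I) :=
      (Complex.ofRealCLM.contDiff.comp contDiff_fst).add
        ((Complex.ofRealCLM.contDiff.comp contDiff_snd).mul contDiff_const)
    exact hl.cexp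
  exact (key h H.diff_left).add
    ((Complex.conjCLE : ℂ →L[ℝ] ℂ).contDiff.comp_contDiffOn (key g H.diff_right))

lemma polarLift_ne_zero {h g : ℂ → ℂ} (H : IsHarmonicDiskMap h g) {p : ℝ × ℝ} (hp : p.1 < 0) :
    polarLift h g p ≠ 0 := by
  intro h0
  have h1 := H.right_lt_left _ (exp_polar_mem_ball hp) (Complex.exp_ne_zero _)
  rw [polarLift, add_eq_zero_iff_eq_neg] at h0
  rw [h0, norm_neg, Complex.norm_conj] at h1
  exact h1.false

lemma polarLift_periodic (h g : ℂ → ℂ) (p : ℝ × ℝ) :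
    polarLift h g (p + (0, 2 * π)) = polarLift h g p := by
  have : Complex.exp (((p + (0, 2 * π)).1 : ℝ) + ((p + (0, 2 * π)).2 : ℝ) * Complex.I)
      = Complex.exp (p.1 + p.2 * Complex.I) := by
    rw [← Complex.exp_periodic (p.1 + p.2 * Complex.I)]
    congr 1
    simp
    ring
  rw [polarLift, this, polarLift]

lemma polarLift_jacobian_nonneg {h g : ℂ → ℂ} (H : IsHarmonicDiskMap h g) {p : ℝ × ℝ}
    (hp : p.1 < 0) :
    0 ≤ ((starRingEnd ℂ) (fderiv ℝ (polarLift h g) p (1, 0)) *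
      fderiv ℝ (polarLift h g) p (0, 1)).im := by
  rw [fderiv_polarLift_apply H hp, fderiv_polarLift_apply H hp]
  have hle : ‖Complex.exp (p.1 + p.2 * Complex.I) *
      deriv g (Complex.exp (p.1 + p.2 * Complex.I))‖ ≤ ‖Complex.exp (p.1 + p.2 * Complex.I) *
      deriv h (Complex.exp (p.1 + p.2 * Complex.I))‖ := by
    rw [norm_mul, norm_mul]
    exact mul_le_mul_of_nonneg_left (H.deriv_le _ (exp_polar_mem_ball hp)) (norm_nonneg _)
  generalize Complex.exp (p.1 + p.2 * Complex.I) *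
      deriv g (Complex.exp (p.1 + p.2 * Complex.I)) = b at hle ⊢
  generalize Complex.exp (p.1 + p.2 * Complex.I) *
      deriv h (Complex.exp (p.1 + p.2 * Complex.I)) = a at hle ⊢
  have hsq : ‖b‖ ^ 2 ≤ ‖a‖ ^ 2 := pow_le_pow_left₀ (norm_nonneg _) hle 2
  rw [← Complex.normSq_eq_norm_sq, ← Complex.normSq_eq_norm_sq, Complex.normSq_apply,
    Complex.normSq_apply] at hsq
  simp
  nlinarith

lemma integrableOn_fderiv_polarLift {h g : ℂ → ℂ} (H : IsHarmonicDiskMap h g) :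
    IntegrableOn (fun p => ‖fderiv ℝ (polarLift h g) p (1, 0)‖) (Ioo (-1) 0 ×ˢ Icc 0 (2 * π)) := by
  obtain ⟨C, hC⟩ := H.bounded
  have h1 := (integrableOn_norm_deriv_comp_exp H.diff_left H.injOn hC).const_mul 2
  have hms : MeasurableSet (Ioo (-1 : ℝ) 0 ×ˢ Icc 0 (2 * π)) :=
    measurableSet_Ioo.prod measurableSet_Icc
  have ho : IsOpen {p : ℝ × ℝ | p.1 < 0} := isOpen_lt continuous_fst continuous_const
  have hcont : ContinuousOn (fun p => ‖fderiv ℝ (polarLift h g) p (1, 0)‖)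
      (Ioo (-1) 0 ×ˢ Icc 0 (2 * π)) := by
    have h2 : ContinuousOn (fderiv ℝ (polarLift h g)) {p | p.1 < 0} :=
      (contDiffOn_polarLift (n := 1) H).continuousOn_fderiv_of_isOpen ho le_rfl
    exact ((h2.clm_apply continuousOn_const).mono fun p hp => hp.1.2).norm
  refine Integrable.mono' h1 (hcont.aestronglyMeasurable hms)
    ((ae_restrict_iff' hms).2 (Filter.Eventually.of_forall fun p hp => ?_))
  have hp' : p.1 < 0 := hp.1.2
  rw [norm_norm, fderiv_polarLift_apply H hp']
  refine (norm_add_le _ _).trans ?_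
  rw [Complex.norm_conj]
  simp only [Complex.ofReal_one, Complex.ofReal_zero, zero_mul, add_zero, mul_one]
  have := mul_le_mul_of_nonneg_left (H.deriv_le _ (exp_polar_mem_ball hp'))
    (norm_nonneg (Complex.exp (p.1 + p.2 * Complex.I)))
  rw [norm_mul, norm_mul]
  linarith
end

section
open MeasureTheory Metric

lemma integral_logDeriv_circle {h : ℂ → ℂ} (hh : DifferentiableOn ℂ h (ball 0 1)) (h0 : h 0 = 0)
    (hne : ∀ z ∈ ball (0 : ℂ) 1, z ≠ 0 → h z ≠ 0) (hd : deriv h 0 ≠ 0) {σ : ℝ} (hσ : σ < 0) :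
    ∫ t in 0..2 * π, Complex.I * (Complex.exp (σ + t * Complex.I) *
      deriv h (Complex.exp (σ + t * Complex.I)) / h (Complex.exp (σ + t * Complex.I)))
      = 2 * π * Complex.I := by
  set k := dslope h 0 with hk
  have hkd : DifferentiableOn ℂ k (ball 0 1) :=
    (Complex.differentiableOn_dslope (isOpen_ball.mem_nhds (mem_ball_self one_pos))).2 hh
  have hhk : ∀ z, h z = z * k z := fun z => by
    have := sub_smul_dslope h 0 z
    rw [h0, sub_zero, sub_zero, smul_eq_mul] at this
    exact this.symm
  have hkne : ∀ z ∈ ball (0 : ℂ) 1, k z ≠ 0 := fun z hz => by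
    rcases eq_or_ne z 0 with rfl | hz0
    · rwa [hk, dslope_same]
    · exact fun e => hne z hz hz0 (by rw [hhk, e, mul_zero])
  have hlog : DifferentiableOn ℂ (fun z => deriv k z / k z) (ball 0 1) :=
    (hkd.deriv isOpen_ball).div hkd hkne
  have hr : rexp σ < 1 := by simpa using hσ
  have hsub : closedBall (0 : ℂ) (rexp σ) ⊆ ball 0 1 := closedBall_subset_ball hr
  have hcauchy : (∮ z in C(0, rexp σ), deriv k z / k z) = 0 :=
    Complex.circleIntegral_eq_zero_of_differentiable_on_off_countable (exp_pos _).le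
      countable_empty (hlog.continuousOn.mono hsub) fun z hz =>
        (hlog z (hsub (ball_subset_closedBall hz.1))).differentiableAt
          (isOpen_ball.mem_nhds (hsub (ball_subset_closedBall hz.1)))
  have hcm : ∀ t : ℝ, circleMap 0 (rexp σ) t = Complex.exp (σ + t * Complex.I) := fun t => by
    rw [circleMap, Complex.exp_add, zero_add, Complex.ofReal_exp]
  rw [circleIntegral] at hcauchy
  simp only [deriv_circleMap, smul_eq_mul, hcm] at hcauchy
  have hmem : ∀ t : ℝ, Complex.exp (σ + t * Complex.I) ∈ ball (0 : ℂ) 1 := fun t =>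
    exp_polar_mem_ball (p := (σ, t)) hσ
  have hsplit : ∀ t : ℝ, Complex.I * (Complex.exp (σ + t * Complex.I) *
      deriv h (Complex.exp (σ + t * Complex.I)) / h (Complex.exp (σ + t * Complex.I)))
      = Complex.I + circleMap 0 (rexp σ) t * Complex.I *
        (deriv k (Complex.exp (σ + t * Complex.I)) / k (Complex.exp (σ + t * Complex.I))) := by
    intro t
    rw [hcm]
    have hu0 := Complex.exp_ne_zero (σ + t * Complex.I)
    have hm := hmem t
    generalize Complex.exp (σ + t * Complex.I) = u at hu0 hm
    have hkd' := ((hkd u hm).differentiableAt (isOpen_ball.mem_nhds hm)).hasDerivAt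
    have hdh : deriv h u = k u + u * deriv k u := by
      have e : h = fun z => z * k z := funext hhk
      have := (hasDerivAt_id' u).fun_mul hkd'
      rw [← e] at this
      rw [this.deriv, one_mul]
    have hku := hkne u hm
    rw [hdh, hhk u]
    field_simp
  simp_rw [hsplit]
  rw [intervalIntegral.integral_add (by simp) ?_]
  · simp only [hcm]
    rw [hcauchy]
    simp
  · refine Continuous.intervalIntegrable ?_ _ _
    simp only [hcm]
    have he : Continuous fun t : ℝ => Complex.exp (σ + t * Complex.I) := by fun_prop
    exact (he.mul continuous_const).mul (hlog.continuousOn.comp_continuous he hmem)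

lemma integral_angular_polarLift {h g : ℂ → ℂ} (H : IsHarmonicDiskMap h g) {σ : ℝ} (hσ : σ < 0) :
    ∫ t in 0..2 * π,
      (deriv (fun t => polarLift h g (σ, t)) t / polarLift h g (σ, t)).im = 2 * π := by
  set u : ℝ → ℂ := fun t => Complex.exp (σ + t * Complex.I) with hu
  have hmem : ∀ t, u t ∈ ball (0 : ℂ) 1 := fun t => exp_polar_mem_ball (p := (σ, t)) hσ
  have hu0 : ∀ t, u t ≠ 0 := fun t => Complex.exp_ne_zero _
  have hhne : ∀ z ∈ ball (0 : ℂ) 1, z ≠ 0 → h z ≠ 0 := fun z hz hz0 e => by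
    have := H.right_lt_left z hz hz0
    rw [e, norm_zero] at this
    exact (norm_nonneg _).not_gt this
  have hud : ∀ t, HasDerivAt u (u t * Complex.I) t := fun t => by
    have h1 : HasDerivAt (fun t : ℝ => (t : ℂ)) 1 t := Complex.ofRealCLM.hasDerivAt
    have := ((h1.mul_const Complex.I).const_add (σ : ℂ)).cexp
    rwa [one_mul] at this
  have hcomp : ∀ k : ℂ → ℂ, DifferentiableOn ℂ k (ball 0 1) → ∀ t,
      HasDerivAt (fun t => k (u t)) (deriv k (u t) * (u t * Complex.I)) t := fun k hk t =>
    ((hk _ (hmem t)).differentiableAt (isOpen_ball.mem_nhds (hmem t))).hasDerivAt.comp t (hud t)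
  have hfd : ∀ t, HasDerivAt (fun t => polarLift h g (σ, t)) (deriv h (u t) * (u t * Complex.I) +
      (starRingEnd ℂ) (deriv g (u t) * (u t * Complex.I))) t := fun t =>
    (hcomp h H.diff_left t).add
      ((Complex.conjCLE : ℂ →L[ℝ] ℂ).hasFDerivAt.comp_hasDerivAt t (hcomp g H.diff_right t))
  have hfne : ∀ t, polarLift h g (σ, t) ≠ 0 := fun t => polarLift_ne_zero H hσ
  have hhu : ∀ t, h (u t) ≠ 0 := fun t => hhne _ (hmem t) (hu0 t)
  set q : ℝ → ℂ := fun t => polarLift h g (σ, t) / h (u t) with hq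
  have hslit : ∀ t, q t ∈ Complex.slitPlane := fun t => by
    refine Complex.mem_slitPlane_of_norm_lt_one (z := q t - 1) ?_ |> fun h => by simpa using h
    have : q t - 1 = (starRingEnd ℂ) (g (u t)) / h (u t) := by
      have := hhu t
      simp only [hq, polarLift]
      field_simp
      simp [hu]
    rw [this, norm_div, Complex.norm_conj, div_lt_one (norm_pos_iff.2 (hhu t))]
    exact H.right_lt_left _ (hmem t) (hu0 t)
  set k1 : ℝ → ℂ := fun t => deriv (fun t => polarLift h g (σ, t)) t / polarLift h g (σ, t) with hk1
  set k2 : ℝ → ℂ := fun t => Complex.I * (u t * deriv h (u t) / h (u t)) with hk2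
  have hqd : ∀ t, HasDerivAt (fun t => Complex.log (q t)) (k1 t - k2 t) t := fun t => by
    have h1 := ((hfd t).fun_div (hcomp h H.diff_left t) (hhu t)).clog_real (hslit t)
    convert! h1 using 1
    have := hhu t
    have := hfne t
    simp only [hk1, hk2, (hfd t).deriv]
    field_simp
  have huc : Continuous u := by fun_prop
  have hhc : Continuous fun t => h (u t) :=
    H.diff_left.continuousOn.comp_continuous huc hmem
  have hhdc : Continuous fun t => deriv h (u t) :=
    (H.diff_left.deriv isOpen_ball).continuousOn.comp_continuous huc hmem
  have hgdc : Continuous fun t => deriv g (u t) :=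
    (H.diff_right.deriv isOpen_ball).continuousOn.comp_continuous huc hmem
  have hk2c : Continuous k2 := continuous_const.mul ((huc.mul hhdc).div hhc hhu)
  have hk1c : Continuous k1 := by
    refine Continuous.div ?_ (continuous_iff_continuousAt.2 fun t => (hfd t).continuousAt) hfne
    have : deriv (fun t => polarLift h g (σ, t)) = fun t => deriv h (u t) * (u t * Complex.I) +
      (starRingEnd ℂ) (deriv g (u t) * (u t * Complex.I)) := funext fun t => (hfd t).deriv
    rw [this]
    fun_prop
  have h_integral := intervalIntegral.integral_eq_sub_of_hasDerivAt (a := 0) (b := 2 * π)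
    (fun t _ => hqd t) ((hk1c.sub hk2c).intervalIntegrable _ _)
  have hqper : q (2 * π) = q 0 := by
    have h1 : u (2 * π) = u 0 := by
      simp only [hu]
      rw [← Complex.exp_periodic (σ + (0 : ℝ) * Complex.I)]
      congr 1
      simp
    have h2 := polarLift_periodic h g (σ, 0)
    simp only [Prod.mk_add_mk, add_zero, zero_add] at h2
    simp only [hq, h1, h2]
  rw [hqper, sub_self, intervalIntegral.integral_sub (hk1c.intervalIntegrable _ _)
    (hk2c.intervalIntegrable _ _),
    integral_logDeriv_circle H.diff_left H.left_zero hhne H.deriv_ne hσ, sub_eq_zero] at h_integral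
  have h3 := Complex.imCLM.intervalIntegral_comp_comm 
    (hk1c.intervalIntegrable (μ := volume) 0 (2 * π))
  simp only [Complex.imCLM_apply] at h3
  rw [h3, h_integral]
  simp
end

section
open MeasureTheory Metric

/-- The Fourier coefficients on the circle of radius `r` of `h + conj g`, where `h`, `g` have Taylor
coefficients `a`, `b` and `b 0 = 0`. -/
noncomputable def harmonicCoeff (a b : ℕ → ℂ) (r : ℝ) : ℤ → ℂ
  | Int.ofNat n => a n * r ^ n
  | Int.negSucc n => (starRingEnd ℂ) (b (n + 1) * r ^ (n + 1))

/-- The Taylor coefficients of `h` at the origin. -/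
noncomputable def taylorCoeff (h : ℂ → ℂ) (n : ℕ) : ℂ := (n.factorial : ℂ)⁻¹ * iteratedDeriv n h 0

lemma hasSum_taylorCoeff {h : ℂ → ℂ} (hh : DifferentiableOn ℂ h (ball 0 1)) {z : ℂ}
    (hz : z ∈ ball (0 : ℂ) 1) : HasSum (fun n => taylorCoeff h n * z ^ n) (h z) := by
  convert! Complex.hasSum_taylorSeries_on_ball hh hz using 2 with n
  simp only [taylorCoeff, sub_zero, smul_eq_mul]
  ring

lemma hasSum_harmonicCoeff {h g : ℂ → ℂ} (H : IsHarmonicDiskMap h g) {σ : ℝ} (hσ : σ < 0) (t : ℝ) :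
    HasSum (fun n : ℤ => harmonicCoeff (taylorCoeff h) (taylorCoeff g) (rexp σ) n *
      Complex.exp (Complex.I * n * t)) (polarLift h g (σ, t)) := by
  have hmem : Complex.exp (σ + t * Complex.I) ∈ ball (0 : ℂ) 1 :=
    exp_polar_mem_ball (p := (σ, t)) hσ
  have hpow : ∀ n : ℕ, Complex.exp (σ + t * Complex.I) ^ n
      = (rexp σ : ℂ) ^ n * Complex.exp (Complex.I * n * t) := fun n => by
    rw [Complex.exp_add, mul_pow, Complex.ofReal_exp, ← Complex.exp_nat_mul (t * Complex.I)]
    congr 2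
    ring
  refine HasSum.of_nat_of_neg_add_one ?_ ?_
  · convert! hasSum_taylorCoeff H.diff_left hmem using 2 with n
    rw [hpow]
    simp [harmonicCoeff, mul_assoc]
  · have h1 := (hasSum_nat_add_iff' 1).2 (hasSum_taylorCoeff H.diff_right hmem)
    have h0 : taylorCoeff g 0 = 0 := by simp [taylorCoeff, H.right_zero]
    simp only [Finset.range_one, Finset.sum_singleton, h0, zero_mul, sub_zero] at h1
    have h2 := Complex.hasSum_conj'.2 h1
    convert! h2 using 2 with n
    have h3 : (-((n : ℤ) + 1)) = Int.negSucc n := (Int.negSucc_eq n).symm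
    rw [hpow, h3, ← mul_assoc, map_mul, ← Complex.exp_conj]
    simp only [harmonicCoeff]
    congr 2
    simp
    ring

lemma summable_norm_harmonicCoeff {h g : ℂ → ℂ} (H : IsHarmonicDiskMap h g) {σ : ℝ} (hσ : σ < 0) :
    Summable fun n => ‖harmonicCoeff (taylorCoeff h) (taylorCoeff g) (rexp σ) n‖ := by
  refine (hasSum_harmonicCoeff H hσ 0).summable.norm.congr fun n => ?_
  rw [norm_mul, norm_cexp_I_mul_intCast_mul, mul_one]

lemma polarLift_boundary {h g : ℂ → ℂ} (H : IsHarmonicDiskMap h g) {ε : ℝ} (hε : 0 < ε) :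
    ∃ σ < 0, ∀ p : ℝ × ℝ, σ < p.1 → p.1 < 0 → 1 - ε < ‖polarLift h g p‖ := by
  obtain ⟨r, hr, hb⟩ := H.boundary ε hε
  obtain ⟨r', hr', hr'1⟩ : ∃ r', max r 0 < r' ∧ r' < 1 := exists_between (by simp [hr])
  have hr'0 : 0 < r' := (le_max_right _ _).trans_lt hr'
  refine ⟨Real.log r', Real.log_neg hr'0 hr'1, fun p hp1 hp2 => hb _ ?_ ?_⟩
  · rw [norm_exp_polar]
    exact ((le_max_left _ _).trans_lt hr').trans ((Real.log_lt_iff_lt_exp hr'0).1 hp1)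
  · rw [norm_exp_polar]
    simpa using hp2

lemma eventually_fourier_inequality {h g : ℂ → ℂ} (H : IsHarmonicDiskMap h g) {ε A : ℝ}
    (hε : 0 < ε) (hε1 : ε < 1) (hA0 : 0 ≤ A) (hA : A ≤ 7 / 8) :
    ∃ σs < 0, ∀ σ ∈ Ioo σs 0, A * (1 - ε) ^ 2 - 83 / 150 - 2 * ε - ε ≤
      (A - 83 / 200) * ‖taylorCoeff h 1 * (rexp σ : ℂ)‖ ^ 2
      + (A - 29 / 200) * ‖taylorCoeff g 1 * (rexp σ : ℂ)‖ ^ 2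
      + (A - 151 / 169) * ‖taylorCoeff h 2 * (rexp σ : ℂ) ^ 2‖ ^ 2
      + (A - 97 / 169) * ‖taylorCoeff g 2 * (rexp σ : ℂ) ^ 2‖ ^ 2 := by
  obtain ⟨σ₁, hσ₁, hang⟩ := exists_forall_integral_angular_ge
    (contDiffOn_polarLift (n := 2) H) (fun p hp => polarLift_ne_zero H hp) (polarLift_periodic h g)
    (fun p hp => polarLift_jacobian_nonneg H hp)
    (fun p hp => H.norm_lt_one _ (exp_polar_mem_ball hp)) (fun ε hε => polarLift_boundary H hε)
    (integrableOn_fderiv_polarLift H) hε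
  obtain ⟨σ₂, hσ₂, hlow⟩ := polarLift_boundary H hε
  refine ⟨max σ₁ σ₂, max_lt hσ₁ hσ₂, fun σ hσ => ?_⟩
  have hσ0 : σ < 0 := hσ.2
  have ho : IsOpen {p : ℝ × ℝ | p.1 < 0} := isOpen_lt continuous_fst continuous_const
  set f : ℝ → ℂ := fun t => polarLift h g (σ, t) with hf
  have hfC : ContDiff ℝ 1 f := contDiff_iff_contDiffAt.2 fun t =>
    ((contDiffOn_polarLift (n := 1) H).contDiffAt (ho.mem_nhds hσ0)).comp t
      (contDiff_const.prodMk contDiff_id).contDiffAt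
  have hfd : ∀ t, deriv f t = fderiv ℝ (polarLift h g) (σ, t) (0, 1) := fun t => by
    have h1 : HasFDerivAt (polarLift h g) (fderiv ℝ (polarLift h g) (σ, t)) (σ, t) :=
      (((contDiffOn_polarLift (n := 1) H).contDiffAt (ho.mem_nhds hσ0)).differentiableAt
        one_ne_zero).hasFDerivAt
    have h2 : HasDerivAt (fun t : ℝ => (σ, t)) ((0 : ℝ), (1 : ℝ)) t :=
      (hasDerivAt_const t σ).prodMk (hasDerivAt_id' t)
    exact (h1.comp_hasDerivAt t h2).deriv
  have hper : Function.Periodic f (2 * π) := fun t => by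
    have := polarLift_periodic h g (σ, t)
    simpa using this
  have hcorr := fun θ (hθ : 0 ≤ θ) => integral_correlation_le hfC hper hε1
    (fun t => hlow (σ, t) ((le_max_right _ _).trans_lt hσ.1) hσ0)
    (fun t => H.norm_lt_one _ (exp_polar_mem_ball (p := (σ, t)) hσ0))
    (fun b h1 h2 h3 h4 => by
      simp_rw [hfd]
      exact hang σ ⟨(le_max_left _ _).trans_lt hσ.1, hσ0⟩ b h1 h2 h3 h4)
    (integral_angular_polarLift H hσ0) hθ
  have key := fourier_weighted_inequality (summable_norm_harmonicCoeff H hσ0)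
    (by
      change taylorCoeff h 0 * (rexp σ : ℂ) ^ 0 = 0
      simp [taylorCoeff, H.left_zero]) hfC.continuous
    (hasSum_harmonicCoeff H hσ0) hε1.le hε.le hA0 hA
    (fun t => hlow (σ, t) ((le_max_right _ _).trans_lt hσ.1) hσ0) hcorr
  have e1 : harmonicCoeff (taylorCoeff h) (taylorCoeff g) (rexp σ) 1
      = taylorCoeff h 1 * (rexp σ : ℂ) ^ 1 := rfl
  have e2 : harmonicCoeff (taylorCoeff h) (taylorCoeff g) (rexp σ) 2
      = taylorCoeff h 2 * (rexp σ : ℂ) ^ 2 := rfl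
  have e3 : harmonicCoeff (taylorCoeff h) (taylorCoeff g) (rexp σ) (-1)
      = (starRingEnd ℂ) (taylorCoeff g 1 * (rexp σ : ℂ) ^ 1) := rfl
  have e4 : harmonicCoeff (taylorCoeff h) (taylorCoeff g) (rexp σ) (-2)
      = (starRingEnd ℂ) (taylorCoeff g 2 * (rexp σ : ℂ) ^ 2) := rfl
  rw [e1, e2, e3, e4, Complex.norm_conj, Complex.norm_conj] at key
  simpa only [pow_one] using key

theorem harmonicDiskMap_coeff_inequality {h g : ℂ → ℂ} (H : IsHarmonicDiskMap h g) {A : ℝ}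
    (hA0 : 0 ≤ A) (hA : A ≤ 7 / 8) :
    A - 83 / 150 ≤ (A - 83 / 200) * ‖taylorCoeff h 1‖ ^ 2 + (A - 29 / 200) * ‖taylorCoeff g 1‖ ^ 2
      + (A - 151 / 169) * ‖taylorCoeff h 2‖ ^ 2 + (A - 97 / 169) * ‖taylorCoeff g 2‖ ^ 2 := by
  set R : ℝ → ℝ := fun σ => (A - 83 / 200) * ‖taylorCoeff h 1 * (rexp σ : ℂ)‖ ^ 2
      + (A - 29 / 200) * ‖taylorCoeff g 1 * (rexp σ : ℂ)‖ ^ 2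
      + (A - 151 / 169) * ‖taylorCoeff h 2 * (rexp σ : ℂ) ^ 2‖ ^ 2
      + (A - 97 / 169) * ‖taylorCoeff g 2 * (rexp σ : ℂ) ^ 2‖ ^ 2 with hR
  have hRc : Continuous R := by fun_prop
  have hR0 : R 0 = (A - 83 / 200) * ‖taylorCoeff h 1‖ ^ 2 + (A - 29 / 200) * ‖taylorCoeff g 1‖ ^ 2
      + (A - 151 / 169) * ‖taylorCoeff h 2‖ ^ 2 + (A - 97 / 169) * ‖taylorCoeff g 2‖ ^ 2 := by
    simp [hR]
  rw [← hR0]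
  have hε : ∀ ε ∈ Ioo (0 : ℝ) 1, A * (1 - ε) ^ 2 - 83 / 150 - 2 * ε - ε ≤ R 0 := by
    intro ε hε
    obtain ⟨σs, hσs, hle⟩ := eventually_fourier_inequality H hε.1 hε.2 hA0 hA
    have ht : Filter.Tendsto R (nhdsWithin 0 (Iio 0)) (nhds (R 0)) :=
      hRc.continuousAt.tendsto.mono_left nhdsWithin_le_nhds
    refine ge_of_tendsto ht ?_
    filter_upwards [Ioo_mem_nhdsLT hσs] with σ hσ using hle σ hσ
  have ht : Filter.Tendsto (fun ε : ℝ => A * (1 - ε) ^ 2 - 83 / 150 - 2 * ε - ε)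
      (nhdsWithin 0 (Ioi 0)) (nhds (A - 83 / 150)) := by
    have hc : Continuous fun ε : ℝ => A * (1 - ε) ^ 2 - 83 / 150 - 2 * ε - ε := by fun_prop
    have := (hc.tendsto 0).mono_left (nhdsWithin_le_nhds (s := Ioi 0))
    simpa using this
  refine le_of_tendsto ht ?_
  filter_upwards [Ioo_mem_nhdsGT one_pos] with ε h using hε ε h
end

section

lemma coeff_lower_bound {x₁ x₂ y₁ y₂ v : ℝ} (hx₂ : 0 ≤ x₂)
    (hv0 : 0 ≤ v) (hv1 : v ≤ 1) (hy₁ : y₁ = v ^ 2 * x₁)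
    (hy₂ : y₂ ≤ v * (1 - v) * x₁ + v * x₂)
    (hA : ∀ A : ℝ, 0 ≤ A → A ≤ 7 / 8 → A - 83 / 150 ≤ (A - 83 / 200) * x₁ + (A - 29 / 200) * y₁
      + (A - 151 / 169) * x₂ + (A - 97 / 169) * y₂) :
    695 / 1000 ≤ x₁ * (1 + v) ^ 2 := by
  subst hy₁
  rcases le_total (7 / 8 * (1 + v)) (151 / 169 + 97 / 169 * v) with hc | hc
  · have h := hA (7 / 8) (by norm_num) le_rfl
    have h1 : 7 / 8 - 83 / 150 ≤ x₁ * (23 / 50 + 73 / 100 * v ^ 2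
        + (7 / 8 - 97 / 169) * (v * (1 - v))) := by
      have h2 : 0 ≤ (151 / 169 + 97 / 169 * v - 7 / 8 * (1 + v)) * x₂ :=
        mul_nonneg (by linarith) hx₂
      nlinarith
    have hv : v ≤ 7 / 100 := by linarith
    have h3 : 695 / 1000 * (23 / 50 + 73 / 100 * v ^ 2 + (7 / 8 - 97 / 169) * (v * (1 - v)))
        ≤ (7 / 8 - 83 / 150) * (1 + v) ^ 2 := by nlinarith
    have hpos : 0 < 23 / 50 + 73 / 100 * v ^ 2 + (7 / 8 - 97 / 169) * (v * (1 - v)) := by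
      have : 0 ≤ v * (1 - v) := mul_nonneg hv0 (by linarith)
      nlinarith [sq_nonneg v]
    have h4 := mul_le_mul_of_nonneg_right h1 (sq_nonneg (1 + v))
    exact le_of_mul_le_mul_right (a := 23 / 50 + 73 / 100 * v ^ 2
      + (7 / 8 - 97 / 169) * (v * (1 - v))) (by nlinarith) hpos
  · have hv' : 0 < 1 + v := by linarith
    have h := hA ((151 / 169 + 97 / 169 * v) / (1 + v)) (by positivity)
      (by rw [div_le_iff₀ hv']; exact hc)
    have h0 := mul_le_mul_of_nonneg_left h hv'.le
    set A := (151 / 169 + 97 / 169 * v) / (1 + v) with hAdef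
    have hA1 : (1 + v) * A = 151 / 169 + 97 / 169 * v := by rw [hAdef]; field_simp
    have hB : (1 + v) * ((A - 83 / 200) * x₁ + (A - 29 / 200) * (v ^ 2 * x₁)
      + (A - 151 / 169) * x₂ + (A - 97 / 169) * y₂) =
        (151 / 169 + 97 / 169 * v - 83 / 200 * (1 + v)) * x₁
        + (151 / 169 + 97 / 169 * v - 29 / 200 * (1 + v)) * (v ^ 2 * x₁)
        - 54 / 169 * v * x₂ + 54 / 169 * y₂ := by
      linear_combination (x₁ + v ^ 2 * x₁ + x₂ + y₂) * hA1
    rw [hB, mul_sub, hA1] at h0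
    have h1 : 151 / 169 + 97 / 169 * v - (1 + v) * (83 / 150) ≤
        x₁ * ((151 / 169 + 97 / 169 * v - 83 / 200 * (1 + v))
        + (151 / 169 + 97 / 169 * v - 29 / 200 * (1 + v)) * v ^ 2 + 54 / 169 * (v * (1 - v))) := by
      nlinarith
    have h3 : 695 / 1000 * ((151 / 169 + 97 / 169 * v - 83 / 200 * (1 + v))
        + (151 / 169 + 97 / 169 * v - 29 / 200 * (1 + v)) * v ^ 2 + 54 / 169 * (v * (1 - v)))
        ≤ (151 / 169 + 97 / 169 * v - (1 + v) * (83 / 150)) * (1 + v) ^ 2 := by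
      have : 6 / 100 ≤ v := by linarith
      nlinarith [mul_nonneg hv0 (sub_nonneg.2 hv1), mul_nonneg (mul_nonneg hv0 hv0)
        (sub_nonneg.2 hv1), pow_nonneg hv0 3]
    have hpos : 0 < ((151 / 169 + 97 / 169 * v - 83 / 200 * (1 + v))
        + (151 / 169 + 97 / 169 * v - 29 / 200 * (1 + v)) * v ^ 2 + 54 / 169 * (v * (1 - v))) := by
      have e1 : 0 ≤ v * (1 - v) := mul_nonneg hv0 (by linarith)
      have e2 : 0 ≤ (151 / 169 + 97 / 169 * v - 29 / 200 * (1 + v)) * v ^ 2 :=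
        mul_nonneg (by linarith) (sq_nonneg v)
      linarith
    have h4 := mul_le_mul_of_nonneg_right h1 (sq_nonneg (1 + v))
    exact le_of_mul_le_mul_right (by nlinarith) hpos
end

section PartialDerivatives

theorem isOpen_unitDisk : IsOpen unitDisk :=
  isOpen_lt (by fun_prop) (by fun_prop)

theorem equivRealProd_mem_unitDisk {z : ℂ} (hz : z ∈ Metric.ball (0 : ℂ) 1) :
    Complex.equivRealProdCLM z ∈ unitDisk := by
  have h : ‖z‖ < 1 := by simpa using hz
  have h2 : z.re ^ 2 + z.im ^ 2 = ‖z‖ ^ 2 := by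
    rw [Complex.sq_norm, Complex.normSq_apply]; ring
  change z.re ^ 2 + z.im ^ 2 < 1
  rw [h2]
  nlinarith [norm_nonneg z]

/-- In complex coordinates a differentiable function on the plane has the differential given by
its partial derivatives. -/
theorem hasFDerivAt_comp_equivRealProd {g : ℝ × ℝ → ℝ} {z : ℂ}
    (hg : DifferentiableAt ℝ g (Complex.equivRealProdCLM z)) :
    HasFDerivAt (fun z => g (Complex.equivRealProdCLM z))
      (pdu g (Complex.equivRealProdCLM z) • Complex.reCLM +
        pdv g (Complex.equivRealProdCLM z) • Complex.imCLM) z := by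
  have h := hg.hasFDerivAt.comp z Complex.equivRealProdCLM.hasFDerivAt
  convert! h using 1
  ext v
  have hv : Complex.equivRealProdCLM v = v.re • ((1, 0) : ℝ × ℝ) + v.im • ((0, 1) : ℝ × ℝ) := by
    change (v.re, v.im) = _
    simp
  simp only [pdu, pdv, hg.lineDeriv_eq_fderiv, ContinuousLinearMap.comp_apply,
    ContinuousLinearEquiv.coe_coe, hv, map_add, map_smul]
  simp [mul_comm]

theorem contDiffOn_pd {f : ℝ × ℝ → ℝ} (hreg : ContDiffOn ℝ 2 f unitDisk) :
    (∀ p ∈ unitDisk, DifferentiableAt ℝ (pdu f) p) ∧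
    (∀ p ∈ unitDisk, DifferentiableAt ℝ (pdv f) p) ∧
    (∀ p ∈ unitDisk, pdu (pdv f) p = pdv (pdu f) p) := by
  have hd : ∀ p ∈ unitDisk, DifferentiableAt ℝ f p := fun p hp =>
    (hreg.contDiffAt (isOpen_unitDisk.mem_nhds hp)).differentiableAt (by norm_num)
  have hdd : ∀ p ∈ unitDisk, DifferentiableAt ℝ (fderiv ℝ f) p := fun p hp =>
    ((hreg.contDiffAt (isOpen_unitDisk.mem_nhds hp)).fderiv_right
      (m := 1) (by norm_num)).differentiableAt (by norm_num)
  have hline : ∀ v : ℝ × ℝ, ∀ p ∈ unitDisk,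
      HasFDerivAt (fun p => lineDeriv ℝ f p v)
        ((fderiv ℝ (fderiv ℝ f) p).flip v) p := by
    intro v p hp
    have h1 : HasFDerivAt (fun p => fderiv ℝ f p v)
        ((fderiv ℝ (fderiv ℝ f) p).flip v) p := by
      have := (hdd p hp).hasFDerivAt.clm_apply (hasFDerivAt_const v p)
      convert! this using 1
      ext <;> simp
    refine h1.congr_of_eventuallyEq ?_
    filter_upwards [isOpen_unitDisk.mem_nhds hp] with x hx
    exact (hd x hx).lineDeriv_eq_fderiv
  refine ⟨fun p hp => (hline _ p hp).differentiableAt, fun p hp => (hline _ p hp).differentiableAt,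
    fun p hp => ?_⟩
  have hs : IsSymmSndFDerivAt ℝ f p :=
    (hreg.contDiffAt (isOpen_unitDisk.mem_nhds hp)).isSymmSndFDerivAt (by simp)
  have e1 : pdu (pdv f) p = _ := ((hline (0, 1) p hp).hasLineDerivAt (1, 0)).lineDeriv
  have e2 : pdv (pdu f) p = _ := ((hline (1, 0) p hp).hasLineDerivAt (0, 1)).lineDeriv
  rw [e1, e2]
  exact hs.eq _ _

end PartialDerivatives

section MinimalSurfaceAlgebra

variable {W p q r s t : ℝ}

theorem minimal_closed (hW0 : 0 < W) (hW : W ^ 2 = 1 + p ^ 2 + q ^ 2)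
    (hM : (1 + q ^ 2) * r - 2 * p * q * s + (1 + p ^ 2) * t = 0) :
    (2 * p * s * W - (1 + p ^ 2) * ((p * s + q * t) / W)) / W ^ 2 =
      ((p * s + q * r) * W - p * q * ((p * r + q * s) / W)) / W ^ 2 := by
  field_simp
  grind

theorem minimal_beltrami_re (hW : W ^ 2 = 1 + p ^ 2 + q ^ 2)
    (hM : (1 + q ^ 2) * r - 2 * p * q * s + (1 + p ^ 2) * t = 0) :
    (1 + W) ^ 2 * ((r + t) * (W + W ^ 2) - (p * (p * r + q * s) + q * (p * s + q * t))) -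
      (p ^ 2 - q ^ 2) *
        ((r - t) * (W + W ^ 2) - (p * (p * r + q * s) - q * (p * s + q * t))) +
      2 * p * q *
        (-2 * s * (W + W ^ 2) + (p * (p * s + q * t) + q * (p * r + q * s))) = 0 := by
  grind

theorem minimal_beltrami_im (hW : W ^ 2 = 1 + p ^ 2 + q ^ 2) :
    (1 + W) ^ 2 * (-(p * (p * s + q * t) - q * (p * r + q * s))) -
      2 * p * q * ((r - t) * (W + W ^ 2) - (p * (p * r + q * s) - q * (p * s + q * t))) -
      (p ^ 2 - q ^ 2) *
        (-2 * s * (W + W ^ 2) + (p * (p * s + q * t) + q * (p * r + q * s))) = 0 := by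
  grind

theorem minimal_curvature (hW : W ^ 2 = 1 + p ^ 2 + q ^ 2)
    (hM : (1 + q ^ 2) * r - 2 * p * q * s + (1 + p ^ 2) * t = 0) :
    ((r - t) * (W + W ^ 2) - (p * (p * r + q * s) - q * (p * s + q * t))) ^ 2 +
      (-2 * s * (W + W ^ 2) + (p * (p * s + q * t) + q * (p * r + q * s))) ^ 2 =
      (s ^ 2 - r * t) * (1 + W) ^ 4 := by
  grind

end MinimalSurfaceAlgebra

section Isothermal

/-- The real-linear map `v ↦ a v + b v̄` with Wirtinger derivatives `a` and `b`. -/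
noncomputable def wirtinger (a b : ℂ) : ℂ →L[ℝ] ℂ :=
  a • (1 : ℂ →L[ℝ] ℂ) + b • (Complex.conjCLE : ℂ →L[ℝ] ℂ)

theorem wirtinger_apply (a b v : ℂ) :
    wirtinger a b v = a * v + b * (starRingEnd ℂ) v := by
  simp [wirtinger]

theorem hasFDerivAt_wirtinger {X Y : ℂ → ℝ} {α β γ δ : ℝ} {z : ℂ}
    (hX : HasFDerivAt X (α • Complex.reCLM + β • Complex.imCLM) z)
    (hY : HasFDerivAt Y (γ • Complex.reCLM + δ • Complex.imCLM) z) :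
    HasFDerivAt (fun z => (⟨X z, Y z⟩ : ℂ))
      (wirtinger ⟨(α + δ) / 2, (γ - β) / 2⟩ ⟨(α - δ) / 2, (γ + β) / 2⟩) z := by
  have h := (Complex.equivRealProdCLM.symm.hasFDerivAt (x := (X z, Y z))).comp z (hX.prodMk hY)
  convert! h using 1
  ext v
  rw [wirtinger_apply]
  change _ = (⟨α * v.re + β * v.im, γ * v.re + δ * v.im⟩ : ℂ)
  apply Complex.ext <;> simp <;> ring

/-- A closed form `a du + b dv` on the unit disk is exact. -/
theorem exists_potential {a b a₁ a₂ b₁ b₂ : ℂ → ℝ}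
    (ha : ∀ z ∈ Metric.ball (0 : ℂ) 1,
      HasFDerivAt a (a₁ z • Complex.reCLM + a₂ z • Complex.imCLM) z)
    (hb : ∀ z ∈ Metric.ball (0 : ℂ) 1,
      HasFDerivAt b (b₁ z • Complex.reCLM + b₂ z • Complex.imCLM) z)
    (hab : ∀ z ∈ Metric.ball (0 : ℂ) 1, a₂ z = b₁ z) :
    ∃ F : ℂ → ℝ, F 0 = 0 ∧ ∀ z ∈ Metric.ball (0 : ℂ) 1,
      HasFDerivAt F (a z • Complex.reCLM + b z • Complex.imCLM) z := by
  have hω : ∀ z ∈ Metric.ball (0 : ℂ) 1,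
      HasFDerivAt (fun z => a z • Complex.reCLM + b z • Complex.imCLM)
        ((a₁ z • Complex.reCLM + a₂ z • Complex.imCLM).smulRight Complex.reCLM +
          (b₁ z • Complex.reCLM + b₂ z • Complex.imCLM).smulRight Complex.imCLM) z :=
    fun z hz => ((ha z hz).smul_const Complex.reCLM).add ((hb z hz).smul_const Complex.imCLM)
  obtain ⟨F, hF⟩ := (convex_ball (0 : ℂ) 1).exists_forall_hasFDerivAt_of_fderiv_symmetric
    Metric.isOpen_ball
    (fun z hz => (hω z hz).differentiableAt.differentiableWithinAt) (by
      intro z hz x y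
      rw [(hω z hz).fderiv]
      simp [hab z hz]
      ring)
  exact ⟨fun z => F z - F 0, by simp, fun z hz => (hF z hz).sub_const _⟩

/-- Isothermal coordinate `ζ` on the unit disk, with complex dilatation governed by the (conjugate)
Gauss map `n`, which is holomorphic with derivative `c` in the coordinate `ζ`. -/
structure IsIsothermal (ζ n c : ℂ → ℂ) (A : ℂ → ℝ) : Prop where
  map_zero : ζ 0 = 0
  hasFDerivAt : ∀ w ∈ Metric.ball (0 : ℂ) 1,
    HasFDerivAt ζ (wirtinger (A w) (A w * (starRingEnd ℂ) (n w) ^ 2)) w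
  hasFDerivAt_gauss : ∀ w ∈ Metric.ball (0 : ℂ) 1,
    HasFDerivAt n (c w • wirtinger (A w) (A w * (starRingEnd ℂ) (n w) ^ 2)) w
  norm_lt_one : ∀ w ∈ Metric.ball (0 : ℂ) 1, ‖n w‖ < 1
  scale : ∀ w ∈ Metric.ball (0 : ℂ) 1, A w * (1 - ‖n w‖ ^ 4) = 2

set_option maxHeartbeats 1000000 in
theorem exists_isIsothermal {p q r s t : ℂ → ℝ}
    (hp : ∀ z ∈ Metric.ball (0 : ℂ) 1,
      HasFDerivAt p (r z • Complex.reCLM + s z • Complex.imCLM) z)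
    (hq : ∀ z ∈ Metric.ball (0 : ℂ) 1,
      HasFDerivAt q (s z • Complex.reCLM + t z • Complex.imCLM) z)
    (hmin : ∀ z ∈ Metric.ball (0 : ℂ) 1,
      (1 + q z ^ 2) * r z - 2 * p z * q z * s z + (1 + p z ^ 2) * t z = 0) :
    ∃ ζ n c A, IsIsothermal ζ n c A ∧
      4 * (A 0) ^ 2 * ‖c 0‖ ^ 2 = (s 0 ^ 2 - r 0 * t 0) / (1 + p 0 ^ 2 + q 0 ^ 2) := by
  set W : ℂ → ℝ := fun z => √(1 + p z ^ 2 + q z ^ 2) with hWdef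
  have hW1 : ∀ z, 0 < W z := fun z => Real.sqrt_pos.2 (by positivity)
  have hWsq : ∀ z, W z ^ 2 = 1 + p z ^ 2 + q z ^ 2 := fun z => Real.sq_sqrt (by positivity)
  have hdW : ∀ z ∈ Metric.ball (0 : ℂ) 1,
      HasFDerivAt W (((p z * r z + q z * s z) / W z) • Complex.reCLM +
        ((p z * s z + q z * t z) / W z) • Complex.imCLM) z := by
    intro z hz
    have h := ((((hp z hz).pow 2).const_add 1).add ((hq z hz).pow 2)).sqrt
      (show 1 + p z ^ 2 + q z ^ 2 ≠ 0 by positivity)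
    convert! h using 1
    ext v
    have hne := (hW1 z).ne'
    change _ = ((1 / (2 * W z)) • _ : ℂ →L[ℝ] ℝ) v
    simp
    field_simp
    ring
  have hquot : ∀ {g : ℂ → ℝ} {g₁ g₂ : ℝ} {z : ℂ}, z ∈ Metric.ball (0 : ℂ) 1 → ∀ b : ℝ, 0 ≤ b →
      HasFDerivAt g (g₁ • Complex.reCLM + g₂ • Complex.imCLM) z →
      HasFDerivAt (fun z => g z / (b + W z))
        (((g₁ * (b + W z) - g z * ((p z * r z + q z * s z) / W z)) / (b + W z) ^ 2)
            • Complex.reCLM +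
          ((g₂ * (b + W z) - g z * ((p z * s z + q z * t z) / W z)) / (b + W z) ^ 2)
            • Complex.imCLM) z := by
    intro g g₁ g₂ z hz b hb hg
    have hne : b + W z ≠ 0 := by have := hW1 z; positivity
    have h := hg.mul ((hasDerivAt_inv hne).comp_hasFDerivAt z ((hdW z hz).const_add b))
    convert! h using 1
    ext v
    simp
    field_simp
    ring
  have hquot0 : ∀ {g : ℂ → ℝ} {g₁ g₂ : ℝ} {z : ℂ}, z ∈ Metric.ball (0 : ℂ) 1 →
      HasFDerivAt g (g₁ • Complex.reCLM + g₂ • Complex.imCLM) z →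
      HasFDerivAt (fun z => g z / W z)
        (((g₁ * W z - g z * ((p z * r z + q z * s z) / W z)) / W z ^ 2) • Complex.reCLM +
          ((g₂ * W z - g z * ((p z * s z + q z * t z) / W z)) / W z ^ 2) • Complex.imCLM) z := by
    intro g g₁ g₂ z hz hg
    simpa using hquot hz 0 le_rfl hg
  have hsq : ∀ {g : ℂ → ℝ} {g₁ g₂ : ℝ} {z : ℂ}, 
      HasFDerivAt g (g₁ • Complex.reCLM + g₂ • Complex.imCLM) z →
      HasFDerivAt (fun z => 1 + g z ^ 2)
        ((2 * g z * g₁) • Complex.reCLM + (2 * g z * g₂) • Complex.imCLM) z := by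
    intro g g₁ g₂ z hg
    convert! (hg.pow 2).const_add 1 using 1
    ext v
    simp
    ring
  have hmul : ∀ z ∈ Metric.ball (0 : ℂ) 1, HasFDerivAt (fun z => p z * q z)
        ((p z * s z + q z * r z) • Complex.reCLM + (p z * t z + q z * s z) • Complex.imCLM) z := by
    intro z hz
    convert! (hp z hz).mul (hq z hz) using 1
    ext v
    simp
    ring
  obtain ⟨F, hF0, hF⟩ := exists_potential (fun z hz => hquot0 hz (hsq (hp z hz)))
    (fun z hz => hquot0 hz (hmul z hz)) (fun z hz => minimal_closed (hW1 z) (hWsq z) (hmin z hz))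
  obtain ⟨G, hG0, hG⟩ := exists_potential (fun z hz => hquot0 hz (hmul z hz))
    (fun z hz => hquot0 hz (hsq (hq z hz))) (fun z hz => by
      have h := minimal_closed (hW1 z) ((hWsq z).trans (add_right_comm _ _ _))
        (r := t z) (s := s z) (t := r z) (by linarith [hmin z hz])
      rw [mul_comm (q z) (p z)] at h
      rw [add_comm (p z * s z), add_comm (p z * t z), h.symm]
      ring)
  have hX : ∀ z ∈ Metric.ball (0 : ℂ) 1, HasFDerivAt (fun z => z.re + F z)
      ((1 + (1 + p z ^ 2) / W z) • Complex.reCLM + (p z * q z / W z) • Complex.imCLM) z := by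
    intro z hz
    convert! Complex.reCLM.hasFDerivAt.add (hF z hz) using 1
    ext v; simp; ring
  have hY : ∀ z ∈ Metric.ball (0 : ℂ) 1, HasFDerivAt (fun z => z.im + G z)
      ((p z * q z / W z) • Complex.reCLM + (1 + (1 + q z ^ 2) / W z) • Complex.imCLM) z := by
    intro z hz
    convert! Complex.imCLM.hasFDerivAt.add (hG z hz) using 1
    ext v; simp; ring
  set A : ℂ → ℝ := fun z => (1 + W z) ^ 2 / (2 * W z) with hA
  set n : ℂ → ℂ := fun z => ⟨p z / (1 + W z), -q z / (1 + W z)⟩ with hn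
  set a : ℂ → ℂ := fun z => ⟨((r z - t z) * (W z + W z ^ 2) -
      (p z * (p z * r z + q z * s z) - q z * (p z * s z + q z * t z))) / (2 * W z * (1 + W z) ^ 2),
      (-2 * s z * (W z + W z ^ 2) + (p z * (p z * s z + q z * t z) +
      q z * (p z * r z + q z * s z))) / (2 * W z * (1 + W z) ^ 2)⟩ with ha
  have hA0 : ∀ z, (A z : ℂ) ≠ 0 := by
    intro z
    have := hW1 z
    exact_mod_cast (show 0 < A z by positivity).ne'
  have hnn : ∀ z, ‖n z‖ ^ 2 = (W z - 1) / (1 + W z) := by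
    intro z
    have := hW1 z
    have h1 := hWsq z
    rw [Complex.sq_norm, Complex.normSq_mk]
    field_simp
    linear_combination -h1
  refine ⟨fun z => ⟨z.re + F z, z.im + G z⟩, n, fun z => a z / A z, A, ?_, ?_⟩
  · refine ⟨by simp [hF0, hG0]; rfl, fun z hz => ?_, fun z hz => ?_, fun z hz => ?_, fun z hz => ?_⟩
    · convert! hasFDerivAt_wirtinger (hX z hz) (hY z hz) using 2
      · have hne := hW1 z
        have h1 := hWsq z
        apply Complex.ext
        · simp only [Complex.ofReal_re, hA]
          field_simp
          linear_combination h1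
        · simp
      · have hne := hW1 z
        have h1 := hWsq z
        apply Complex.ext
        · rw [Complex.re_ofReal_mul]
          simp [hA, hn, pow_two]
          field_simp
          ring
        · rw [Complex.im_ofReal_mul]
          simp [hA, hn, pow_two]
          field_simp
          ring
    · have hx := hquot hz 1 zero_le_one (hp z hz)
      have hq' : HasFDerivAt (fun z => -q z) ((-s z) • Complex.reCLM + (-t z) • Complex.imCLM) z := by
        convert! (hq z hz).neg using 1
        ext v
        simp
        ring
      have hy' := hquot hz 1 zero_le_one hq'
      convert! hasFDerivAt_wirtinger hx hy' using 1
      have hne := hW1 z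
      have h1 := hWsq z
      have h2 := hmin z hz
      have hbb : a z / A z * (A z * (starRingEnd ℂ) (n z) ^ 2) = a z * (starRingEnd ℂ) (n z) ^ 2 := by
        field_simp [hA0 z]
      have e : ∀ x y w : ℂ, x • wirtinger y w = wirtinger (x * y) (x * w) := by
        intro x y w
        ext v
        simp [wirtinger_apply]; ring
      rw [e, hbb, div_mul_cancel₀ _ (hA0 z)]
      congr 1
      · apply Complex.ext
        · simp only [ha]
          field_simp
          ring
        · simp only [ha]
          field_simp
          ring
      · apply Complex.ext
        · simp [ha, hn, pow_two]
          field_simp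
          linear_combination -minimal_beltrami_re h1 h2
        · simp [ha, hn, pow_two]
          field_simp
          linear_combination -minimal_beltrami_im (r := r z) (s := s z) (t := t z) h1
    · have hne := hW1 z
      have h := hnn z
      have : (W z - 1) / (1 + W z) < 1 := by rw [div_lt_one (by positivity)]; linarith
      rw [← h] at this
      nlinarith [norm_nonneg (n z)]
    · have hne := hW1 z
      rw [show ‖n z‖ ^ 4 = (‖n z‖ ^ 2) ^ 2 by ring, hnn z]
      simp only [hA]
      field_simp
      ring
  · have hne := hW1 0
    have h1 := hWsq 0
    have h2 := hmin 0 (by simp)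
    have hA1 : A 0 ≠ 0 := by exact_mod_cast hA0 0
    have e : ∀ (x : ℂ) (y : ℝ), y ≠ 0 → 4 * y ^ 2 * ‖x / y‖ ^ 2 = 4 * ‖x‖ ^ 2 := by
      intro x y hy
      rw [norm_div, Complex.norm_real, div_pow, Real.norm_eq_abs, sq_abs]
      field_simp
    have h3 := minimal_curvature h1 h2
    rw [e _ _ hA1, ← h1, Complex.sq_norm, ha, Complex.normSq_mk]
    field_simp
    linear_combination 4 * h3

end Isothermal

section IsothermalInverse

open Filter Topology Metric

variable {ζ n c : ℂ → ℂ} {A : ℂ → ℝ}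

theorem continuousAt_leftInverse {f g : ℂ → ℂ} {x : ℂ} (hmap : map f (𝓝 x) = 𝓝 (f x))
    (hg : ∀ᶠ y in 𝓝 x, g (f y) = y) : ContinuousAt g (f x) := by
  rw [ContinuousAt, hg.self_of_nhds, ← hmap, tendsto_map'_iff]
  exact tendsto_id.congr' (hg.mono fun y hy => hy.symm)

theorem eventually_rightInverse {f g : ℂ → ℂ} {x : ℂ} (hmap : map f (𝓝 x) = 𝓝 (f x))
    (hg : ∀ᶠ y in 𝓝 x, g (f y) = y) : ∀ᶠ y in 𝓝 (f x), f (g y) = y := by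
  rw [← hmap, eventually_map]
  exact hg.mono fun y hy => by rw [hy]

theorem hasDerivAt_of_hasFDerivAt_smul_one {f : ℂ → ℂ} {a x : ℂ}
    (h : HasFDerivAt f (a • (1 : ℂ →L[ℝ] ℂ)) x) : HasDerivAt f a x := by
  rw [hasDerivAt_iff_hasFDerivAt]
  refine hasFDerivAt_of_restrictScalars ℝ h ?_
  ext v
  simp [mul_comm]

theorem differentiableAt_of_sq_eq {φ ψ : ℂ → ℂ} {x : ℂ} (hφ : DifferentiableAt ℂ φ x)
    (hψ : ContinuousAt ψ x) (h0 : φ x ≠ 0) (h : ∀ᶠ y in 𝓝 x, ψ y ^ 2 = φ y) :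
    DifferentiableAt ℂ ψ x := by
  have hx : ψ x ≠ 0 := by
    intro h1
    apply h0
    rw [← h.self_of_nhds, h1]
    simp
  have hlim : Tendsto (fun y => slope φ x y / (ψ y + ψ x)) (𝓝[≠] x)
      (𝓝 (deriv φ x / (ψ x + ψ x))) :=
    (hasDerivAt_iff_tendsto_slope.1 hφ.hasDerivAt).div
      ((hψ.mono_left nhdsWithin_le_nhds).add tendsto_const_nhds)
      (by rw [← two_mul]; exact mul_ne_zero two_ne_zero hx)
  refine HasDerivAt.differentiableAt (f' := deriv φ x / (ψ x + ψ x))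
    (hasDerivAt_iff_tendsto_slope.2 (hlim.congr' ?_))
  have hne : ∀ᶠ y in 𝓝 x, ψ y + ψ x ≠ 0 :=
    ContinuousAt.eventually_ne (g := fun y => ψ y + ψ x) (hψ.add continuousAt_const)
      (by rw [← two_mul]; exact mul_ne_zero two_ne_zero hx)
  filter_upwards [nhdsWithin_le_nhds hne, nhdsWithin_le_nhds h] with y hy hy2
  rw [slope_def_field, slope_def_field, ← hy2, ← h.self_of_nhds, div_div, sq_sub_sq,
    mul_comm (y - x), mul_div_mul_left _ _ hy]

namespace IsIsothermal

theorem re_mul_conj_lt (I : IsIsothermal ζ n c A) {x y : ℂ} (hx : x ∈ ball (0 : ℂ) 1)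
    (hy : y ∈ ball (0 : ℂ) 1) (hxy : x ≠ y) :
    ‖x - y‖ ^ 2 < ((ζ x - ζ y) * (starRingEnd ℂ) (x - y)).re := by
  set d := x - y with hd
  have hd0 : 0 < ‖d‖ := norm_pos_iff.2 (sub_ne_zero.2 hxy)
  have hseg : ∀ t ∈ Icc (0 : ℝ) 1, y + t * d ∈ ball (0 : ℂ) 1 := by
    intro t ht
    have := (convex_ball (0 : ℂ) 1).add_smul_sub_mem hy hx ht
    simpa using this
  set e : ℝ → ℂ := fun t => wirtinger (A (y + t * d))
    (A (y + t * d) * (starRingEnd ℂ) (n (y + t * d)) ^ 2) d with he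
  have hder : ∀ t ∈ Icc (0 : ℝ) 1,
      HasDerivAt (fun t : ℝ => (ζ (y + t * d) * (starRingEnd ℂ) d).re)
        ((e t * (starRingEnd ℂ) d).re) t := by
    intro t ht
    have h1 : HasDerivAt (fun t : ℝ => y + t * d) d t := by
      simpa using (((hasDerivAt_id' t).ofReal_comp).mul_const d).const_add y
    have h2 := (I.hasFDerivAt _ (hseg t ht)).comp_hasDerivAt t h1
    exact (Complex.reCLM.hasFDerivAt).comp_hasDerivAt t (h2.mul_const ((starRingEnd ℂ) d))
  obtain ⟨t, ht, hslope⟩ := exists_hasDerivAt_eq_slope _ _ (zero_lt_one (α := ℝ))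
    (fun t ht => (hder t ht).continuousAt.continuousWithinAt)
    (fun t ht => hder t (Ioo_subset_Icc_self ht))
  have hmem := hseg t (Ioo_subset_Icc_self ht)
  have h3 : ((ζ x - ζ y) * (starRingEnd ℂ) d).re = (e t * (starRingEnd ℂ) d).re := by
    rw [hslope]
    simp [hd, sub_mul]
  rw [h3, he]
  simp only [wirtinger_apply]
  set m := n (y + t * d)
  have hm : ‖m‖ < 1 := I.norm_lt_one _ hmem
  have hA := I.scale _ hmem
  set a := A (y + t * d)
  have h4 : ((((a : ℂ) * d + a * (starRingEnd ℂ) m ^ 2 * (starRingEnd ℂ) d)) *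
      (starRingEnd ℂ) d).re = a * (‖d‖ ^ 2 + ((starRingEnd ℂ) (m * d) ^ 2).re) := by
    have : ((a : ℂ) * d + a * (starRingEnd ℂ) m ^ 2 * (starRingEnd ℂ) d) * (starRingEnd ℂ) d
        = a * (d * (starRingEnd ℂ) d + (starRingEnd ℂ) (m * d) ^ 2) := by
      rw [map_mul]; ring
    rw [this, Complex.re_ofReal_mul, Complex.add_re, Complex.mul_conj, Complex.ofReal_re,
      Complex.normSq_eq_norm_sq]
  have h5 : -(‖m‖ ^ 2 * ‖d‖ ^ 2) ≤ ((starRingEnd ℂ) (m * d) ^ 2).re := by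
    have := Complex.abs_re_le_norm ((starRingEnd ℂ) (m * d) ^ 2)
    rw [norm_pow, Complex.norm_conj, norm_mul, mul_pow] at this
    exact (abs_le.1 this).1
  rw [h4]
  have hm4 : 0 < 1 - ‖m‖ ^ 4 := by
    have := pow_lt_one₀ (norm_nonneg m) hm (n := 4) (by norm_num)
    linarith
  have ha : 0 < a := by
    by_contra h
    nlinarith
  have h6 : 1 < a * (1 - ‖m‖ ^ 2) := by
    have : a * (1 - ‖m‖ ^ 2) * (1 + ‖m‖ ^ 2) = 2 := by rw [← hA]; ring
    have h7 : ‖m‖ ^ 2 < 1 := pow_lt_one₀ (norm_nonneg m) hm (by norm_num)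
    have h8 : 0 < a * (1 - ‖m‖ ^ 2) := mul_pos ha (by linarith)
    nlinarith
  calc ‖d‖ ^ 2 < a * (1 - ‖m‖ ^ 2) * ‖d‖ ^ 2 := by
        have : 0 < ‖d‖ ^ 2 := by positivity
        nlinarith
    _ = a * (‖d‖ ^ 2 + -(‖m‖ ^ 2 * ‖d‖ ^ 2)) := by ring
    _ ≤ _ := by gcongr

theorem injOn (I : IsIsothermal ζ n c A) : InjOn ζ (ball 0 1) := by
  intro x hx y hy h
  by_contra hne
  have := I.re_mul_conj_lt hx hy hne
  rw [h] at this
  simp at this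
  nlinarith [norm_nonneg (x - y)]

theorem wirtinger_inverse {a : ℝ} {m : ℂ} (h : a * (1 - ‖m‖ ^ 4) = 2) :
    (wirtinger a (a * (starRingEnd ℂ) m ^ 2)).comp
      (wirtinger (1 / 2) (-(starRingEnd ℂ) m ^ 2 / 2)) = 1 ∧
    (wirtinger (1 / 2) (-(starRingEnd ℂ) m ^ 2 / 2)).comp
      (wirtinger a (a * (starRingEnd ℂ) m ^ 2)) = 1 := by
  have hm : (a : ℂ) * (1 - (m * (starRingEnd ℂ) m) ^ 2) = 2 := by
    rw [Complex.mul_conj, Complex.normSq_eq_norm_sq]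
    rw [← Complex.ofReal_ofNat 2, ← h]
    push_cast
    ring
  constructor
  · ext v
    simp only [ContinuousLinearMap.comp_apply, wirtinger_apply, one_apply_eq_self, map_add, map_mul,
      map_div₀, map_neg, map_pow, Complex.conj_conj, map_one, map_ofNat]
    linear_combination (v / 2) * hm
  · ext v
    simp only [ContinuousLinearMap.comp_apply, wirtinger_apply, one_apply_eq_self, map_add, map_mul,
      map_pow, Complex.conj_conj, Complex.conj_ofReal]
    linear_combination (v / 2) * hm

theorem hasFDerivAt_equiv (I : IsIsothermal ζ n c A) {w : ℂ} (hw : w ∈ ball (0 : ℂ) 1) :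
    ∃ e : ℂ ≃L[ℝ] ℂ, HasStrictFDerivAt ζ (e : ℂ →L[ℝ] ℂ) w ∧
      (e : ℂ →L[ℝ] ℂ) = wirtinger (A w) (A w * (starRingEnd ℂ) (n w) ^ 2) ∧
      (e.symm : ℂ →L[ℝ] ℂ) = wirtinger (1 / 2) (-(starRingEnd ℂ) (n w) ^ 2 / 2) := by
  obtain ⟨h1, h2⟩ := wirtinger_inverse (I.scale w hw)
  refine ⟨ContinuousLinearEquiv.equivOfInverse
    (wirtinger (A w) (A w * (starRingEnd ℂ) (n w) ^ 2))
    (wirtinger (1 / 2) (-(starRingEnd ℂ) (n w) ^ 2 / 2)) (fun v => DFunLike.congr_fun h2 v)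
    (fun v => DFunLike.congr_fun h1 v), ?_, rfl, rfl⟩
  refine hasStrictFDerivAt_of_hasFDerivAt_of_continuousAt
    (f' := fun w => wirtinger (A w) (A w * (starRingEnd ℂ) (n w) ^ 2)) ?_ ?_
  · filter_upwards [isOpen_ball.mem_nhds hw] with x hx using I.hasFDerivAt x hx
  · have hn : ContinuousAt n w := (I.hasFDerivAt_gauss w hw).continuousAt
    have hA : ContinuousAt A w := by
      have hlt : 1 - ‖n w‖ ^ 4 ≠ 0 := by
        intro h
        have := I.scale w hw
        rw [h] at this
        simp at this
      have : ContinuousAt (fun w => 2 / (1 - ‖n w‖ ^ 4)) w :=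
        continuousAt_const.div (continuousAt_const.sub (hn.norm.pow 4)) hlt
      refine this.congr ?_
      filter_upwards [isOpen_ball.mem_nhds hw] with x hx
      have h := I.scale x hx
      have hne : 1 - ‖n x‖ ^ 4 ≠ 0 := by
        intro h'
        rw [h'] at h
        simp at h
      rw [div_eq_iff hne, h]
    have hAc : ContinuousAt (fun w => (A w : ℂ)) w := Complex.continuous_ofReal.continuousAt.comp hA
    have hnc : ContinuousAt (fun w => (starRingEnd ℂ) (n w)) w :=
      Complex.continuous_conj.continuousAt.comp hn
    unfold wirtinger
    exact (hAc.smul continuousAt_const).add ((hAc.mul (hnc.pow 2)).smul continuousAt_const)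

theorem map_nhds_eq (I : IsIsothermal ζ n c A) {w : ℂ} (hw : w ∈ ball (0 : ℂ) 1) :
    map ζ (𝓝 w) = 𝓝 (ζ w) := by
  obtain ⟨e, he, -⟩ := I.hasFDerivAt_equiv hw
  exact he.map_nhds_eq_of_equiv

theorem isOpen_image (I : IsIsothermal ζ n c A) {ρ : ℝ} (hρ : ρ ≤ 1) :
    IsOpen (ζ '' ball 0 ρ) := by
  rw [isOpen_iff_mem_nhds]
  rintro _ ⟨w, hw, rfl⟩
  rw [← I.map_nhds_eq (ball_subset_ball hρ hw)]
  exact image_mem_map (isOpen_ball.mem_nhds hw)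

/-- The inverse of the isothermal coordinate. -/
noncomputable def inverse (ζ : ℂ → ℂ) : ℂ → ℂ := Function.invFunOn ζ (ball 0 1)

theorem inverse_apply (I : IsIsothermal ζ n c A) {w : ℂ} (hw : w ∈ ball (0 : ℂ) 1) :
    inverse ζ (ζ w) = w :=
  I.injOn.leftInvOn_invFunOn hw

theorem eventually_inverse_apply (I : IsIsothermal ζ n c A) {w : ℂ} (hw : w ∈ ball (0 : ℂ) 1) :
    ∀ᶠ y in 𝓝 w, inverse ζ (ζ y) = y := by
  filter_upwards [isOpen_ball.mem_nhds hw] with y hy using I.inverse_apply hy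

theorem hasFDerivAt_inverse (I : IsIsothermal ζ n c A) {w : ℂ} (hw : w ∈ ball (0 : ℂ) 1) :
    HasFDerivAt (inverse ζ) (wirtinger (1 / 2) (-(starRingEnd ℂ) (n w) ^ 2 / 2)) (ζ w) := by
  obtain ⟨e, he, -, he2⟩ := I.hasFDerivAt_equiv hw
  have hev := I.eventually_inverse_apply hw
  rw [← he2]
  refine HasFDerivAt.of_local_left_inverse (continuousAt_leftInverse (I.map_nhds_eq hw) hev) ?_
    (eventually_rightInverse (I.map_nhds_eq hw) hev)
  rw [I.inverse_apply hw]
  exact he.hasFDerivAt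

theorem hasDerivAt_gauss_comp_inverse (I : IsIsothermal ζ n c A) {w : ℂ}
    (hw : w ∈ ball (0 : ℂ) 1) : HasDerivAt (fun z => n (inverse ζ z)) (c w) (ζ w) := by
  have h1 := I.hasFDerivAt_gauss w hw
  rw [← I.inverse_apply hw] at h1
  have h2 := h1.comp (ζ w) (I.hasFDerivAt_inverse hw)
  apply hasDerivAt_of_hasFDerivAt_smul_one
  rw [I.inverse_apply hw, ContinuousLinearMap.smul_comp,
    (wirtinger_inverse (I.scale w hw)).1] at h2
  exact h2

theorem hasDerivAt_conj_inverse (I : IsIsothermal ζ n c A) {w : ℂ} (hw : w ∈ ball (0 : ℂ) 1) :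
    HasDerivAt (fun z => (starRingEnd ℂ) (2 * inverse ζ z - z)) (-(n w) ^ 2) (ζ w) := by
  apply hasDerivAt_of_hasFDerivAt_smul_one
  have h1 := ((I.hasFDerivAt_inverse hw).const_mul (2 : ℂ)).sub (hasFDerivAt_id (ζ w))
  have h2 := (Complex.conjCLE : ℂ →L[ℝ] ℂ).hasFDerivAt.comp (ζ w) h1
  convert! h2 using 1
  ext v
  simp [wirtinger_apply, map_ofNat]
  ring

theorem exists_sqrt (I : IsIsothermal ζ n c A) {ρ : ℝ} (h0 : 0 < ρ) (hρ : ρ ≤ 1) {φ : ℂ → ℂ}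
    (hφ : DifferentiableOn ℂ φ (ζ '' ball 0 ρ)) (hφ0 : ∀ z ∈ ζ '' ball 0 ρ, φ z ≠ 0) :
    ∃ ψ : ℂ → ℂ, DifferentiableOn ℂ ψ (ζ '' ball 0 ρ) ∧ ∀ z ∈ ζ '' ball 0 ρ, ψ z ^ 2 = φ z := by
  have hsub : ball (0 : ℂ) ρ ⊆ ball 0 1 := ball_subset_ball hρ
  have hsc : IsSimplyConnected (ball (0 : ℂ) ρ) := by
    have := (convex_ball (0 : ℂ) ρ).contractibleSpace ⟨0, mem_ball_self h0⟩
    exact SimplyConnectedSpace.ofContractible _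
  have hcont : ContinuousOn (fun w => φ (ζ w)) (ball 0 ρ) :=
    hφ.continuousOn.comp (fun w hw => (I.hasFDerivAt w (hsub hw)).continuousAt.continuousWithinAt)
      (mapsTo_image _ _)
  obtain ⟨f, hf, hf2⟩ := Complex.exists_continuousOn_pow_eq hsc isOpen_ball hcont
    (by rintro ⟨w, hw, h⟩; exact hφ0 _ (mem_image_of_mem _ hw) h) two_ne_zero
  refine ⟨fun z => f (inverse ζ z), ?_, ?_⟩
  · rintro _ ⟨w, hw, rfl⟩
    refine (differentiableAt_of_sq_eq (φ := φ)
      ((hφ _ (mem_image_of_mem _ hw)).differentiableAt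
        ((I.isOpen_image hρ).mem_nhds (mem_image_of_mem _ hw))) ?_
      (hφ0 _ (mem_image_of_mem _ hw)) ?_).differentiableWithinAt
    · have h1 : ContinuousAt f (inverse ζ (ζ w)) := by
        rw [I.inverse_apply (hsub hw)]
        exact hf.continuousAt (isOpen_ball.mem_nhds hw)
      exact ContinuousAt.comp h1 (I.hasFDerivAt_inverse (hsub hw)).continuousAt
    · filter_upwards [(I.isOpen_image hρ).mem_nhds (mem_image_of_mem _ hw)] with _ hy
      obtain ⟨y, hy, rfl⟩ := hy
      rw [I.inverse_apply (hsub hy), hf2]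
  · rintro _ ⟨w, hw, rfl⟩
    dsimp only
    rw [I.inverse_apply (hsub hw), hf2]

end IsIsothermal

end IsothermalInverse

section HarmonicParametrization

open Filter Topology Metric

variable {ζ n c : ℂ → ℂ} {A : ℂ → ℝ}

/-- The inverse of a bijective holomorphic map onto the disk is holomorphic. -/
theorem IsRiemannCandidate.exists_inverse {Ω : Set ℂ} {φ : ℂ → ℂ} (ho : IsOpen Ω)
    (hφ : IsRiemannCandidate Ω φ) (hs : SurjOn φ Ω (ball 0 1)) :
    ∃ Ψ : ℂ → ℂ, (∀ x ∈ Ω, Ψ (φ x) = x) ∧ (∀ z ∈ ball (0 : ℂ) 1, Ψ z ∈ Ω ∧ φ (Ψ z) = z) ∧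
      ∀ z ∈ ball (0 : ℂ) 1, DifferentiableAt ℂ Ψ z ∧ deriv Ψ z ≠ 0 := by
  have hl : ∀ x ∈ Ω, Function.invFunOn φ Ω (φ x) = x := fun x hx =>
    hφ.injOn.leftInvOn_invFunOn hx
  refine ⟨Function.invFunOn φ Ω, hl, fun z hz => ?_, fun z hz => ?_⟩
  · obtain ⟨x, hx, rfl⟩ := hs hz
    rw [hl x hx]
    exact ⟨hx, rfl⟩
  · obtain ⟨x, hx, rfl⟩ := hs hz
    have hd : HasStrictDerivAt φ (deriv φ x) x :=
      (hφ.differentiableOn.analyticAt (ho.mem_nhds hx)).hasStrictDerivAt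
    have hmap := hd.map_nhds_eq (hφ.deriv_ne x hx)
    have hev : ∀ᶠ y in 𝓝 x, Function.invFunOn φ Ω (φ y) = y := by
      filter_upwards [ho.mem_nhds hx] with y hy using hl y hy
    have h := HasDerivAt.of_local_left_inverse (continuousAt_leftInverse hmap hev)
      (by rw [hl x hx]; exact hd.hasDerivAt) (hφ.deriv_ne x hx)
      (eventually_rightInverse hmap hev)
    refine ⟨h.differentiableAt, ?_⟩
    rw [h.deriv]
    exact inv_ne_zero (hφ.deriv_ne x hx)

/-- The graph of a solution over the disk of radius `ρ` is parametrized by a harmonic map of the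
unit disk, whose dilatation is minus the square of the Gauss map `Q`. -/
theorem IsIsothermal.exists_isHarmonicDiskMap (I : IsIsothermal ζ n c A) {ρ : ℝ} (h0 : 0 < ρ)
    (hρ : ρ < 1) :
    ∃ h g Q : ℂ → ℂ, IsHarmonicDiskMap h g ∧ DifferentiableOn ℂ Q (ball 0 1) ∧
      MapsTo Q (ball 0 1) (ball 0 1) ∧
      (∀ z ∈ ball (0 : ℂ) 1, deriv g z = -Q z ^ 2 * deriv h z) ∧ Q 0 = n 0 ∧
      deriv Q 0 = c 0 * (2 * ρ * deriv h 0) := by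
  have hsub : ball (0 : ℂ) ρ ⊆ ball 0 1 := ball_subset_ball hρ.le
  have hcl : closedBall (0 : ℂ) ρ ⊆ ball 0 1 := closedBall_subset_ball hρ
  have hzc : ContinuousOn ζ (ball 0 1) :=
    fun w hw => (I.hasFDerivAt w hw).continuousAt.continuousWithinAt
  have ho : IsOpen (ζ '' ball 0 ρ) := I.isOpen_image hρ.le
  have hbd : Bornology.IsBounded (ζ '' ball 0 ρ) :=
    ((isCompact_closedBall (0 : ℂ) ρ).image_of_continuousOn (hzc.mono hcl)).isBounded.subset
      (image_mono ball_subset_closedBall)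
  have hΩ0 : (0 : ℂ) ∈ ζ '' ball 0 ρ := ⟨0, mem_ball_self h0, I.map_zero⟩
  obtain ⟨φ, hφ, hsurj⟩ := exists_riemannCandidate_surjOn ho
    ((convex_ball (0 : ℂ) ρ).isPreconnected.image ζ (hzc.mono hsub)) hbd hΩ0
    (fun φ h1 h2 => I.exists_sqrt h0 hρ.le h1 h2)
  obtain ⟨Ψ, hΨl, hΨr, hΨd⟩ := hφ.exists_inverse ho hsurj
  have hΨ0 : Ψ 0 = 0 := by
    have := hΨl 0 hΩ0
    rwa [hφ.map_zero] at this
  have hw : ∀ z ∈ ball (0 : ℂ) 1, ∃ w ∈ ball (0 : ℂ) ρ, ζ w = Ψ z ∧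
      IsIsothermal.inverse ζ (Ψ z) = w := by
    intro z hz
    obtain ⟨w, hw, he⟩ := (hΨr z hz).1
    exact ⟨w, hw, he, by rw [← he, I.inverse_apply (hsub hw)]⟩
  have hρc : (ρ : ℂ) ≠ 0 := by exact_mod_cast h0.ne'
  set k : ℂ := 1 / (2 * ρ) with hk
  have hk0 : k ≠ 0 := by
    rw [hk]
    exact one_div_ne_zero (mul_ne_zero two_ne_zero hρc)
  have hkc : (starRingEnd ℂ) k = k := by simp [hk, map_ofNat]
  set h : ℂ → ℂ := fun z => k * Ψ z with hh
  set g : ℂ → ℂ := fun z => k * (starRingEnd ℂ) (2 * IsIsothermal.inverse ζ (Ψ z) - Ψ z) with hg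
  set Q : ℂ → ℂ := fun z => n (IsIsothermal.inverse ζ (Ψ z)) with hQ
  have hdh : ∀ z ∈ ball (0 : ℂ) 1, HasDerivAt h (k * deriv Ψ z) z := fun z hz =>
    (hΨd z hz).1.hasDerivAt.const_mul k
  have hdg : ∀ z ∈ ball (0 : ℂ) 1, HasDerivAt g (k * (-(Q z) ^ 2 * deriv Ψ z)) z := by
    intro z hz
    obtain ⟨w, hwρ, hζ, hinv⟩ := hw z hz
    have h1 := I.hasDerivAt_conj_inverse (hsub hwρ)
    rw [hζ] at h1
    have h2 := (h1.comp z (hΨd z hz).1.hasDerivAt).const_mul k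
    simp only [hQ, hinv]
    exact h2
  have hdQ : ∀ z ∈ ball (0 : ℂ) 1,
      HasDerivAt Q (c (IsIsothermal.inverse ζ (Ψ z)) * deriv Ψ z) z := by
    intro z hz
    obtain ⟨w, hwρ, hζ, hinv⟩ := hw z hz
    have h1 := I.hasDerivAt_gauss_comp_inverse (hsub hwρ)
    rw [hζ] at h1
    rw [hinv]
    exact h1.comp z (hΨd z hz).1.hasDerivAt
  have hQ1 : ∀ z ∈ ball (0 : ℂ) 1, ‖Q z‖ < 1 := by
    intro z hz
    obtain ⟨w, hwρ, -, hinv⟩ := hw z hz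
    simp only [hQ, hinv]
    exact I.norm_lt_one w (hsub hwρ)
  have hinv0 : IsIsothermal.inverse ζ (Ψ 0) = 0 := by
    rw [hΨ0]
    conv_lhs => rw [← I.map_zero]
    exact I.inverse_apply (mem_ball_self one_pos)
  have hsum : ∀ z, h z + (starRingEnd ℂ) (g z) = IsIsothermal.inverse ζ (Ψ z) / ρ := by
    intro z
    simp only [hh, hg, map_mul, hkc, Complex.conj_conj]
    rw [hk]
    field_simp
    ring
  have hdgh : ∀ z ∈ ball (0 : ℂ) 1, deriv g z = -Q z ^ 2 * deriv h z := by
    intro z hz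
    rw [(hdg z hz).deriv, (hdh z hz).deriv]
    ring
  have h0b : (0 : ℂ) ∈ ball (0 : ℂ) 1 := mem_ball_self one_pos
  refine ⟨h, g, Q, ⟨fun z hz => (hdh z hz).differentiableAt.differentiableWithinAt,
    fun z hz => (hdg z hz).differentiableAt.differentiableWithinAt, by simp [hh, hΨ0],
    by simp only [hg, hinv0]; simp [hΨ0], fun z hz => ?_, fun z hz hz0 => ?_, ?_, ?_, ?_,
    fun z hz => ?_, fun ε hε => ?_⟩,
    fun z hz => (hdQ z hz).differentiableAt.differentiableWithinAt,
    fun z hz => by simpa using hQ1 z hz, hdgh, by simp only [hQ, hinv0], ?_⟩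
  · rw [hdgh z hz, norm_mul, norm_neg, norm_pow]
    exact mul_le_of_le_one_left (norm_nonneg _) (pow_le_one₀ (norm_nonneg _) (hQ1 z hz).le)
  · obtain ⟨w, hwρ, hζ, hinv⟩ := hw z hz
    simp only [hh, hg, hinv, norm_mul, Complex.norm_conj]
    refine mul_lt_mul_of_pos_left ?_ (norm_pos_iff.2 hk0)
    have hw0 : w ≠ 0 := by
      rintro rfl
      apply hz0
      rw [← (hΨr z hz).2, ← hζ, I.map_zero, hφ.map_zero]
    have hlt := I.re_mul_conj_lt (hsub hwρ) h0b hw0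
    rw [I.map_zero, sub_zero, sub_zero, hζ] at hlt
    have hexp : ‖2 * w - Ψ z‖ ^ 2 =
        4 * ‖w‖ ^ 2 - 4 * (Ψ z * (starRingEnd ℂ) w).re + ‖Ψ z‖ ^ 2 := by
      simp only [Complex.sq_norm, Complex.normSq_apply]
      simp
      ring
    refine lt_of_pow_lt_pow_left₀ 2 (norm_nonneg _) ?_
    rw [hexp]
    linarith
  · rw [(hdh 0 h0b).deriv]
    exact mul_ne_zero hk0 (hΨd 0 h0b).2
  · intro x hx y hy hxy
    have : Ψ x = Ψ y := mul_left_cancel₀ hk0 hxy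
    rw [← (hΨr x hx).2, ← (hΨr y hy).2, this]
  · obtain ⟨C, hC⟩ := hbd.exists_norm_le
    refine ⟨‖k‖ * C, fun z hz => ?_⟩
    simp only [hh, norm_mul]
    gcongr
    exact hC _ (hΨr z hz).1
  · obtain ⟨w, hwρ, hζ, hinv⟩ := hw z hz
    rw [hsum, hinv, norm_div, Complex.norm_real, Real.norm_of_nonneg h0.le, div_lt_one h0]
    simpa using hwρ
  · have hK : closedBall (0 : ℂ) (ρ * (1 - ε)) ⊆ ball 0 ρ :=
      closedBall_subset_ball (by nlinarith)
    have hcomp : IsCompact ((fun w => φ (ζ w)) '' closedBall (0 : ℂ) (ρ * (1 - ε))) := by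
      refine (isCompact_closedBall _ _).image_of_continuousOn ?_
      exact hφ.differentiableOn.continuousOn.comp (hzc.mono (hK.trans hsub))
        (fun w hw => mem_image_of_mem _ (hK hw))
    obtain ⟨r, hr, hr2⟩ := exists_lt_subset_ball hcomp.isClosed (x := (0 : ℂ)) (r := 1) (by
      rintro _ ⟨w, hw, rfl⟩
      exact hφ.mapsTo (mem_image_of_mem _ (hK hw)))
    refine ⟨r, hr, fun z hz1 hz2 => ?_⟩
    have hz : z ∈ ball (0 : ℂ) 1 := by simpa using hz2
    obtain ⟨w, hwρ, hζ, hinv⟩ := hw z hz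
    rw [hsum, hinv, norm_div, Complex.norm_real, Real.norm_of_nonneg h0.le, lt_div_iff₀ h0]
    by_contra hcon
    have hmem : w ∈ closedBall (0 : ℂ) (ρ * (1 - ε)) := by
      rw [mem_closedBall_zero_iff]
      linarith
    have := hr2 (mem_image_of_mem (fun w => φ (ζ w)) hmem)
    simp only [hζ, (hΨr z hz).2, mem_ball_zero_iff] at this
    linarith
  · rw [(hdQ 0 h0b).deriv, (hdh 0 h0b).deriv, hinv0, hk]
    field_simp

end HarmonicParametrization

section CurvatureBound

open Filter Topology Metric

theorem norm_deriv_zero_le_of_mapsTo_ball {Q : ℂ → ℂ} (hd : DifferentiableOn ℂ Q (ball 0 1))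
    (hm : MapsTo Q (ball 0 1) (ball 0 1)) : ‖deriv Q 0‖ ≤ 1 - ‖Q 0‖ ^ 2 := by
  have hlt : ∀ z ∈ ball (0 : ℂ) 1, ‖Q z‖ < 1 := fun z hz => by simpa using hm hz
  have h0b : (0 : ℂ) ∈ ball (0 : ℂ) 1 := mem_ball_self one_pos
  have hQ0 := hlt 0 h0b
  have hder : ∀ z ∈ ball (0 : ℂ) 1, HasDerivAt (fun z => diskAut (Q 0) (Q z))
      ((1 - (starRingEnd ℂ) (Q 0) * Q 0) / (1 - (starRingEnd ℂ) (Q 0) * Q z) ^ 2 * deriv Q z) z :=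
    fun z hz => (hasDerivAt_diskAut hQ0 (hlt z hz)).comp z
      ((hd z hz).differentiableAt (isOpen_ball.mem_nhds hz)).hasDerivAt
  have h := Complex.norm_deriv_le_div_of_mapsTo_ball (f := fun z => diskAut (Q 0) (Q z))
    (c := 0) (R₁ := 1) (R₂ := 1)
    (fun z hz => (hder z hz).differentiableAt.differentiableWithinAt) (fun z hz => by
      simpa [diskAut] using (norm_diskAut_lt_one hQ0 (hlt z hz)).le) one_pos
  have hc : (1 : ℂ) - (starRingEnd ℂ) (Q 0) * Q 0 = ((1 - ‖Q 0‖ ^ 2 : ℝ) : ℂ) := by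
    rw [mul_comm, Complex.mul_conj, Complex.normSq_eq_norm_sq]
    push_cast
    ring
  have hpos : 0 < 1 - ‖Q 0‖ ^ 2 := by nlinarith [norm_nonneg (Q 0)]
  rw [(hder 0 h0b).deriv, hc, norm_mul, norm_div, norm_pow, Complex.norm_real,
    Real.norm_of_nonneg hpos.le, div_one] at h
  have e : (1 - ‖Q 0‖ ^ 2) / (1 - ‖Q 0‖ ^ 2) ^ 2 * ‖deriv Q 0‖ =
      ‖deriv Q 0‖ / (1 - ‖Q 0‖ ^ 2) := by
    field_simp
  rwa [e, div_le_one hpos] at h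

theorem taylorCoeff_one (h : ℂ → ℂ) : taylorCoeff h 1 = deriv h 0 := by
  simp [taylorCoeff]

theorem taylorCoeff_two (h : ℂ → ℂ) : taylorCoeff h 2 = deriv (deriv h) 0 / 2 := by
  simp [taylorCoeff, iteratedDeriv_succ, div_eq_inv_mul]

/-- The second coefficient of the co-analytic part, in terms of the Gauss map. -/
theorem taylorCoeff_two_of_dilatation {h g Q : ℂ → ℂ} (hh : DifferentiableOn ℂ h (ball 0 1))
    (hQ : DifferentiableOn ℂ Q (ball 0 1))
    (hgh : ∀ z ∈ ball (0 : ℂ) 1, deriv g z = -Q z ^ 2 * deriv h z) :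
    taylorCoeff g 2 =
      -(Q 0 * deriv Q 0 * taylorCoeff h 1 + Q 0 ^ 2 * taylorCoeff h 2) := by
  have h0b : (0 : ℂ) ∈ ball (0 : ℂ) 1 := mem_ball_self one_pos
  have hnhds := isOpen_ball.mem_nhds h0b
  have h1 : HasDerivAt (deriv h) (deriv (deriv h) 0) 0 :=
    ((hh.deriv isOpen_ball 0 h0b).differentiableAt hnhds).hasDerivAt
  have h2 : HasDerivAt Q (deriv Q 0) 0 := ((hQ 0 h0b).differentiableAt hnhds).hasDerivAt
  have h3 := ((h2.fun_pow 2).fun_neg).fun_mul h1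
  have h4 : deriv (deriv g) 0 = _ :=
    (h3.congr_of_eventuallyEq (by filter_upwards [hnhds] with z hz using hgh z hz)).deriv
  rw [taylorCoeff_two, taylorCoeff_two, taylorCoeff_one, h4]
  push_cast
  ring

theorem sq_norm_coeff_le {q d a b : ℂ} (hd : ‖d‖ ≤ 1 - ‖q‖ ^ 2) :
    ‖-(q * d * a + q ^ 2 * b)‖ ^ 2 ≤
      ‖q‖ ^ 2 * (1 - ‖q‖ ^ 2) * ‖a‖ ^ 2 + ‖q‖ ^ 2 * ‖b‖ ^ 2 := by
  have h1 : ‖-(q * d * a + q ^ 2 * b)‖ ≤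
      (1 - ‖q‖ ^ 2) * (‖q‖ * ‖a‖) + ‖q‖ ^ 2 * ‖b‖ := by
    rw [norm_neg]
    refine (norm_add_le _ _).trans ?_
    rw [norm_mul, norm_mul, norm_mul, norm_pow]
    have : ‖d‖ * (‖q‖ * ‖a‖) ≤ (1 - ‖q‖ ^ 2) * (‖q‖ * ‖a‖) := by gcongr
    linarith
  have hv : 0 ≤ 1 - ‖q‖ ^ 2 := (norm_nonneg d).trans hd
  calc ‖-(q * d * a + q ^ 2 * b)‖ ^ 2
      ≤ ((1 - ‖q‖ ^ 2) * (‖q‖ * ‖a‖) + ‖q‖ ^ 2 * ‖b‖) ^ 2 := by gcongr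
    _ ≤ (1 - ‖q‖ ^ 2) * (‖q‖ * ‖a‖) ^ 2 + ‖q‖ ^ 2 * ‖b‖ ^ 2 := by
        nlinarith [mul_nonneg (mul_nonneg hv (sq_nonneg ‖q‖)) (sq_nonneg (‖q‖ * ‖a‖ - ‖b‖))]
    _ = _ := by ring

theorem IsIsothermal.curvature_lt {ζ n c : ℂ → ℂ} {A : ℂ → ℝ} (I : IsIsothermal ζ n c A) :
    4 * A 0 ^ 2 * ‖c 0‖ ^ 2 < 5.8 := by
  have h0b : (0 : ℂ) ∈ ball (0 : ℂ) 1 := mem_ball_self one_pos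
  obtain ⟨h, g, Q, H, hQd, hQm, hgh, hQ0, hQ1⟩ :=
    I.exists_isHarmonicDiskMap (ρ := 999 / 1000) (by norm_num) (by norm_num)
  have hSP := norm_deriv_zero_le_of_mapsTo_ball hQd hQm
  have hlow := coeff_lower_bound (x₁ := ‖taylorCoeff h 1‖ ^ 2) (x₂ := ‖taylorCoeff h 2‖ ^ 2)
    (y₁ := ‖taylorCoeff g 1‖ ^ 2) (y₂ := ‖taylorCoeff g 2‖ ^ 2) (v := ‖Q 0‖ ^ 2)
    (by positivity) (by positivity) (by linarith [norm_nonneg (deriv Q 0)])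
    (by rw [taylorCoeff_one, taylorCoeff_one, hgh 0 h0b, norm_mul, norm_neg, norm_pow]; ring)
    (by
      rw [taylorCoeff_two_of_dilatation H.diff_left hQd hgh]
      exact sq_norm_coeff_le hSP)
    (fun A hA0 hA1 => harmonicDiskMap_coeff_inequality H hA0 hA1)
  have hscale := I.scale 0 h0b
  have hn := I.norm_lt_one 0 h0b
  rw [← hQ0] at hscale hn
  rw [hQ1, norm_mul] at hSP
  rw [taylorCoeff_one] at hlow
  have hnorm : ‖2 * ((999 / 1000 : ℝ) : ℂ) * deriv h 0‖ = 999 / 500 * ‖deriv h 0‖ := by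
    rw [norm_mul, norm_mul, Complex.norm_real]
    norm_num
  rw [hnorm] at hSP
  set v := ‖Q 0‖ ^ 2 with hv
  have hv1 : v < 1 := pow_lt_one₀ (norm_nonneg _) hn two_ne_zero
  have hv0 : 0 ≤ v := by positivity
  have hA : A 0 * (1 - v) * (1 + v) = 2 := by
    rw [← hscale, hv]; ring
  have hApos : 0 < A 0 := by
    by_contra hneg
    have : A 0 * ((1 - v) * (1 + v)) ≤ 0 :=
      mul_nonpos_of_nonpos_of_nonneg (not_lt.1 hneg) (mul_nonneg (by linarith) (by linarith))
    linarith
  set x := ‖deriv h 0‖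
  have hx : 0 ≤ x := norm_nonneg _
  have hc := norm_nonneg (c 0)
  set κ := A 0 * ‖c 0‖ with hκ
  have h1 : κ * (1 + v) * (999 / 500 * x) ≤ 2 := by
    rw [← hA]
    calc κ * (1 + v) * (999 / 500 * x) = A 0 * (1 + v) * (‖c 0‖ * (999 / 500 * x)) := by
          rw [hκ]; ring
      _ ≤ A 0 * (1 + v) * (1 - v) := by gcongr
      _ = _ := by ring
  have hκ0 : 0 ≤ κ := by positivity
  have h2 : (κ * (1 + v) * (999 / 500 * x)) ^ 2 ≤ 2 ^ 2 := by gcongr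
  have h3 : κ ^ 2 * (695 / 1000) ≤ κ ^ 2 * (x ^ 2 * (1 + v) ^ 2) := by gcongr
  have h4 : 4 * A 0 ^ 2 * ‖c 0‖ ^ 2 = 4 * κ ^ 2 := by rw [hκ]; ring
  rw [h4]
  nlinarith

end CurvatureBound

/-- **Kalaj, Corollary (Hopf constant improvement).**  For any `C²` solution of the
minimal surface equation on the unit disk, `W² |K| < 5.8` at the point above the origin,
where `W² = 1 + f_u(0,0)² + f_v(0,0)²`. -/
theorem normalized_curvature_lt_five_point_eight (f : ℝ × ℝ → ℝ)
    (hreg : ContDiffOn ℝ 2 f unitDisk)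
    (hmin : MinimalSurfaceEq f unitDisk) :
    (1 + (pdu f (0, 0)) ^ 2 + (pdv f (0, 0)) ^ 2) * |gaussCurv f (0, 0)| < 5.8 := by
  obtain ⟨hu, hv, huv⟩ := contDiffOn_pd hreg
  obtain ⟨ζ, n, c, A, I, hI⟩ := exists_isIsothermal
    (p := fun z => pdu f (Complex.equivRealProdCLM z))
    (q := fun z => pdv f (Complex.equivRealProdCLM z))
    (r := fun z => pdu (pdu f) (Complex.equivRealProdCLM z))
    (s := fun z => pdv (pdu f) (Complex.equivRealProdCLM z))
    (t := fun z => pdv (pdv f) (Complex.equivRealProdCLM z))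
    (fun z hz => hasFDerivAt_comp_equivRealProd (hu _ (equivRealProd_mem_unitDisk hz)))
    (fun z hz => by
      rw [← huv _ (equivRealProd_mem_unitDisk hz)]
      exact hasFDerivAt_comp_equivRealProd (hv _ (equivRealProd_mem_unitDisk hz)))
    (fun z hz => hmin _ (equivRealProd_mem_unitDisk hz))
  have hlt := I.curvature_lt
  have h00 : Complex.equivRealProdCLM 0 = ((0, 0) : ℝ × ℝ) := map_zero _
  rw [hI, h00] at hlt
  have hnonneg : 0 ≤ 4 * A 0 ^ 2 * ‖c 0‖ ^ 2 := by positivity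
  rw [hI, h00] at hnonneg
  set W := 1 + pdu f (0, 0) ^ 2 + pdv f (0, 0) ^ 2 with hW
  have hWpos : 0 < W := by positivity
  have e : W * |gaussCurv f (0, 0)| =
      |(pdv (pdu f) (0, 0) ^ 2 - pdu (pdu f) (0, 0) * pdv (pdv f) (0, 0)) / W| := by
    rw [gaussCurv, ← hW, abs_div, abs_div, abs_sub_comm, abs_of_pos hWpos,
      abs_of_pos (pow_pos hWpos 2)]
    field_simp
  rw [e, abs_of_nonneg hnonneg]
  exact hlt
end

section
/- Let t₀ = 2·arctan(√((√5 − 1)/2)). For t ∈ (t₀, π/2], set r(t) = tan((π/8)·√(cos t)·sin t / sin³(t/2)) and κ(t) = π (1 − r(t)⁴) cos(t/2) / (2((1 + r(t)²) cos(t/2) + 2 r(t) √(cos t))²). Then κ is strictly increasing on (t₀, π/2], κ(t) → 0 as t → t₀⁺, and κ(π/2) = π/√2; consequently 0 < κ(t) ≤ π/√2 for all t ∈ (t₀, π/2]. -/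
open Real Set Filter

/-- `t₀ = 2 arctan √((√5 − 1)/2)`. -/
noncomputable def t0 : ℝ := 2 * Real.arctan (Real.sqrt ((Real.sqrt 5 - 1) / 2))

/-- `r(t) = tan((π/8)·√(cos t)·sin t / sin³(t/2))`. -/
noncomputable def rOf (t : ℝ) : ℝ :=
  Real.tan (Real.pi / 8 * Real.sqrt (Real.cos t) * Real.sin t / Real.sin (t / 2) ^ 3)

/-- `κ(t) = π (1 − r⁴) cos(t/2) / (2((1 + r²) cos(t/2) + 2 r √(cos t))²)`. -/
noncomputable def kappa (t : ℝ) : ℝ :=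
  Real.pi * (1 - rOf t ^ 4) * Real.cos (t / 2) /
    (2 * ((1 + rOf t ^ 2) * Real.cos (t / 2) + 2 * rOf t * Real.sqrt (Real.cos t)) ^ 2)

/-- The ratio `w(t) = √(cos t) cos(t/2) / sin²(t/2)`, for which `r(t) = tan ((π/4) w(t))`;
the condition `r(t₀) = 1` becomes `w(t₀) = 1`. -/
noncomputable def angleRatio (t : ℝ) : ℝ :=
  √(cos t) * cos (t / 2) / sin (t / 2) ^ 2

lemma cos_eq_two_mul_cos_half_sq_sub_one (t : ℝ) : cos t = 2 * cos (t / 2) ^ 2 - 1 := by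
  rw [← cos_two_mul]; ring_nf

lemma rOf_eq_tan_angleRatio {t : ℝ} (hs : sin (t / 2) ≠ 0) :
    rOf t = tan (π / 4 * angleRatio t) := by
  have h : sin t = 2 * sin (t / 2) * cos (t / 2) := by
    rw [← sin_two_mul]; ring_nf
  unfold rOf angleRatio
  rw [h]
  congr 1
  field_simp
  ring

/-- In terms of the double angle, `κ = (π/2) cos φ · c / (c + sin φ √(cos t))²`
with `c = cos(t/2)` and `φ = (π/2) w(t)`. -/
lemma kappa_eq_of_cos_ne_zero {t : ℝ} (hs : sin (t / 2) ≠ 0)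
    (hc : cos (π / 4 * angleRatio t) ≠ 0) :
    kappa t = π / 2 * cos (π / 2 * angleRatio t) * cos (t / 2) /
      (cos (t / 2) + sin (π / 2 * angleRatio t) * √(cos t)) ^ 2 := by
  have hφ : π / 2 * angleRatio t = 2 * (π / 4 * angleRatio t) := by ring
  unfold kappa
  rw [rOf_eq_tan_angleRatio hs, hφ, cos_two_mul, sin_two_mul, tan_eq_sin_div_cos]
  set θ := π / 4 * angleRatio t
  have hs2 : sin θ ^ 2 = 1 - cos θ ^ 2 := sin_sq θ
  have hden : (1 + (sin θ / cos θ) ^ 2) * cos (t / 2) + 2 * (sin θ / cos θ) * √(cos t) =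
      (cos (t / 2) + 2 * sin θ * cos θ * √(cos t)) / cos θ ^ 2 := by
    rw [div_pow, hs2]; field_simp; ring
  have hnum : 1 - (sin θ / cos θ) ^ 4 = (2 * cos θ ^ 2 - 1) / cos θ ^ 4 := by
    rw [div_pow, show sin θ ^ 4 = (sin θ ^ 2) ^ 2 by ring, hs2]; field_simp; ring
  rw [hden, hnum, div_pow]
  rcases eq_or_ne (cos (t / 2) + 2 * sin θ * cos θ * √(cos t)) 0 with h0 | h0
  · simp [h0]
  · field_simp

lemma sq_sqrt_golden : √((√5 - 1) / 2) ^ 2 = (√5 - 1) / 2 := by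
  refine sq_sqrt ?_
  have : (1 : ℝ) ≤ √5 := by rw [one_le_sqrt]; norm_num
  linarith

lemma t0_pos : 0 < t0 := by
  have h : (1 : ℝ) < √5 := by rw [lt_sqrt] <;> norm_num
  have : 0 < arctan √((√5 - 1) / 2) := arctan_pos.2 (sqrt_pos.2 (by linarith))
  unfold t0
  linarith

lemma t0_lt_pi_div_two : t0 < π / 2 := by
  have h : √5 < 3 := by rw [sqrt_lt] <;> norm_num
  have h1 : √((√5 - 1) / 2) < 1 := by rw [sqrt_lt'] <;> linarith
  have := arctan_strictMono h1
  rw [arctan_one] at this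
  unfold t0
  linarith

lemma cos_half_t0_sq : cos (t0 / 2) ^ 2 = (√5 - 1) / 2 := by
  have h5 : √5 ^ 2 = 5 := sq_sqrt (by norm_num)
  have hpos : 0 < √5 := by positivity
  rw [show t0 / 2 = arctan √((√5 - 1) / 2) by unfold t0; ring, cos_sq_arctan, sq_sqrt_golden]
  rw [div_eq_iff (by linarith)]
  nlinarith

section Range

variable {t : ℝ}

lemma cos_half_pos (ht : t ∈ Icc t0 (π / 2)) : 0 < cos (t / 2) :=
  cos_pos_of_mem_Ioo ⟨by linarith [ht.1, t0_pos, pi_pos], by linarith [ht.2, pi_pos]⟩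

lemma sin_half_pos (ht : t ∈ Icc t0 (π / 2)) : 0 < sin (t / 2) :=
  sin_pos_of_pos_of_lt_pi (by linarith [ht.1, t0_pos]) (by linarith [ht.2, pi_pos])

lemma cos_nonneg_of_mem (ht : t ∈ Icc t0 (π / 2)) : 0 ≤ cos t :=
  cos_nonneg_of_mem_Icc ⟨by linarith [ht.1, t0_pos, pi_pos], ht.2⟩

lemma angleRatio_nonneg (ht : t ∈ Icc t0 (π / 2)) : 0 ≤ angleRatio t := by
  have := cos_half_pos ht
  unfold angleRatio
  positivity

end Range

lemma angleRatio_t0 : angleRatio t0 = 1 := by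
  have ht : t0 ∈ Icc t0 (π / 2) := ⟨le_rfl, t0_lt_pi_div_two.le⟩
  have h5 : √5 ^ 2 = 5 := sq_sqrt (by norm_num)
  have hsq : angleRatio t0 ^ 2 = 1 := by
    have hs : sin (t0 / 2) ≠ 0 := (sin_half_pos ht).ne'
    unfold angleRatio
    rw [div_pow, mul_pow, sq_sqrt (cos_nonneg_of_mem ht), div_eq_one_iff_eq (by positivity),
      cos_eq_two_mul_cos_half_sq_sub_one, sin_sq, cos_half_t0_sq]
    nlinarith
  exact (pow_eq_one_iff_of_nonneg (angleRatio_nonneg ht) two_ne_zero).1 hsq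

lemma cos_half_strictAntiOn : StrictAntiOn (fun t => cos (t / 2)) (Icc t0 (π / 2)) := by
  intro a ha b hb hab
  exact strictAntiOn_cos ⟨by linarith [ha.1, t0_pos], by linarith [ha.2, pi_pos]⟩
    ⟨by linarith [hb.1, t0_pos], by linarith [hb.2, pi_pos]⟩ (by linarith)

lemma angleRatio_strictAntiOn : StrictAntiOn angleRatio (Icc t0 (π / 2)) := by
  intro a ha b hb hab
  have hc := cos_half_strictAntiOn ha hb hab
  have hcb := cos_half_pos hb
  have hs : sin (a / 2) ≤ sin (b / 2) := (strictMonoOn_sin.monotoneOn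
    ⟨by linarith [ha.1, t0_pos, pi_pos], by linarith [ha.2, pi_pos]⟩
    ⟨by linarith [hb.1, t0_pos, pi_pos], by linarith [hb.2, pi_pos]⟩ (by linarith))
  have hsa := sin_half_pos ha
  have hq : √(cos b) < √(cos a) := sqrt_lt_sqrt (cos_nonneg_of_mem hb) (by
    rw [cos_eq_two_mul_cos_half_sq_sub_one a, cos_eq_two_mul_cos_half_sq_sub_one b]
    simp only at hc
    nlinarith)
  unfold angleRatio
  calc √(cos b) * cos (b / 2) / sin (b / 2) ^ 2
      ≤ √(cos b) * cos (b / 2) / sin (a / 2) ^ 2 := by gcongr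
    _ < √(cos a) * cos (a / 2) / sin (a / 2) ^ 2 := by
        have : √(cos b) * cos (b / 2) < √(cos a) * cos (a / 2) :=
          mul_lt_mul hq hc.le hcb (sqrt_nonneg _)
        gcongr

lemma angleRatio_le_one {t : ℝ} (ht : t ∈ Icc t0 (π / 2)) : angleRatio t ≤ 1 :=
  angleRatio_t0 ▸ angleRatio_strictAntiOn.antitoneOn ⟨le_rfl, t0_lt_pi_div_two.le⟩ ht ht.1

lemma kappa_eq {t : ℝ} (ht : t ∈ Icc t0 (π / 2)) :
    kappa t = π / 2 * cos (π / 2 * angleRatio t) * cos (t / 2) /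
      (cos (t / 2) + sin (π / 2 * angleRatio t) * √(cos t)) ^ 2 := by
  have h0 := angleRatio_nonneg ht
  have h1 := angleRatio_le_one ht
  refine kappa_eq_of_cos_ne_zero (sin_half_pos ht).ne' (cos_pos_of_mem_Ioo ⟨?_, ?_⟩).ne' <;>
    nlinarith [pi_pos]

lemma sin_angle_nonneg {t : ℝ} (ht : t ∈ Icc t0 (π / 2)) : 0 ≤ sin (π / 2 * angleRatio t) := by
  have h0 := angleRatio_nonneg ht
  have h1 := angleRatio_le_one ht
  exact sin_nonneg_of_nonneg_of_le_pi (by positivity) (by nlinarith [pi_pos])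

lemma cos_angle_pos {t : ℝ} (ht : t ∈ Ioc t0 (π / 2)) : 0 < cos (π / 2 * angleRatio t) := by
  have h0 := angleRatio_nonneg (Ioc_subset_Icc_self ht)
  have h1 : angleRatio t < 1 := angleRatio_t0 ▸ angleRatio_strictAntiOn
    ⟨le_rfl, t0_lt_pi_div_two.le⟩ (Ioc_subset_Icc_self ht) ht.1
  exact cos_pos_of_mem_Ioo ⟨by nlinarith [pi_pos], by nlinarith [pi_pos]⟩

lemma kappa_pos {t : ℝ} (ht : t ∈ Ioc t0 (π / 2)) : 0 < kappa t := by
  have ht' := Ioc_subset_Icc_self ht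
  have hc := cos_half_pos ht'
  have hφ := cos_angle_pos ht
  have hs := sin_angle_nonneg ht'
  rw [kappa_eq ht']
  positivity

lemma kappa_strictMonoOn : StrictMonoOn kappa (Ioc t0 (π / 2)) := by
  intro a ha b hb hab
  have ha' := Ioc_subset_Icc_self ha
  have hb' := Ioc_subset_Icc_self hb
  have hφ := angleRatio_strictAntiOn ha' hb' hab
  have hc : cos (b / 2) < cos (a / 2) := cos_half_strictAntiOn ha' hb' hab
  have hca := cos_half_pos ha'
  have hcb := cos_half_pos hb'
  have hb0 := angleRatio_nonneg hb'
  have ha1 := angleRatio_le_one ha'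
  have hφπ : π / 2 * angleRatio b < π / 2 * angleRatio a := by gcongr
  have hb0π : 0 ≤ π / 2 * angleRatio b := by positivity
  have ha1π : π / 2 * angleRatio a ≤ π / 2 := by nlinarith [pi_pos]
  have hcos : cos (π / 2 * angleRatio a) < cos (π / 2 * angleRatio b) :=
    cos_lt_cos_of_nonneg_of_le_pi_div_two hb0π ha1π hφπ
  have hsin : sin (π / 2 * angleRatio b) ≤ sin (π / 2 * angleRatio a) :=
    sin_le_sin_of_le_of_le_pi_div_two (by linarith [pi_pos]) ha1π hφπ.le
  have hsb := sin_angle_nonneg hb'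
  have hsa := sin_angle_nonneg ha'
  have hcosb := cos_angle_pos hb
  have hq : √(cos b) / cos (b / 2) ≤ √(cos a) / cos (a / 2) := by
    rw [div_le_div_iff₀ hcb hca]
    refine (sq_le_sq₀ (by positivity) (by positivity)).1 ?_
    rw [mul_pow, mul_pow, sq_sqrt (cos_nonneg_of_mem ha'), sq_sqrt (cos_nonneg_of_mem hb'),
      cos_eq_two_mul_cos_half_sq_sub_one a, cos_eq_two_mul_cos_half_sq_sub_one b]
    nlinarith
  have key : ∀ t ∈ Icc t0 (π / 2), kappa t = π / 2 * (cos (π / 2 * angleRatio t) /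
      (cos (t / 2) * (1 + sin (π / 2 * angleRatio t) * (√(cos t) / cos (t / 2))) ^ 2)) := by
    intro t ht
    have hct := cos_half_pos ht
    have hst := sin_angle_nonneg ht
    have : 0 < cos (t / 2) + sin (π / 2 * angleRatio t) * √(cos t) := by positivity
    rw [kappa_eq ht]
    field_simp
  rw [key a ha', key b hb']
  gcongr

lemma tendsto_kappa_t0 : Tendsto kappa (nhdsWithin t0 (Ioi t0)) (nhds 0) := by
  have ht0 : t0 ∈ Icc t0 (π / 2) := ⟨le_rfl, t0_lt_pi_div_two.le⟩
  have hs := sin_half_pos ht0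
  have hc := cos_half_pos ht0
  have hcont : ContinuousAt angleRatio t0 := by
    unfold angleRatio
    exact ContinuousAt.div (by fun_prop) (by fun_prop) (by positivity)
  have hsin := sin_angle_nonneg ht0
  have hlim : ContinuousAt (fun t => π / 2 * cos (π / 2 * angleRatio t) * cos (t / 2) /
      (cos (t / 2) + sin (π / 2 * angleRatio t) * √(cos t)) ^ 2) t0 :=
    ContinuousAt.div (by fun_prop) (by fun_prop) (by positivity)
  have hlim' := hlim.tendsto.mono_left (nhdsWithin_le_nhds (s := Ioi t0))
  simp only [angleRatio_t0, mul_one, cos_pi_div_two, mul_zero, zero_mul, zero_div] at hlim'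
  refine hlim'.congr' ?_
  filter_upwards [Ioc_mem_nhdsGT t0_lt_pi_div_two] with t ht
  exact (kappa_eq (Ioc_subset_Icc_self ht)).symm

lemma kappa_pi_div_two : kappa (π / 2) = π / √2 := by
  rw [kappa_eq ⟨t0_lt_pi_div_two.le, le_rfl⟩]
  simp only [angleRatio, cos_pi_div_two, sqrt_zero, zero_mul, zero_div, mul_zero, cos_zero,
    sin_zero, add_zero, mul_one, show π / 2 / 2 = π / 4 by ring, cos_pi_div_four]
  field_simp

/-- **Monotonicity of the curvature function `κ`.** `κ` is strictly increasing on
`(t₀, π/2]`, tends to `0` as `t → t₀⁺`, `κ(π/2) = π/√2`, and `0 < κ(t) ≤ π/√2` on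
`(t₀, π/2]`. -/
theorem kappa_strictMono_and_bounds :
    StrictMonoOn kappa (Set.Ioc t0 (Real.pi / 2)) ∧
    Tendsto kappa (nhdsWithin t0 (Set.Ioi t0)) (nhds 0) ∧
    kappa (Real.pi / 2) = Real.pi / Real.sqrt 2 ∧
    ∀ t ∈ Set.Ioc t0 (Real.pi / 2), 0 < kappa t ∧ kappa t ≤ Real.pi / Real.sqrt 2 := by
  have hmem : π / 2 ∈ Ioc t0 (π / 2) := ⟨t0_lt_pi_div_two, le_rfl⟩
  refine ⟨kappa_strictMonoOn, tendsto_kappa_t0, kappa_pi_div_two, fun t ht => ⟨kappa_pos ht, ?_⟩⟩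
  exact kappa_pi_div_two ▸ kappa_strictMonoOn.monotoneOn ht hmem ht.2
end
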